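/- Upper bound on E11 root multiplicities up to height 240: for every nonzero n ∈ ℕ^{11} with ∑_i n_i ≤ 240 and nᵀ A(E11) n ≤ 2, the multiplicity of n in g(A(E11)) satisfies mult(n) ≤ p₉(1 − (nᵀ A(E11) n)/2). -/

import Mathlib

noncomputable section

open CartanMatrix

/-- A generalized Cartan matrix: `A i i = 2`, off-diagonal entries are non-positive, and
`A i j = 0 ↔ A j i = 0`. -/
def IsGCM {B : Type*} (A : Matrix B B ℤ) : Prop :=
  (∀ i, A i i = 2) ∧ (∀ i j, i ≠ j → A i j ≤ 0) ∧ (∀ i j, A i j = 0 ↔ A j i = 0)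

/-- The images in the Kac–Moody algebra `Matrix.ToLieAlgebra ℚ A` of the generators of the
free Lie algebra. -/
def KMgen {B : Type*} [DecidableEq B] (A : Matrix B B ℤ) (x : Generators B) :
    Matrix.ToLieAlgebra ℚ A :=
  LieSubmodule.Quotient.mk (N := Relations.toIdeal ℚ A) (FreeLieAlgebra.of ℚ x)

/-- The Cartan generator `h i`. -/
def gH {B : Type*} [DecidableEq B] (A : Matrix B B ℤ) (i : B) : Matrix.ToLieAlgebra ℚ A :=
  KMgen A (Generators.H i)

/-- The raising generator `e i`. -/
def gE {B : Type*} [DecidableEq B] (A : Matrix B B ℤ) (i : B) : Matrix.ToLieAlgebra ℚ A :=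
  KMgen A (Generators.E i)

/-- The lowering generator `f i`. -/
def gF {B : Type*} [DecidableEq B] (A : Matrix B B ℤ) (i : B) : Matrix.ToLieAlgebra ℚ A :=
  KMgen A (Generators.F i)

/-- The root space of `g(A)` attached to `n : B → ℤ`: the simultaneous eigenspace of the
adjoint action of the Cartan generators `h i`, with eigenvalues `∑ j, A i j * n j`. -/
def rootSpace {B : Type*} [Fintype B] [DecidableEq B] (A : Matrix B B ℤ) (n : B → ℤ) :
    Submodule ℚ (Matrix.ToLieAlgebra ℚ A) :=
  ⨅ i, Module.End.eigenspace
    (LieAlgebra.ad ℚ (Matrix.ToLieAlgebra ℚ A) (gH A i)) ((∑ j, A i j * n j : ℤ) : ℚ)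

/-- The multiplicity of `n` in `g(A)`: the dimension of the root space. -/
def rootMult {B : Type*} [Fintype B] [DecidableEq B] (A : Matrix B B ℤ) (n : B → ℤ) : ℕ :=
  Module.finrank ℚ (rootSpace A n)

/-- The Cartan matrix of `E11` (node 1 ↦ index `0` is the very extended node; indices `0`–`9`
form a chain and index `10` is attached to index `7`). -/
def E11M : Matrix (Fin 11) (Fin 11) ℤ := fun i j =>
  if i = j then 2
  else if (i.val + 1 = j.val ∧ j.val ≤ 9) ∨ (j.val + 1 = i.val ∧ i.val ≤ 9) ∨
          (i.val = 7 ∧ j.val = 10) ∨ (i.val = 10 ∧ j.val = 7) then -1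
  else 0

/-- The number of partitions of `k` into parts of `c` colours: the number of finitely
supported functions `f : ℕ+ × Fin c → ℕ` with `∑ j·f(j,s) = k` (so that
`∑ k, p_c(k) qᵏ = ∏_{j ≥ 1} (1 - qʲ)⁻ᶜ`), with `p_c(k) = 0` for `k < 0`. -/
def coloredPartitions (c : ℕ) (k : ℤ) : ℕ :=
  if k < 0 then 0
  else Nat.card {f : ℕ+ × Fin c →₀ ℕ // ∑ p ∈ f.support, (p.1 : ℕ) * f p = k.toNat}

/-- The norm `nᵀ A n` of a vector of natural numbers with respect to a Cartan matrix. -/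
def qform {d : ℕ} (A : Matrix (Fin d) (Fin d) ℤ) (n : Fin d → ℕ) : ℤ :=
  ∑ i, ∑ j, (n i : ℤ) * A i j * (n j : ℤ)

set_option linter.all false

set_option linter.unusedSectionVars false
namespace E11B

/-- Chevalley–Serre relations for a simply laced matrix. -/
structure KMRel {ι : Type} (M : Matrix ι ι ℤ) {L : Type} [LieRing L] [LieAlgebra ℚ L]
    (h e f : ι → L) : Prop where
  hh : ∀ i j, ⁅h i, h j⁆ = 0
  ef : ∀ i, ⁅e i, f i⁆ = h i
  ef' : ∀ i j, i ≠ j → ⁅e i, f j⁆ = 0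
  he : ∀ i j, ⁅h i, e j⁆ = (M i j : ℚ) • e j
  hf : ∀ i j, ⁅h i, f j⁆ = -((M i j : ℚ) • f j)
  ee0 : ∀ i j, M i j = 0 → ⁅e i, e j⁆ = 0
  ee1 : ∀ i j, M i j = -1 → ⁅e i, ⁅e i, e j⁆⁆ = 0
  ff0 : ∀ i j, M i j = 0 → ⁅f i, f j⁆ = 0
  ff1 : ∀ i j, M i j = -1 → ⁅f i, ⁅f i, f j⁆⁆ = 0

/-- Conditions on the matrix. -/
structure SLM {ι : Type} [Fintype ι] (M : Matrix ι ι ℤ) : Prop where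
  diag : ∀ i, M i i = 2
  off : ∀ i j, i ≠ j → M i j = 0 ∨ M i j = -1
  sym : ∀ i j, M i j = M j i
  inj : ∀ n : ι → ℤ, M.mulVec n = 0 → n = 0

variable {ι : Type} [Fintype ι] [DecidableEq ι] {M : Matrix ι ι ℤ}
  {L : Type} [LieRing L] [LieAlgebra ℚ L] {h e f : ι → L}

/-- Chevalley involution. -/
theorem KMRel.swap (K : KMRel M h e f) : KMRel M (fun i => - h i) f e where
  hh i j := by simp [K.hh]
  ef i := by rw [← lie_skew, K.ef]
  ef' i j hij := by rw [← lie_skew, K.ef' j i hij.symm, neg_zero]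
  he i j := by simp [K.hf]
  hf i j := by simp [K.he]
  ee0 := K.ff0
  ee1 := K.ff1
  ff0 := K.ee0
  ff1 := K.ee1

/-- iterated brackets -/
def word (e : ι → L) : List ι → L
  | [] => 0
  | [i] => e i
  | i :: j :: l => ⁅e i, word e (j :: l)⁆

/-- span of iterated brackets -/
def NN (e : ι → L) : Submodule ℚ L := Submodule.span ℚ (Set.range (word e))

theorem word_cons (e : ι → L) (i : ι) {l : List ι} (hl : l ≠ []) :
    word e (i :: l) = ⁅e i, word e l⁆ := by
  cases l with
  | nil => exact absurd rfl hl
  | cons j l => rfl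

theorem word_mem (e : ι → L) (l : List ι) : word e l ∈ NN e := Submodule.subset_span ⟨l, rfl⟩

theorem e_mem (e : ι → L) (i : ι) : e i ∈ NN e := word_mem e [i]

theorem lie_e_NN (e : ι → L) (i : ι) {x : L} (hx : x ∈ NN e) : ⁅e i, x⁆ ∈ NN e := by
  induction hx using Submodule.span_induction with
  | mem x hx =>
    obtain ⟨l, rfl⟩ := hx
    by_cases hl : l = []
    · subst hl; simp [word]
    · rw [← word_cons e i hl]; exact word_mem e _
  | zero => simp
  | add x y _ _ hx hy => rw [lie_add]; exact add_mem hx hy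
  | smul a x _ hx => rw [lie_smul]; exact Submodule.smul_mem _ _ hx

def HH (h : ι → L) : Submodule ℚ L := Submodule.span ℚ (Set.range h)

theorem h_mem (h : ι → L) (i : ι) : h i ∈ HH h := Submodule.subset_span ⟨i, rfl⟩

theorem HH_neg (h : ι → L) : HH (fun i => - h i) = HH h := by
  apply le_antisymm <;> refine Submodule.span_le.2 ?_
  · rintro _ ⟨i, rfl⟩; exact neg_mem (h_mem h i)
  · rintro _ ⟨i, rfl⟩
    have := neg_mem (h_mem (fun i => - h i) i)
    simpa using this

theorem lie_h_word (K : KMRel M h e f) (i : ι) (l : List ι) :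
    ⁅h i, word e l⁆ = ((M.mulVec (fun j => (l.count j : ℤ)) i : ℤ) : ℚ) • word e l := by
  induction l with
  | nil => simp [word]
  | cons j l ih =>
    by_cases hl : l = []
    · subst hl
      simp [word, K.he, Matrix.mulVec, dotProduct, List.count_cons]
    · rw [word_cons e j hl, leibniz_lie, ih, K.he, lie_smul, smul_lie, ← add_smul]
      congr 1
      simp only [Matrix.mulVec, dotProduct, List.count_cons]
      push_cast
      simp only [mul_add, Finset.sum_add_distrib]
      simp [add_comm]

theorem lie_e_HH (K : KMRel M h e f) (i : ι) {x : L} (hx : x ∈ HH h) : ⁅e i, x⁆ ∈ NN e := by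
  induction hx using Submodule.span_induction with
  | mem x hx =>
    obtain ⟨j, rfl⟩ := hx
    rw [← lie_skew, K.he]
    exact neg_mem (Submodule.smul_mem _ _ (e_mem e i))
  | zero => simp
  | add x y _ _ hx hy => rw [lie_add]; exact add_mem hx hy
  | smul a x _ hx => rw [lie_smul]; exact Submodule.smul_mem _ _ hx

theorem lie_f_word (K : KMRel M h e f) (i : ι) (l : List ι) : ⁅f i, word e l⁆ ∈ NN e ⊔ HH h := by
  induction l with
  | nil => simp [word]
  | cons j l ih =>
    have hfe : ⁅f i, e j⁆ = if i = j then - h i else 0 := by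
      split_ifs with hij
      · subst hij; rw [← lie_skew, K.ef]
      · rw [← lie_skew, K.ef' j i (Ne.symm hij), neg_zero]
    by_cases hl : l = []
    · subst hl
      simp only [word, hfe]
      apply Submodule.mem_sup_right
      split_ifs
      · exact neg_mem (h_mem h i)
      · exact zero_mem _
    · rw [word_cons e j hl, leibniz_lie, hfe]
      apply Submodule.mem_sup_left
      refine add_mem ?_ ?_
      · split_ifs
        · rw [neg_lie, lie_h_word K]
          exact neg_mem (Submodule.smul_mem _ _ (word_mem e l))
        · simp
      · obtain ⟨a, ha, b, hb, hab⟩ := Submodule.mem_sup.1 ih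
        rw [← hab, lie_add]
        exact add_mem (lie_e_NN e j ha) (lie_e_HH K j hb)

theorem lie_f_NN (K : KMRel M h e f) (i : ι) {x : L} (hx : x ∈ NN e) :
    ⁅f i, x⁆ ∈ NN e ⊔ HH h := by
  induction hx using Submodule.span_induction with
  | mem x hx => obtain ⟨l, rfl⟩ := hx; exact lie_f_word K i l
  | zero => simp
  | add x y _ _ hx hy => rw [lie_add]; exact add_mem hx hy
  | smul a x _ hx => rw [lie_smul]; exact Submodule.smul_mem _ _ hx

theorem top_le (K : KMRel M h e f)
    (gen : LieSubalgebra.lieSpan ℚ L (Set.range e ∪ Set.range f) = ⊤) (x : L) :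
    x ∈ NN e ⊔ HH h ⊔ NN f := by
  set S := NN e ⊔ HH h ⊔ NN f with hS
  have hee : ∀ i, ∀ x ∈ S, ⁅e i, x⁆ ∈ S := by
    intro i x hx
    obtain ⟨a', ha', c, hc, rfl⟩ := Submodule.mem_sup.1 hx
    obtain ⟨a, ha, b, hb, rfl⟩ := Submodule.mem_sup.1 ha'
    rw [lie_add, lie_add]
    refine add_mem (add_mem ?_ ?_) ?_
    · exact Submodule.mem_sup_left (Submodule.mem_sup_left (lie_e_NN e i ha))
    · exact Submodule.mem_sup_left (Submodule.mem_sup_left (lie_e_HH K i hb))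
    · have := lie_f_NN K.swap i hc
      rw [HH_neg] at this
      refine (sup_le ?_ ?_ : NN f ⊔ HH h ≤ S) this
      · exact le_sup_right
      · exact le_sup_of_le_left le_sup_right
  have hff : ∀ i, ∀ x ∈ S, ⁅f i, x⁆ ∈ S := by
    intro i x hx
    obtain ⟨a', ha', c, hc, rfl⟩ := Submodule.mem_sup.1 hx
    obtain ⟨a, ha, b, hb, rfl⟩ := Submodule.mem_sup.1 ha'
    rw [lie_add, lie_add]
    refine add_mem (add_mem ?_ ?_) ?_
    · exact Submodule.mem_sup_left (lie_f_NN K i ha)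
    · rw [← HH_neg] at hb
      exact Submodule.mem_sup_right (lie_e_HH K.swap i hb)
    · exact Submodule.mem_sup_right (lie_e_NN f i hc)
  -- the stabiliser
  let St : LieSubalgebra ℚ L :=
    { carrier := {x | ∀ s ∈ S, ⁅x, s⁆ ∈ S}
      add_mem' := fun {a b} ha hb s hs => by rw [add_lie]; exact add_mem (ha s hs) (hb s hs)
      zero_mem' := fun s _ => by simp
      smul_mem' := fun c x hx s hs => by rw [smul_lie]; exact Submodule.smul_mem _ _ (hx s hs)
      lie_mem' := fun {a b} ha hb s hs => by
        rw [lie_lie]; exact sub_mem (ha _ (hb s hs)) (hb _ (ha s hs)) }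
  have hSt : ∀ y : L, ∀ s ∈ S, ⁅y, s⁆ ∈ S := by
    have : LieSubalgebra.lieSpan ℚ L (Set.range e ∪ Set.range f) ≤ St := by
      rw [LieSubalgebra.lieSpan_le]
      rintro _ (⟨i, rfl⟩ | ⟨i, rfl⟩)
      · exact hee i
      · exact hff i
    rw [gen] at this
    intro y
    exact this (LieSubalgebra.mem_top y)
  let Sa : LieSubalgebra ℚ L := { S with lie_mem' := fun {a b} _ hb => hSt a b hb }
  have : LieSubalgebra.lieSpan ℚ L (Set.range e ∪ Set.range f) ≤ Sa := by
    rw [LieSubalgebra.lieSpan_le]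
    rintro _ (⟨i, rfl⟩ | ⟨i, rfl⟩)
    · exact Submodule.mem_sup_left (Submodule.mem_sup_left (e_mem e i))
    · exact Submodule.mem_sup_right (e_mem f i)
  rw [gen] at this
  exact this (LieSubalgebra.mem_top x)

end E11B

namespace E11B

/-- all the assumptions -/
structure Std {ι : Type} [Fintype ι] (M : Matrix ι ι ℤ) {L : Type} [LieRing L] [LieAlgebra ℚ L]
    (h e f : ι → L) : Prop extends KMRel M h e f, SLM M where
  gen : LieSubalgebra.lieSpan ℚ L (Set.range e ∪ Set.range f) = ⊤

/-- weight spaces -/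
def W {ι : Type} [Fintype ι] (M : Matrix ι ι ℤ) {L : Type} [LieRing L] [LieAlgebra ℚ L]
    (h : ι → L) (n : ι → ℤ) : Submodule ℚ L :=
  ⨅ i, Module.End.eigenspace (LieAlgebra.ad ℚ L (h i)) ((M.mulVec n i : ℤ) : ℚ)

variable {ι : Type} [Fintype ι] [DecidableEq ι] {M : Matrix ι ι ℤ}
  {L : Type} [LieRing L] [LieAlgebra ℚ L] {h e f : ι → L}

theorem mem_W {n : ι → ℤ} {x : L} :
    x ∈ W M h n ↔ ∀ i, ⁅h i, x⁆ = ((M.mulVec n i : ℤ) : ℚ) • x := by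
  simp [W, Submodule.mem_iInf, Module.End.mem_eigenspace_iff]

/-- content of a word -/
def cnt (l : List ι) : ι → ℤ := fun j => (l.count j : ℤ)

theorem cnt_cons (i : ι) (l : List ι) : cnt (i :: l) = Pi.single i 1 + cnt l := by
  funext j
  simp only [cnt, List.count_cons, Pi.add_apply, Pi.single_apply]
  push_cast
  by_cases hij : i = j
  · subst hij; simp; ring
  · simp [hij, Ne.symm hij]

theorem cnt_pos {l : List ι} (hl : l ≠ []) : 0 < cnt l := by
  obtain ⟨i, l, rfl⟩ := List.exists_cons_of_ne_nil hl
  refine lt_of_le_of_ne (fun j => by simp [cnt]) (fun h0 => ?_)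
  have := congrFun h0 i
  simp [cnt] at this
  omega

theorem word_W (K : KMRel M h e f) (l : List ι) : word e l ∈ W M h (cnt l) :=
  mem_W.2 fun i => lie_h_word K i l

theorem wordf_W (K : KMRel M h e f) (l : List ι) : word f l ∈ W M h (-cnt l) := by
  refine mem_W.2 fun i => ?_
  have := lie_h_word K.swap i l
  rw [Matrix.mulVec_neg]
  rw [neg_lie, neg_eq_iff_eq_neg] at this
  rw [this]
  simp [cnt]
  rfl

theorem h_W (K : KMRel M h e f) (i : ι) : h i ∈ W M h 0 :=
  mem_W.2 fun j => by simp [K.hh]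

theorem e_W (K : KMRel M h e f) (i : ι) : e i ∈ W M h (Pi.single i 1) :=
  mem_W.2 fun j => by simp [K.he]

theorem f_W (K : KMRel M h e f) (i : ι) : f i ∈ W M h (-Pi.single i 1) :=
  mem_W.2 fun j => by simp [K.hf, Matrix.mulVec_neg]

theorem lie_W {m n : ι → ℤ} {x y : L} (hx : x ∈ W M h m) (hy : y ∈ W M h n) :
    ⁅x, y⁆ ∈ W M h (m + n) := by
  refine mem_W.2 fun i => ?_
  rw [leibniz_lie, mem_W.1 hx, mem_W.1 hy, Matrix.mulVec_add, lie_smul, smul_lie, ← add_smul]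
  simp

theorem iSup_W (S : Std M h e f) : ⨆ n, W M h n = ⊤ := by
  rw [eq_top_iff]
  intro x _
  refine Set.mem_of_subset_of_mem (show (NN e ⊔ HH h ⊔ NN f : Submodule ℚ L) ≤ _ from
    sup_le (sup_le ?_ ?_) ?_) (top_le S.toKMRel S.gen x)
  · refine Submodule.span_le.2 ?_
    rintro _ ⟨l, rfl⟩
    exact Submodule.mem_iSup_of_mem _ (word_W S.toKMRel l)
  · refine Submodule.span_le.2 ?_
    rintro _ ⟨l, rfl⟩
    exact Submodule.mem_iSup_of_mem _ (h_W S.toKMRel l)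
  · refine Submodule.span_le.2 ?_
    rintro _ ⟨l, rfl⟩
    exact Submodule.mem_iSup_of_mem _ (wordf_W S.toKMRel l)

theorem indep_W (S : Std M h e f) : iSupIndep (W M h) := by
  have h1 := Module.End.independent_iInf_maxGenEigenspace_of_forall_mapsTo
    (fun i => LieAlgebra.ad ℚ L (h i)) (fun i j φ => by
      apply Module.End.mapsTo_maxGenEigenspace_of_comm
      ext x
      have := leibniz_lie (h i) (h j) x
      rw [S.hh, zero_lie, zero_add] at this
      simpa using this.symm)
  have h2 : Function.Injective (fun (n : ι → ℤ) (i : ι) => ((M.mulVec n i : ℤ) : ℚ)) := by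
    intro a b hab
    have : M.mulVec (a - b) = 0 := by
      funext i
      have := congrFun hab i
      simp only [Int.cast_inj] at this
      simp [Matrix.mulVec_sub, this]
    exact sub_eq_zero.1 (S.inj _ this)
  refine (h1.comp h2).mono fun n => ?_
  refine iInf_mono fun i => ?_
  exact Module.End.eigenspace_le_maxGenEigenspace

theorem compl_W (S : Std M h e f) (n : ι → ℤ) : IsCompl (W M h n) (⨆ m ≠ n, W M h m) := by
  refine ⟨indep_W S n, ?_⟩
  rw [codisjoint_iff, eq_top_iff, ← iSup_W S]
  refine iSup_le fun m => ?_
  by_cases hmn : m = n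
  · subst hmn; exact le_sup_left
  · exact le_sup_of_le_right (le_iSup₂_of_le m hmn le_rfl)

/-- projection on a weight space -/
def pr (S : Std M h e f) (n : ι → ℤ) : L →ₗ[ℚ] W M h n :=
  Submodule.projectionOnto _ _ (compl_W S n)

theorem pr_same (S : Std M h e f) {n : ι → ℤ} {x : L} (hx : x ∈ W M h n) :
    pr S n x = ⟨x, hx⟩ := Submodule.projectionOnto_apply_left (compl_W S n) ⟨x, hx⟩

theorem pr_same' (S : Std M h e f) {n : ι → ℤ} (x : W M h n) :
    pr S n x = x := Submodule.projectionOnto_apply_left (compl_W S n) x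

theorem pr_ne (S : Std M h e f) {m n : ι → ℤ} (hmn : m ≠ n) {x : L} (hx : x ∈ W M h m) :
    pr S n x = 0 := by
  apply (Submodule.projectionOnto_apply_eq_zero_iff (compl_W S n)).2
  exact Submodule.mem_iSup_of_mem m (Submodule.mem_iSup_of_mem hmn hx)

theorem W_le (S : Std M h e f) {n : ι → ℤ} (P : Submodule ℚ L)
    (he : ∀ l, l ≠ [] → cnt l = n → word e l ∈ P)
    (hf : ∀ l, l ≠ [] → -cnt l = n → word f l ∈ P)
    (hh : n = 0 → ∀ i, h i ∈ P) : W M h n ≤ P := by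
  have key : ∀ x : L, (pr S n x : L) ∈ P := by
    intro x
    have : (⊤ : Submodule ℚ L) ≤ P.comap ((W M h n).subtype ∘ₗ pr S n) := by
      intro x _
      refine Set.mem_of_subset_of_mem (show (NN e ⊔ HH h ⊔ NN f : Submodule ℚ L) ≤ _ from
    sup_le (sup_le ?_ ?_) ?_) (top_le S.toKMRel S.gen x)
      · refine Submodule.span_le.2 ?_
        rintro _ ⟨l, rfl⟩
        show (pr S n (word e l) : L) ∈ P
        by_cases hl : l = []
        · subst hl; simp [word]
        by_cases hc : cnt l = n
        · subst hc; rw [pr_same S (word_W S.toKMRel l)]; exact he l hl rfl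
        · rw [pr_ne S hc (word_W S.toKMRel l)]; simp
      · refine Submodule.span_le.2 ?_
        rintro _ ⟨i, rfl⟩
        show (pr S n (h i) : L) ∈ P
        by_cases hc : 0 = n
        · subst hc; rw [pr_same S (h_W S.toKMRel i)]; exact hh rfl i
        · rw [pr_ne S hc (h_W S.toKMRel i)]; simp
      · refine Submodule.span_le.2 ?_
        rintro _ ⟨l, rfl⟩
        show (pr S n (word f l) : L) ∈ P
        by_cases hl : l = []
        · subst hl; simp [word]
        by_cases hc : -cnt l = n
        · subst hc; rw [pr_same S (wordf_W S.toKMRel l)]; exact hf l hl rfl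
        · rw [pr_ne S hc (wordf_W S.toKMRel l)]; simp
    exact this (Submodule.mem_top (x := x))
  intro x hx
  have := key x
  rwa [pr_same S hx] at this

/-- words of given content -/
def wds (e : ι → L) (n : ι → ℤ) : Submodule ℚ L :=
  Submodule.span ℚ {x | ∃ l, l ≠ [] ∧ cnt l = n ∧ word e l = x}

theorem W_pos (S : Std M h e f) {n : ι → ℤ} (hn : 0 < n) : W M h n = wds e n := by
  apply le_antisymm
  · refine W_le S _ (fun l hl hc => Submodule.subset_span ⟨l, hl, hc, rfl⟩) ?_ ?_
    · intro l hl hc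
      have := cnt_pos hl
      rw [← hc, lt_neg, neg_zero] at hn
      exact absurd this hn.asymm
    · intro h0; exact absurd h0 hn.ne'
  · refine Submodule.span_le.2 ?_
    rintro _ ⟨l, _, rfl, rfl⟩
    exact word_W S.toKMRel l

theorem finite_words (n : ι → ℤ) : {l : List ι | cnt l = n}.Finite := by
  refine (List.finite_length_eq ι ((∑ i, n i).toNat)).subset ?_
  rintro l rfl
  simp only [Set.mem_ofPred_eq, cnt]
  rw [← Nat.cast_sum, Int.toNat_natCast]
  rw [← Multiset.coe_card, ← Multiset.sum_count_eq_card (s := Finset.univ) (by simp)]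
  simp

theorem W_fin (S : Std M h e f) {n : ι → ℤ} (hn : 0 < n) : Module.Finite ℚ (W M h n) := by
  rw [W_pos S hn]
  apply Module.Finite.span_of_finite
  refine ((finite_words n).image (word e)).subset ?_
  rintro _ ⟨l, _, hc, rfl⟩
  exact ⟨l, hc, rfl⟩

theorem W_mixed (S : Std M h e f) {n : ι → ℤ} {i j : ι} (hi : 0 < n i) (hj : n j < 0) :
    W M h n = ⊥ := by
  rw [eq_bot_iff]
  refine W_le S _ ?_ ?_ ?_
  · rintro l _ rfl; simp [cnt] at hj; omega
  · rintro l _ rfl; simp [cnt] at hi; omega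
  · rintro rfl; simp at hi

theorem cnt_single {l : List ι} {i : ι} {k : ℤ} (hc : cnt l = Pi.single i k) :
    l = List.replicate l.length i := by
  rw [List.eq_replicate_iff]
  refine ⟨rfl, fun b hb => ?_⟩
  by_contra hbi
  have := congrFun hc b
  simp only [cnt, Pi.single_apply, hbi, if_false] at this
  have := List.count_pos_iff.2 hb
  omega

theorem word_replicate (e : ι → L) (i : ι) (k : ℕ) : word e (List.replicate (k + 2) i) = 0 := by
  induction k with
  | zero => simp [word, List.replicate]
  | succ k ih =>
    rw [show k + 1 + 2 = (k + 2) + 1 by ring, List.replicate_succ, word_cons _ _ (by simp), ih]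
    simp

theorem W_simple (S : Std M h e f) (i : ι) : W M h (Pi.single i 1) ≤ Submodule.span ℚ {e i} := by
  have hp : (0 : ι → ℤ) < Pi.single i 1 := by simp
  rw [W_pos S hp]
  refine Submodule.span_le.2 ?_
  rintro _ ⟨l, hl, hc, rfl⟩
  have h1 := cnt_single hc
  have h2 := congrFun hc i
  rw [h1] at h2
  simp [cnt] at h2
  rw [h2] at h1
  rw [h1]
  exact Submodule.mem_span_singleton_self _

theorem W_multiple (S : Std M h e f) (i : ι) {k : ℤ} (hk : 2 ≤ k) :
    W M h (Pi.single i k) = ⊥ := by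
  have hp : (0 : ι → ℤ) < Pi.single i k := by simp; omega
  rw [W_pos S hp, eq_bot_iff]
  refine Submodule.span_le.2 ?_
  rintro _ ⟨l, hl, hc, rfl⟩
  have h1 := cnt_single hc
  have h2 := congrFun hc i
  rw [h1] at h2
  simp [cnt] at h2
  obtain ⟨j, hj⟩ : ∃ j, l.length = j + 2 := ⟨l.length - 2, by omega⟩
  rw [h1, hj, word_replicate]
  simp

/-- multiplicity -/
def mul' (M : Matrix ι ι ℤ) (h : ι → L) (n : ι → ℤ) : ℕ := Module.finrank ℚ (W M h n)

theorem mul'_simple (S : Std M h e f) (i : ι) : mul' M h (Pi.single i 1) ≤ 1 := by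
  refine (Submodule.finrank_mono (W_simple S i)).trans ?_
  exact (finrank_span_le_card _).trans (by simp)

theorem mul'_bot {n : ι → ℤ} (hn : W M h n = ⊥) : mul' M h n = 0 := by
  rw [mul', hn]; simp

end E11B

namespace E11B

variable {ι : Type} [Fintype ι] [DecidableEq ι] {M : Matrix ι ι ℤ}
  {L : Type} [LieRing L] [LieAlgebra ℚ L] {h e f : ι → L}

theorem nilp (S : Std M h e f) (i : ι) (x : L) : ∃ N : ℕ, (LieAlgebra.ad ℚ L (e i) ^ N) x = 0 := by
  rw [← LieSubalgebra.mem_engel_iff]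
  have : LieSubalgebra.lieSpan ℚ L (Set.range e ∪ Set.range f) ≤ LieSubalgebra.engel ℚ (e i) := by
    rw [LieSubalgebra.lieSpan_le]
    rintro _ (⟨j, rfl⟩ | ⟨j, rfl⟩)
    · show e j ∈ LieSubalgebra.engel ℚ (e i)
      rw [LieSubalgebra.mem_engel_iff]
      refine ⟨2, ?_⟩
      simp only [pow_two, Module.End.mul_apply, LieAlgebra.ad_apply]
      by_cases hij : i = j
      · subst hij; simp
      · rcases S.off i j hij with h0 | h1
        · rw [S.ee0 i j h0, lie_zero]
        · exact S.ee1 i j h1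
    · show f j ∈ LieSubalgebra.engel ℚ (e i)
      rw [LieSubalgebra.mem_engel_iff]
      refine ⟨3, ?_⟩
      simp only [pow_succ, pow_zero, one_mul, Module.End.mul_apply, LieAlgebra.ad_apply]
      by_cases hij : i = j
      · subst hij; rw [S.ef, ← lie_skew (e i) (h i), S.he]; simp
      · rw [S.ef' i j hij]; simp
  rw [S.gen] at this
  exact this (LieSubalgebra.mem_top x)

section sl2
variable {a b c : L}

theorem sl2_h (hbc : ⁅a, c⁆ = -((2 : ℚ) • c)) {y : L} {k : ℚ} (hy : ⁅a, y⁆ = k • y)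
    (j : ℕ) : ⁅a, (LieAlgebra.ad ℚ L c ^ j) y⁆ = (k - 2 * j) • (LieAlgebra.ad ℚ L c ^ j) y := by
  induction j with
  | zero => simp [hy]
  | succ j ih =>
    rw [pow_succ', Module.End.mul_apply, LieAlgebra.ad_apply, leibniz_lie, ih, hbc]
    simp only [neg_lie, smul_lie, lie_smul]
    push_cast
    module

theorem sl2_e (hab : ⁅b, c⁆ = a) (hbc : ⁅a, c⁆ = -((2 : ℚ) • c)) {y : L} {k : ℚ}
    (hy : ⁅a, y⁆ = k • y) (j : ℕ) : ⁅b, (LieAlgebra.ad ℚ L c ^ (j + 1)) y⁆ =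
      (LieAlgebra.ad ℚ L c ^ (j + 1)) ⁅b, y⁆ + ((j + 1) * (k - j)) • (LieAlgebra.ad ℚ L c ^ j) y := by
  induction j with
  | zero => simp only [zero_add, pow_one, pow_zero, LieAlgebra.ad_apply, Module.End.one_apply]
            rw [leibniz_lie, hab, hy]; simp [add_comm]
  | succ j ih =>
    rw [pow_succ', Module.End.mul_apply, LieAlgebra.ad_apply, leibniz_lie, ih, hab,
      sl2_h hbc hy, lie_add, lie_smul]
    rw [Module.End.mul_apply, LieAlgebra.ad_apply]
    have : ⁅c, (LieAlgebra.ad ℚ L c ^ j) y⁆ = (LieAlgebra.ad ℚ L c ^ (j + 1)) y := by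
      rw [pow_succ', Module.End.mul_apply, LieAlgebra.ad_apply]
    rw [this]
    push_cast
    module

theorem sl2_inj (hab : ⁅b, c⁆ = a) (hac : ⁅a, b⁆ = (2 : ℚ) • b) (hbc : ⁅a, c⁆ = -((2 : ℚ) • c))
    (N : ℕ) : ∀ (k : ℕ) (y : L), ⁅a, y⁆ = (k : ℚ) • y → 
      (LieAlgebra.ad ℚ L b ^ N) y = 0 → (LieAlgebra.ad ℚ L c ^ k) y = 0 → y = 0 := by
  induction N with
  | zero => intro k y _ h0 _; simpa using h0
  | succ N ih =>
    intro k y hy hN hk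
    have hk1 : (LieAlgebra.ad ℚ L c ^ (k + 1)) y = 0 := by
      rw [pow_succ', Module.End.mul_apply, hk, map_zero]
    have hk2 : (LieAlgebra.ad ℚ L c ^ (k + 2)) y = 0 := by
      rw [pow_succ', Module.End.mul_apply, hk1, map_zero]
    have hb : ⁅b, y⁆ = 0 := by
      refine ih (k + 2) ⁅b, y⁆ ?_ ?_ ?_
      · rw [leibniz_lie, hac, hy, smul_lie, lie_smul]; push_cast; module
      · rw [pow_succ, Module.End.mul_apply] at hN; exact hN
      · have := sl2_e hab hbc hy (k + 1)
        rw [hk1, hk2, lie_zero, smul_zero, add_zero] at this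
        exact this.symm
    have : ∀ d, d ≤ k → (LieAlgebra.ad ℚ L c ^ (k - d)) y = 0 := by
      intro d
      induction d with
      | zero => intro _; exact hk
      | succ d ihd =>
        intro hd
        have h1 := ihd (by omega)
        obtain ⟨j, hj⟩ : ∃ j, k - d = j + 1 := ⟨k - d - 1, by omega⟩
        have h2 := sl2_e hab hbc hy j
        rw [hb, map_zero, zero_add, ← hj, h1, lie_zero] at h2
        rw [show k - (d + 1) = j by omega]
        refine (smul_eq_zero.1 h2.symm).resolve_left ?_
        have hjk : (j : ℚ) < k := by exact_mod_cast (by omega : j < k)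
        have : (0 : ℚ) < ((j : ℚ) + 1) * (k - j) := by
          apply mul_pos
          · positivity
          · linarith
        exact this.ne'
    have := this k le_rfl
    simpa using this

end sl2

theorem pow_f_W (S : Std M h e f) (i : ι) {n : ι → ℤ} {x : L} (hx : x ∈ W M h n) (k : ℕ) :
    (LieAlgebra.ad ℚ L (f i) ^ k) x ∈ W M h (n - Pi.single i (k : ℤ)) := by
  induction k with
  | zero => simpa using hx
  | succ k ih =>
    rw [pow_succ', Module.End.mul_apply, LieAlgebra.ad_apply]
    have := lie_W (f_W S.toKMRel i) ih
    convert this using 1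
    push_cast
    rw [Pi.single_add]
    congr 1
    abel

theorem refl_inj (S : Std M h e f) (i : ι) {n : ι → ℤ} {k : ℕ} (hk : M.mulVec n i = k) {x : L}
    (hx : x ∈ W M h n) (h0 : (LieAlgebra.ad ℚ L (f i) ^ k) x = 0) : x = 0 := by
  obtain ⟨N, hN⟩ := nilp S i x
  refine sl2_inj (S.ef i) ?_ ?_ N k x ?_ hN h0
  · rw [S.he, S.diag]; simp
  · rw [S.hf, S.diag]; simp
  · rw [mem_W.1 hx, hk]; simp

theorem refl_bot (S : Std M h e f) (i : ι) {n : ι → ℤ} {k : ℕ} (hk : M.mulVec n i = k)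
    (h0 : W M h (n - Pi.single i (k : ℤ)) = ⊥) : W M h n = ⊥ := by
  rw [eq_bot_iff]
  intro x hx
  have := pow_f_W S i hx k
  rw [h0, Submodule.mem_bot] at this
  exact refl_inj S i hk hx this

theorem refl_le (S : Std M h e f) (i : ι) {n : ι → ℤ} {k : ℕ} (hk : M.mulVec n i = k)
    (h0 : 0 < n - Pi.single i (k : ℤ)) : mul' M h n ≤ mul' M h (n - Pi.single i (k : ℤ)) := by
  have := W_fin S h0
  refine LinearMap.finrank_le_finrank_of_injective
    (f := (LieAlgebra.ad ℚ L (f i) ^ k).restrict fun x hx => pow_f_W S i hx k) ?_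
  rw [← LinearMap.ker_eq_bot, LinearMap.ker_eq_bot']
  rintro ⟨x, hx⟩ h1
  have := congrArg Subtype.val h1
  simp only [LinearMap.restrict_coe_apply] at this
  exact Subtype.ext (refl_inj S i hk hx (by simpa using this))

end E11B

namespace E11B

open TensorProduct

variable {ι : Type} [Fintype ι] [DecidableEq ι] {M : Matrix ι ι ℤ}
  {L : Type} [LieRing L] [LieAlgebra ℚ L] {h e f : ι → L}

/-- a cocycle `L → L ⊗ L` -/
structure Coc (h e : ι → L) (δ : L →ₗ[ℚ] L ⊗[ℚ] L) : Prop where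
  coc : ∀ x y, δ ⁅x, y⁆ = ⁅x, δ y⁆ - ⁅y, δ x⁆
  ce : ∀ i, δ (e i) = e i ⊗ₜ h i - h i ⊗ₜ e i

/-- Cartan element -/
def hv (h : ι → L) (γ : ι → ℤ) : L := ∑ i, (γ i : ℚ) • h i

/-- bilinear form -/
def bil (M : Matrix ι ι ℤ) (γ β : ι → ℤ) : ℤ := ∑ i, γ i * M.mulVec β i

theorem bil_comm (S : SLM M) (γ β : ι → ℤ) : bil M γ β = bil M β γ := by
  simp only [bil, Matrix.mulVec, dotProduct, Finset.mul_sum]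
  rw [Finset.sum_comm]
  refine Finset.sum_congr rfl fun i _ => Finset.sum_congr rfl fun j _ => ?_
  rw [S.sym i j]; ring

theorem bil_add_left (a b c : ι → ℤ) : bil M (a + b) c = bil M a c + bil M b c := by
  simp [bil, add_mul, Finset.sum_add_distrib]

theorem bil_add_right (a b c : ι → ℤ) : bil M a (b + c) = bil M a b + bil M a c := by
  simp [bil, Matrix.mulVec_add, mul_add, Finset.sum_add_distrib]

theorem bil_single_left (i : ι) (c : ι → ℤ) : bil M (Pi.single i 1) c = M.mulVec c i := by
  simp [bil, Pi.single_apply]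

theorem hv_lie {γ β : ι → ℤ} {x : L} (hx : x ∈ W M h β) :
    ⁅hv h γ, x⁆ = (bil M γ β : ℚ) • x := by
  simp only [hv, LieModule.toEnd]
  rw [sum_lie]
  simp only [smul_lie, mem_W.1 hx, smul_smul]
  rw [← Finset.sum_smul]
  congr 1
  simp [bil]

theorem hv_add (a b : ι → ℤ) : hv h (a + b) = hv h a + hv h b := by
  simp [hv, add_smul, Finset.sum_add_distrib]

theorem hv_single (i : ι) : hv h (Pi.single i 1) = h i := by
  simp only [hv, Pi.single_apply]
  simp

theorem hv_W (K : KMRel M h e f) (γ : ι → ℤ) : hv h γ ∈ W M h 0 :=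
  Submodule.sum_mem _ fun i _ => Submodule.smul_mem _ _ (h_W K i)

/-- the off-Cartan part -/
def Rg (M : Matrix ι ι ℤ) (h : ι → L) (γ : ι → ℤ) : Submodule ℚ (L ⊗[ℚ] L) :=
  Submodule.span ℚ {t | ∃ μ ν : ι → ℤ, 0 < μ ∧ 0 < ν ∧ μ + ν = γ ∧
    ∃ a ∈ W M h μ, ∃ b ∈ W M h ν, a ⊗ₜ b = t}

theorem tmul_Rg {μ ν : ι → ℤ} (hμ : 0 < μ) (hν : 0 < ν) {a b : L} (ha : a ∈ W M h μ)
    (hb : b ∈ W M h ν) : a ⊗ₜ[ℚ] b ∈ Rg M h (μ + ν) :=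
  Submodule.subset_span ⟨μ, ν, hμ, hν, rfl, a, ha, b, hb, rfl⟩

theorem lie_Rg {α γ : ι → ℤ} (hα : 0 < α) {x : L} (hx : x ∈ W M h α) {t : L ⊗[ℚ] L}
    (ht : t ∈ Rg M h γ) : ⁅x, t⁆ ∈ Rg M h (α + γ) := by
  induction ht using Submodule.span_induction with
  | mem t ht =>
    obtain ⟨μ, ν, hμ, hν, rfl, a, ha, b, hb, rfl⟩ := ht
    rw [TensorProduct.LieModule.lie_tmul_right]
    refine add_mem ?_ ?_
    · rw [← add_assoc]
      exact tmul_Rg (add_pos hα hμ) hν (lie_W hx ha) hb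
    · rw [add_left_comm]
      exact tmul_Rg hμ (add_pos hα hν) ha (lie_W hx hb)
  | zero => simp
  | add x y _ _ hx hy => rw [lie_add]; exact add_mem hx hy
  | smul a x _ hx => rw [lie_smul]; exact Submodule.smul_mem _ _ hx

/-- the residual of the cocycle -/
def res (h : ι → L) (δ : L →ₗ[ℚ] L ⊗[ℚ] L) (γ : ι → ℤ) : L →ₗ[ℚ] L ⊗[ℚ] L where
  toFun y := δ y - (y ⊗ₜ hv h γ - hv h γ ⊗ₜ y)
  map_add' x y := by simp only [map_add, TensorProduct.add_tmul, TensorProduct.tmul_add]; abel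
  map_smul' c x := by
    simp only [map_smul, RingHom.id_apply, TensorProduct.smul_tmul', TensorProduct.tmul_smul,
      smul_sub]

theorem res_word (S : Std M h e f) {δ : L →ₗ[ℚ] L ⊗[ℚ] L} (C : Coc h e δ) (l : List ι)
    (hl : l ≠ []) : res h δ (cnt l) (word e l) ∈ Rg M h (cnt l) := by
  induction l with
  | nil => exact absurd rfl hl
  | cons i l ih =>
    by_cases hl' : l = []
    · subst hl'
      have : cnt [i] = Pi.single i 1 := by rw [cnt_cons]; ext j; simp [cnt]
      simp only [this, res, word, C.ce, hv_single, LinearMap.coe_mk, AddHom.coe_mk]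
      simp
    · have ih := ih hl'
      have hp := cnt_pos hl'
      rw [word_cons e i hl', cnt_cons]
      set w := word e l with hw
      set γ := cnt l with hγ
      have hwW : w ∈ W M h γ := word_W S.toKMRel l
      have heW := e_W S.toKMRel i
      have hα : (0 : ι → ℤ) < Pi.single i 1 := by simp
      have h1 : δ w = res h δ γ w + (w ⊗ₜ hv h γ - hv h γ ⊗ₜ w) := by simp [res]
      have h2 : ⁅e i, hv h γ⁆ = -((bil M γ (Pi.single i 1) : ℚ) • e i) := by
        rw [← lie_skew, hv_lie heW]
      have h3 : ⁅w, h i⁆ = -((bil M γ (Pi.single i 1) : ℚ) • w) := by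
        rw [← lie_skew, ← hv_single (h := h), hv_lie hwW, bil_comm S.toSLM]
      have key : res h δ (Pi.single i 1 + γ) ⁅e i, w⁆ = ⁅e i, res h δ γ w⁆
          + (2 * bil M γ (Pi.single i 1) : ℚ) • (e i ⊗ₜ w - w ⊗ₜ e i) := by
        have h4 : ⁅w, e i⁆ = - ⁅e i, w⁆ := by rw [lie_skew]
        show δ ⁅e i, w⁆ - _ = _
        rw [C.coc, C.ce, h1, hv_add, hv_single]
        simp only [lie_add, lie_sub, TensorProduct.LieModule.lie_tmul_right, h2, h3, h4,
          TensorProduct.add_tmul, TensorProduct.tmul_add, TensorProduct.neg_tmul,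
          TensorProduct.tmul_neg, ← TensorProduct.smul_tmul', TensorProduct.tmul_smul]
        module
      rw [key]
      refine add_mem (lie_Rg hα heW ih) (Submodule.smul_mem _ _ (sub_mem (tmul_Rg hα hp heW hwW) ?_))
      rw [add_comm]
      exact tmul_Rg hp hα hwW heW

theorem res_W (S : Std M h e f) {δ : L →ₗ[ℚ] L ⊗[ℚ] L} (C : Coc h e δ) {γ : ι → ℤ} (hγ : 0 < γ)
    {y : L} (hy : y ∈ W M h γ) : res h δ γ y ∈ Rg M h γ := by
  rw [W_pos S hγ] at hy
  suffices wds e γ ≤ (Rg M h γ).comap (res h δ γ) from this hy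
  refine Submodule.span_le.2 ?_
  rintro _ ⟨l, hl, rfl, rfl⟩
  exact res_word S C l hl

/-- bracket -/
def br (L : Type) [LieRing L] [LieAlgebra ℚ L] : L ⊗[ℚ] L →ₗ[ℚ] L :=
  (LieModule.toModuleHom ℚ L L : L ⊗[ℚ] L →ₗ[ℚ] L)

theorem br_tmul (x y : L) : br L (x ⊗ₜ y) = ⁅x, y⁆ := LieModule.toModuleHom_apply ℚ L L x y

theorem br_lie (x : L) (t : L ⊗[ℚ] L) : br L ⁅x, t⁆ = ⁅x, br L t⁆ :=
  LieModuleHom.map_lie (LieModule.toModuleHom ℚ L L) x t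

/-- height -/
def ht (γ : ι → ℤ) : ℤ := ∑ i, γ i

theorem br_word (S : Std M h e f) {δ : L →ₗ[ℚ] L ⊗[ℚ] L} (C : Coc h e δ) (l : List ι)
    (hl : l ≠ []) : br L (δ (word e l)) = (-4 * ht (cnt l) : ℚ) • word e l := by
  have h0 : ∀ i, br L (δ (e i)) = (-4 : ℚ) • e i := by
    intro i
    rw [C.ce, map_sub, br_tmul, br_tmul, ← lie_skew (e i), S.he, S.diag]
    push_cast; module
  induction l with
  | nil => exact absurd rfl hl
  | cons i l ih =>
    by_cases hl' : l = []
    · subst hl'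
      have : cnt [i] = Pi.single i 1 := by rw [cnt_cons]; ext j; simp [cnt]
      rw [this]
      simp [ht, word, h0]
    · rw [word_cons e i hl', cnt_cons, C.coc, map_sub, br_lie, br_lie, ih hl', h0, lie_smul,
        lie_smul, ← lie_skew (e i) (word e l)]
      have : ht (Pi.single i 1 + cnt l) = 1 + ht (cnt l) := by simp [ht, Finset.sum_add_distrib]
      rw [this]
      push_cast; module

theorem br_W (S : Std M h e f) {δ : L →ₗ[ℚ] L ⊗[ℚ] L} (C : Coc h e δ) {γ : ι → ℤ} (hγ : 0 < γ)
    {y : L} (hy : y ∈ W M h γ) :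
    br L (res h δ γ y) = (-4 * ht γ + 2 * bil M γ γ : ℚ) • y := by
  have h1 : br L (δ y) = (-4 * ht γ : ℚ) • y := by
    have hy' := hy
    rw [W_pos S hγ] at hy'
    suffices wds e γ ≤ LinearMap.eqLocus (br L ∘ₗ δ) ((-4 * ht γ : ℚ) • LinearMap.id) from this hy'
    refine Submodule.span_le.2 ?_
    rintro _ ⟨l, hl, rfl, rfl⟩
    exact br_word S C l hl
  show br L (δ y - (y ⊗ₜ hv h γ - hv h γ ⊗ₜ y)) = _
  rw [map_sub, h1, map_sub, br_tmul, br_tmul, ← lie_skew y, hv_lie hy]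
  module

end E11B

namespace E11B

open TensorProduct

section linalg
variable {V X Y : Type} [AddCommGroup V] [AddCommGroup X] [AddCommGroup Y] [Module ℚ V] [Module ℚ X]
  [Module ℚ Y]

/-- first auxiliary map -/
def Ph1 (c : V →ₗ[ℚ] X →ₗ[ℚ] Y) (G : Y →ₗ[ℚ] V ⊗[ℚ] X) : V ⊗[ℚ] Y →ₗ[ℚ] V ⊗[ℚ] Y :=
  TensorProduct.lift (LinearMap.mk₂ ℚ (fun x y => LinearMap.lTensor V (c x) (G y))
    (fun x x' y => by simp [LinearMap.lTensor_add]) (fun a x y => by simp [LinearMap.lTensor_smul])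
    (fun x y y' => by simp) (fun a x y => by simp))

theorem Ph1_tmul (c : V →ₗ[ℚ] X →ₗ[ℚ] Y) (G : Y →ₗ[ℚ] V ⊗[ℚ] X) (x : V) (y : Y) :
    Ph1 c G (x ⊗ₜ y) = LinearMap.lTensor V (c x) (G y) := by simp [Ph1]

/-- second auxiliary map -/
def Ph2 (c : X →ₗ[ℚ] Y →ₗ[ℚ] V) (G : V →ₗ[ℚ] X ⊗[ℚ] Y) : V ⊗[ℚ] Y →ₗ[ℚ] V ⊗[ℚ] Y :=
  TensorProduct.lift (LinearMap.mk₂ ℚ (fun x y => LinearMap.rTensor Y (c.flip y) (G x))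
    (fun x x' y => by simp) (fun a x y => by simp)
    (fun x y y' => by simp [LinearMap.rTensor_add]) (fun a x y => by simp [LinearMap.rTensor_smul]))

theorem Ph2_tmul (c : X →ₗ[ℚ] Y →ₗ[ℚ] V) (G : V →ₗ[ℚ] X ⊗[ℚ] Y) (x : V) (y : Y) :
    Ph2 c G (x ⊗ₜ y) = LinearMap.rTensor Y (c.flip y) (G x) := by simp [Ph2]

theorem rank_one_ind {V X : Type} [AddCommGroup V] [Module ℚ V] [AddCommGroup X] [Module ℚ X]
    [Module.Finite ℚ V] (P : (V →ₗ[ℚ] X) → Prop) (h0 : P 0)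
    (h1 : ∀ (φ : V →ₗ[ℚ] ℚ) (x : X), P (φ.smulRight x)) (h2 : ∀ a b, P a → P b → P (a + b))
    (G : V →ₗ[ℚ] X) : P G := by
  have hG : G = ∑ i, ((Module.finBasis ℚ V).coord i).smulRight (G (Module.finBasis ℚ V i)) := by
    refine (Module.finBasis ℚ V).ext fun j => ?_
    simp [Finsupp.single_apply]
  rw [hG]
  refine Finset.sum_induction _ P h2 h0 fun i _ => h1 _ _

theorem trace_Ph1 [Module.Finite ℚ V] [Module.Finite ℚ Y] (c : V →ₗ[ℚ] X →ₗ[ℚ] Y)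
    (G : Y →ₗ[ℚ] V ⊗[ℚ] X) :
    LinearMap.trace ℚ _ (Ph1 c G) = LinearMap.trace ℚ _ (TensorProduct.lift c ∘ₗ G) := by
  have hadd : ∀ G G', Ph1 c (G + G') = Ph1 c G + Ph1 c G' := by
    intro G G'; ext x y; simp [Ph1_tmul]
  have h00 : Ph1 c 0 = 0 := by ext x y; simp [Ph1_tmul]
  induction G using rank_one_ind with
  | h0 => simp [h00]
  | h2 a b ha hb => rw [hadd, map_add, ha, hb, LinearMap.comp_add, map_add]
  | h1 φ t =>
    induction t using TensorProduct.induction_on with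
    | zero =>
      have : (φ.smulRight (0 : V ⊗[ℚ] X)) = 0 := by ext; simp
      simp [this, h00]
    | add t t' ht ht' =>
      have : φ.smulRight (t + t') = φ.smulRight t + φ.smulRight t' := by ext; simp
      rw [this, hadd, map_add, ht, ht', LinearMap.comp_add, map_add]
    | tmul v z =>
      let A : V ⊗[ℚ] Y →ₗ[ℚ] Y := (c.flip z) ∘ₗ
        (TensorProduct.rid ℚ V).toLinearMap ∘ₗ LinearMap.lTensor V φ
      let B : Y →ₗ[ℚ] V ⊗[ℚ] Y := TensorProduct.mk ℚ V Y v
      have e1 : Ph1 c (φ.smulRight (v ⊗ₜ[ℚ] z)) = B ∘ₗ A := by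
        ext x y; simp [Ph1_tmul, A, B]
      have e2 : TensorProduct.lift c ∘ₗ φ.smulRight (v ⊗ₜ[ℚ] z) = A ∘ₗ B := by
        ext y; simp [A, B]
      rw [e1, e2, LinearMap.trace_comp_comm']

theorem trace_Ph2 [Module.Finite ℚ V] [Module.Finite ℚ Y] (c : X →ₗ[ℚ] Y →ₗ[ℚ] V)
    (G : V →ₗ[ℚ] X ⊗[ℚ] Y) :
    LinearMap.trace ℚ _ (Ph2 c G) = LinearMap.trace ℚ _ (TensorProduct.lift c ∘ₗ G) := by
  have hadd : ∀ G G', Ph2 c (G + G') = Ph2 c G + Ph2 c G' := by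
    intro G G'; ext x y; simp [Ph2_tmul]
  have h00 : Ph2 c 0 = 0 := by ext x y; simp [Ph2_tmul]
  induction G using rank_one_ind with
  | h0 => simp [h00]
  | h2 a b ha hb => rw [hadd, map_add, ha, hb, LinearMap.comp_add, map_add]
  | h1 φ t =>
    induction t using TensorProduct.induction_on with
    | zero =>
      have : (φ.smulRight (0 : X ⊗[ℚ] Y)) = 0 := by ext; simp
      simp [this, h00]
    | add t t' ht ht' =>
      have : φ.smulRight (t + t') = φ.smulRight t + φ.smulRight t' := by ext; simp
      rw [this, hadd, map_add, ht, ht', LinearMap.comp_add, map_add]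
    | tmul v z =>
      let A : V ⊗[ℚ] Y →ₗ[ℚ] V := (c v) ∘ₗ
        (TensorProduct.lid ℚ Y).toLinearMap ∘ₗ LinearMap.rTensor Y φ
      let B : V →ₗ[ℚ] V ⊗[ℚ] Y := (TensorProduct.mk ℚ V Y).flip z
      have e1 : Ph2 c (φ.smulRight (v ⊗ₜ[ℚ] z)) = B ∘ₗ A := by
        ext x y; simp [Ph2_tmul, A, B, TensorProduct.smul_tmul']
      have e2 : TensorProduct.lift c ∘ₗ φ.smulRight (v ⊗ₜ[ℚ] z) = A ∘ₗ B := by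
        ext y; simp [A, B]
      rw [e1, e2, LinearMap.trace_comp_comm']

theorem trace_swap [Module.Finite ℚ V] :
    LinearMap.trace ℚ _ ((TensorProduct.comm ℚ V V).toLinearMap) = (Module.finrank ℚ V : ℚ) := by
  let b := Module.finBasis ℚ V
  rw [LinearMap.trace_eq_matrix_trace ℚ (b.tensorProduct b), Matrix.trace]
  simp only [Matrix.diag_apply, LinearMap.toMatrix_apply]
  rw [Fintype.sum_prod_type]
  simp [Finsupp.single_apply]

end linalg
end E11B

namespace E11B

open TensorProduct
open scoped Classical

variable {ι : Type} [Fintype ι] [DecidableEq ι] {M : Matrix ι ι ℤ}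
  {L : Type} [LieRing L] [LieAlgebra ℚ L] {h e f : ι → L}

/-- projection on a component of the tensor square -/
def prt (S : Std M h e f) (μ ν : ι → ℤ) : L ⊗[ℚ] L →ₗ[ℚ] W M h μ ⊗[ℚ] W M h ν :=
  TensorProduct.map (pr S μ) (pr S ν)

/-- inclusion -/
def inc (M : Matrix ι ι ℤ) (h : ι → L) (μ ν : ι → ℤ) : W M h μ ⊗[ℚ] W M h ν →ₗ[ℚ] L ⊗[ℚ] L :=
  TensorProduct.map (W M h μ).subtype (W M h ν).subtype

/-- bracket of weight spaces, curried -/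
def cc' (S : Std M h e f) (μ ν β : ι → ℤ) : W M h μ →ₗ[ℚ] W M h ν →ₗ[ℚ] W M h β :=
  LinearMap.mk₂ ℚ (fun x y => pr S β ⁅(x : L), (y : L)⁆) (by simp) (by simp) (by simp) (by simp)

/-- bracket of weight spaces -/
def cW (S : Std M h e f) (μ ν β : ι → ℤ) : W M h μ ⊗[ℚ] W M h ν →ₗ[ℚ] W M h β :=
  TensorProduct.lift (cc' S μ ν β)

/-- component of the cobracket -/
def gW (S : Std M h e f) (δ : L →ₗ[ℚ] L ⊗[ℚ] L) (β μ ν : ι → ℤ) :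
    W M h β →ₗ[ℚ] W M h μ ⊗[ℚ] W M h ν := prt S μ ν ∘ₗ δ ∘ₗ (W M h β).subtype

/-- the traces -/
def Traw (S : Std M h e f) (δ : L →ₗ[ℚ] L ⊗[ℚ] L) (β μ ν : ι → ℤ) : ℚ :=
  LinearMap.trace ℚ _ (cW S μ ν β ∘ₗ gW S δ β μ ν)

theorem prt_tmul (S : Std M h e f) (μ ν : ι → ℤ) (a b : L) :
    prt S μ ν (a ⊗ₜ b) = pr S μ a ⊗ₜ pr S ν b := rfl

theorem gW_res (S : Std M h e f) (δ : L →ₗ[ℚ] L ⊗[ℚ] L) {β μ ν : ι → ℤ} (hμ : 0 < μ) (hν : 0 < ν)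
    (y : W M h β) : gW S δ β μ ν y = prt S μ ν (res h δ β y) := by
  show prt S μ ν (δ y) = prt S μ ν (δ y - (_ ⊗ₜ hv h β - hv h β ⊗ₜ _))
  simp only [map_sub, prt_tmul]
  rw [pr_ne S hμ.ne (hv_W S.toKMRel β), pr_ne S hν.ne (hv_W S.toKMRel β)]
  simp

theorem cW_gW_sum (S : Std M h e f) {δ : L →ₗ[ℚ] L ⊗[ℚ] L} (C : Coc h e δ) {β : ι → ℤ}
    (hβ : 0 < β) :
    ∑ μ ∈ Finset.Ioo 0 β, cW S μ (β - μ) β ∘ₗ gW S δ β μ (β - μ) =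
      (-4 * ht β + 2 * bil M β β : ℚ) • LinearMap.id := by
  refine LinearMap.ext fun y => ?_
  have key : ∀ t ∈ Rg M h β, ∑ μ ∈ Finset.Ioo 0 β, cW S μ (β - μ) β (prt S μ (β - μ) t)
      = pr S β (br L t) := by
    intro t ht
    induction ht using Submodule.span_induction with
    | mem t ht =>
      obtain ⟨μ, ν, hμ, hν, rfl, a, ha, b, hb, rfl⟩ := ht
      rw [Finset.sum_eq_single μ]
      · rw [prt_tmul, pr_same S ha, add_sub_cancel_left, pr_same S hb, br_tmul]
        simp [cW, cc']
      · intro μ' _ hne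
        rw [prt_tmul, pr_ne S hne.symm ha]; simp
      · intro hn
        exact absurd (Finset.mem_Ioo.2 ⟨hμ, lt_add_of_pos_right _ hν⟩) hn
    | zero => simp
    | add x y _ _ hx hy => simp only [map_add, Finset.sum_add_distrib, hx, hy]
    | smul a x _ hx => simp only [map_smul, ← Finset.smul_sum, hx]
  have h1 := key _ (res_W S C hβ y.2)
  rw [br_W S C hβ y.2, map_smul, pr_same' S y] at h1
  rw [LinearMap.sum_apply, LinearMap.smul_apply, LinearMap.id_apply, ← h1]
  refine Finset.sum_congr rfl fun μ hμ => ?_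
  rw [Finset.mem_Ioo] at hμ
  rw [LinearMap.comp_apply, gW_res S δ hμ.1 (sub_pos.2 hμ.2)]

theorem Traw_sum (S : Std M h e f) {δ : L →ₗ[ℚ] L ⊗[ℚ] L} (C : Coc h e δ) {β : ι → ℤ}
    (hβ : 0 < β) : ∑ μ ∈ Finset.Ioo 0 β, Traw S δ β μ (β - μ) =
      (-4 * ht β + 2 * bil M β β : ℚ) * mul' M h β := by
  have := W_fin S hβ
  have h1 := congrArg (LinearMap.trace ℚ _) (cW_gW_sum S C hβ)
  rw [map_sum] at h1
  rw [map_smul, LinearMap.trace_id, smul_eq_mul] at h1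
  exact h1

theorem Traw_zero (S : Std M h e f) (δ : L →ₗ[ℚ] L ⊗[ℚ] L) {β μ ν : ι → ℤ} (hμ : 0 < μ) (hν : 0 < ν)
    (h0 : mul' M h μ = 0 ∨ mul' M h ν = 0) : Traw S δ β μ ν = 0 := by
  have := W_fin S hμ
  have := W_fin S hν
  have : Subsingleton (W M h μ ⊗[ℚ] W M h ν) := by
    rw [← Module.finrank_zero_iff (R := ℚ), Module.finrank_tensorProduct, mul_eq_zero]
    exact h0
  have : gW S δ β μ ν = 0 := by
    ext x; exact Subsingleton.elim _ _
  rw [Traw, this]; simp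

theorem prt_lie_left (S : Std M h e f) {μ ν : ι → ℤ} (hμ : 0 < μ) (x : W M h μ)
    {t : L ⊗[ℚ] L} (ht : t ∈ Rg M h ν) : prt S μ ν ⁅(x : L), t⁆ =
      if 0 < ν - μ then LinearMap.lTensor _ (cc' S μ (ν - μ) ν x) (prt S μ (ν - μ) t) else 0 := by
  induction ht using Submodule.span_induction with
  | mem t ht =>
    obtain ⟨μ', ν', hμ', hν', rfl, a, ha, b, hb, rfl⟩ := ht
    rw [TensorProduct.LieModule.lie_tmul_right, map_add, prt_tmul, prt_tmul, prt_tmul]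
    rw [pr_ne S (by simpa using hμ'.ne') (lie_W x.2 ha)]
    by_cases hm : μ' = μ
    · subst hm
      rw [add_sub_cancel_left, if_pos hν', pr_same S ha, pr_same S hb]
      simp [cc']
    · rw [pr_ne S hm ha]
      simp
  | zero => simp
  | add x y _ _ hx hy => rw [lie_add, map_add, hx, hy]; split_ifs <;> simp
  | smul a x _ hx => rw [lie_smul, map_smul, hx]; split_ifs <;> simp

theorem prt_lie_right (S : Std M h e f) {μ ν : ι → ℤ} (hν : 0 < ν) (y : W M h ν)
    {t : L ⊗[ℚ] L} (ht : t ∈ Rg M h μ) : -prt S μ ν ⁅(y : L), t⁆ =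
      if 0 < μ - ν then LinearMap.rTensor _ ((cc' S (μ - ν) ν μ).flip y) (prt S (μ - ν) ν t)
      else 0 := by
  induction ht using Submodule.span_induction with
  | mem t ht =>
    obtain ⟨μ', ν', hμ', hν', rfl, a, ha, b, hb, rfl⟩ := ht
    rw [TensorProduct.LieModule.lie_tmul_right, map_add, prt_tmul, prt_tmul, prt_tmul]
    rw [pr_ne S (by simpa using hν'.ne') (lie_W y.2 hb)]
    by_cases hm : ν' = ν
    · subst hm
      rw [add_sub_cancel_right, if_pos hμ', pr_same S ha, pr_same S hb]
      simp [cc']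
      rw [← lie_skew, map_neg, TensorProduct.neg_tmul, neg_neg]
    · rw [pr_ne S hm hb]
      simp
  | zero => simp
  | add x y _ _ hx hy => rw [lie_add, map_add, neg_add, hx, hy]; split_ifs <;> simp
  | smul a x _ hx => rw [lie_smul, map_smul, (smul_neg a (prt S μ ν ⁅(y : L), x⁆)).symm, hx]; split_ifs <;> simp

/-- swap component -/
def swp (S : Std M h e f) (μ ν : ι → ℤ) : W M h μ ⊗[ℚ] W M h ν →ₗ[ℚ] W M h μ ⊗[ℚ] W M h ν :=
  prt S μ ν ∘ₗ (TensorProduct.comm ℚ L L).toLinearMap ∘ₗ inc M h μ ν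

theorem trace_swp (S : Std M h e f) {μ ν : ι → ℤ} (hμ : 0 < μ) :
    LinearMap.trace ℚ _ (swp S μ ν) = if μ = ν then (mul' M h μ : ℚ) else 0 := by
  split_ifs with hmn
  · subst hmn
    have := W_fin S hμ
    rw [mul', ← trace_swap]
    congr 1
    ext x y
    simp only [swp, inc, prt_tmul, pr_same', TensorProduct.AlgebraTensorModule.curry_apply,
      LinearMap.restrictScalars_self, TensorProduct.curry_apply, LinearMap.comp_apply,
      TensorProduct.map_tmul, LinearEquiv.coe_coe, TensorProduct.comm_tmul, Submodule.subtype_apply]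
  · have : swp S μ ν = 0 := by
      ext x y
      simp only [swp, inc, prt_tmul, TensorProduct.AlgebraTensorModule.curry_apply,
        LinearMap.restrictScalars_self, TensorProduct.curry_apply, LinearMap.comp_apply,
        TensorProduct.map_tmul, LinearEquiv.coe_coe, TensorProduct.comm_tmul,
        Submodule.subtype_apply]
      rw [pr_ne S (Ne.symm hmn) y.2]
      simp
    rw [this]; simp

theorem gc_eq (S : Std M h e f) {δ : L →ₗ[ℚ] L ⊗[ℚ] L} (C : Coc h e δ) {μ ν : ι → ℤ} (hμ : 0 < μ)
    (hν : 0 < ν) : gW S δ (μ + ν) μ ν ∘ₗ cW S μ ν (μ + ν) =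
      (2 * bil M μ ν : ℚ) • (LinearMap.id - swp S μ ν)
      + (if 0 < ν - μ then Ph1 (cc' S μ (ν - μ) ν) (gW S δ ν μ (ν - μ)) else 0)
      + (if 0 < μ - ν then Ph2 (cc' S (μ - ν) ν μ) (gW S δ μ (μ - ν) ν) else 0) := by
  refine TensorProduct.ext' fun x y => ?_
  have h1 : cW S μ ν (μ + ν) (x ⊗ₜ y) = ⟨⁅(x : L), (y : L)⁆, lie_W x.2 y.2⟩ := by
    simp only [cW, cc', TensorProduct.lift.tmul, LinearMap.mk₂_apply]
    exact pr_same S _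
  have h2 : (if 0 < ν - μ then Ph1 (cc' S μ (ν - μ) ν) (gW S δ ν μ (ν - μ)) else 0) (x ⊗ₜ y)
      = prt S μ ν ⁅(x : L), res h δ ν y⁆ := by
    rw [prt_lie_left S hμ x (res_W S C hν y.2)]
    split_ifs with h0
    · rw [Ph1_tmul, gW_res S δ hμ h0]
    · rfl
  have h3 : (if 0 < μ - ν then Ph2 (cc' S (μ - ν) ν μ) (gW S δ μ (μ - ν) ν) else 0) (x ⊗ₜ y)
      = -prt S μ ν ⁅(y : L), res h δ μ x⁆ := by
    rw [prt_lie_right S hν y (res_W S C hμ x.2)]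
    split_ifs with h0
    · rw [Ph2_tmul, gW_res S δ h0 hν]
    · rfl
  have h4 : ∀ (γ : ι → ℤ) (z : L), δ z = res h δ γ z + (z ⊗ₜ hv h γ - hv h γ ⊗ₜ z) := by
    intro γ z; simp [res]
  have h5 : ⁅(x : L), hv h ν⁆ = -((bil M μ ν : ℚ) • (x : L)) := by
    rw [← lie_skew, hv_lie x.2, bil_comm S.toSLM]
  have h6 : ⁅(y : L), hv h μ⁆ = -((bil M μ ν : ℚ) • (y : L)) := by
    rw [← lie_skew, hv_lie y.2]
  have h7 : swp S μ ν (x ⊗ₜ y) = prt S μ ν ((y : L) ⊗ₜ (x : L)) := rfl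
  have h8 : (x ⊗ₜ y : W M h μ ⊗[ℚ] W M h ν) = prt S μ ν ((x : L) ⊗ₜ (y : L)) := by
    rw [prt_tmul, pr_same', pr_same']
  have h9 : ∀ (a : L) (γ : ι → ℤ), prt S μ ν (a ⊗ₜ hv h γ) = 0 := by
    intro a γ; rw [prt_tmul, pr_ne S hν.ne (hv_W S.toKMRel γ)]; simp
  have h10 : ∀ (a : L) (γ : ι → ℤ), prt S μ ν (hv h γ ⊗ₜ a) = 0 := by
    intro a γ; rw [prt_tmul, pr_ne S hμ.ne (hv_W S.toKMRel γ)]; simp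
  rw [LinearMap.comp_apply, h1, LinearMap.add_apply, LinearMap.add_apply, h2, h3]
  show prt S μ ν (δ ⁅(x : L), (y : L)⁆) = _
  rw [LinearMap.smul_apply, LinearMap.sub_apply, LinearMap.id_apply, h7, h8, C.coc, h4 ν y,
    h4 μ x]
  simp only [lie_add, lie_sub, TensorProduct.LieModule.lie_tmul_right, h5, h6, map_add, map_sub,
    h9, h10, TensorProduct.neg_tmul,
          TensorProduct.tmul_neg, ← TensorProduct.smul_tmul', TensorProduct.tmul_smul, map_neg,
          map_smul]
  module

theorem Traw_rec (S : Std M h e f) {δ : L →ₗ[ℚ] L ⊗[ℚ] L} (C : Coc h e δ) {μ ν : ι → ℤ}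
    (hμ : 0 < μ) (hν : 0 < ν) : Traw S δ (μ + ν) μ ν =
      2 * bil M μ ν * (mul' M h μ * mul' M h ν - if μ = ν then (mul' M h μ : ℚ) else 0)
      + (if 0 < ν - μ then Traw S δ ν μ (ν - μ) else 0)
      + (if 0 < μ - ν then Traw S δ μ (μ - ν) ν else 0) := by
  have := W_fin S hμ
  have := W_fin S hν
  have := W_fin S (add_pos hμ hν)
  rw [Traw, LinearMap.trace_comp_comm', gc_eq S C hμ hν]
  simp only [map_add, map_smul, map_sub, LinearMap.trace_id, trace_swp S hμ,
    Module.finrank_tensorProduct]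
  congr 1
  congr 1
  · have h1 : LinearMap.trace ℚ _ ((LinearMap.id : W M h μ ⊗[ℚ] W M h ν →ₗ[ℚ] _) - swp S μ ν) =
        mul' M h μ * mul' M h ν - if μ = ν then (mul' M h μ : ℚ) else 0 := by
      refine (map_sub (LinearMap.trace ℚ (W M h μ ⊗[ℚ] W M h ν)) _ _).trans ?_
      rw [trace_swp S hμ, LinearMap.trace_id, Module.finrank_tensorProduct]
      simp [mul']
    rw [h1, smul_eq_mul]
  · split_ifs with h0
    · rw [trace_Ph1]; rfl
    · simp
  · split_ifs with h0
    · rw [trace_Ph2]; rfl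
    · simp

/-- normalised traces -/
def TT (S : Std M h e f) (δ : L →ₗ[ℚ] L ⊗[ℚ] L) (μ ν : ι → ℤ) : ℚ := -Traw S δ (μ + ν) μ ν / 2

theorem TT_zero (S : Std M h e f) (δ : L →ₗ[ℚ] L ⊗[ℚ] L) {μ ν : ι → ℤ} (hμ : 0 < μ) (hν : 0 < ν)
    (h0 : mul' M h μ = 0 ∨ mul' M h ν = 0) : TT S δ μ ν = 0 := by
  rw [TT, Traw_zero S δ hμ hν h0]; simp

theorem TT_sum (S : Std M h e f) {δ : L →ₗ[ℚ] L ⊗[ℚ] L} (C : Coc h e δ) {β : ι → ℤ}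
    (hβ : 0 < β) : ∑ μ ∈ Finset.Ioo 0 β, TT S δ μ (β - μ) =
      (2 * ht β - bil M β β : ℚ) * mul' M h β := by
  have := Traw_sum S C hβ
  simp only [TT, add_sub_cancel]
  rw [← Finset.sum_div, Finset.sum_neg_distrib, this]
  ring

theorem TT_rec (S : Std M h e f) {δ : L →ₗ[ℚ] L ⊗[ℚ] L} (C : Coc h e δ) {μ ν : ι → ℤ}
    (hμ : 0 < μ) (hν : 0 < ν) : TT S δ μ ν =
      -bil M μ ν * (mul' M h μ * mul' M h ν - if μ = ν then (mul' M h μ : ℚ) else 0)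
      + (if 0 < ν - μ then TT S δ μ (ν - μ) else 0)
      + (if 0 < μ - ν then TT S δ (μ - ν) ν else 0) := by
  simp only [TT, add_sub_cancel, sub_add_cancel]
  rw [Traw_rec S C hμ hν]
  split_ifs <;> ring

end E11B

namespace E11B

open TensorProduct

/-- semidirect product of a Lie algebra with a module -/
def SD (L V : Type) := L × V

section SD
variable (L V : Type) [LieRing L] [LieAlgebra ℚ L] [AddCommGroup V] [Module ℚ V] [LieRingModule L V]
  [LieModule ℚ L V]

instance : AddCommGroup (SD L V) := inferInstanceAs (AddCommGroup (L × V))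
instance : Module ℚ (SD L V) := inferInstanceAs (Module ℚ (L × V))

variable {L V}
/-- constructor -/
def SD.mk (x : L) (v : V) : SD L V := (x, v)

theorem SD.mk_fst (x : L) (v : V) : (SD.mk x v).1 = x := rfl
theorem SD.mk_snd (x : L) (v : V) : (SD.mk x v).2 = v := rfl
theorem SD.ext' {a b : SD L V} (h1 : a.1 = b.1) (h2 : a.2 = b.2) : a = b := Prod.ext h1 h2

theorem SD.add_fst (a b : SD L V) : (a + b).1 = a.1 + b.1 := rfl
theorem SD.add_snd (a b : SD L V) : (a + b).2 = a.2 + b.2 := rfl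
theorem SD.neg_fst (a : SD L V) : (-a).1 = -a.1 := rfl
theorem SD.neg_snd (a : SD L V) : (-a).2 = -a.2 := rfl
theorem SD.smul_fst (c : ℚ) (a : SD L V) : (c • a).1 = c • a.1 := rfl
theorem SD.smul_snd (c : ℚ) (a : SD L V) : (c • a).2 = c • a.2 := rfl
theorem SD.zero_fst : (0 : SD L V).1 = 0 := rfl
theorem SD.zero_snd : (0 : SD L V).2 = 0 := rfl

instance : Bracket (SD L V) (SD L V) := ⟨fun a b => SD.mk ⁅a.1, b.1⁆ (⁅a.1, b.2⁆ - ⁅b.1, a.2⁆)⟩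

theorem SD.lie_fst (a b : SD L V) : ⁅a, b⁆.1 = ⁅a.1, b.1⁆ := rfl
theorem SD.lie_snd (a b : SD L V) : ⁅a, b⁆.2 = ⁅a.1, b.2⁆ - ⁅b.1, a.2⁆ := rfl

instance : LieRing (SD L V) where
  add_lie a b c := by
    apply SD.ext' <;> simp only [SD.lie_fst, SD.lie_snd, SD.add_fst, SD.add_snd, add_lie, lie_add]
    abel
  lie_add a b c := by
    apply SD.ext' <;> simp only [SD.lie_fst, SD.lie_snd, SD.add_fst, SD.add_snd, add_lie, lie_add]
    abel
  lie_self a := by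
    apply SD.ext' <;> simp [SD.lie_fst, SD.lie_snd, SD.zero_fst, SD.zero_snd]
  leibniz_lie a b c := by
    apply SD.ext' <;> simp only [SD.lie_fst, SD.lie_snd, SD.add_fst, SD.add_snd, lie_sub]
    · exact leibniz_lie _ _ _
    · rw [leibniz_lie a.1 b.1 c.2, lie_lie a.1 c.1 b.2, lie_lie, leibniz_lie c.1 a.1 b.2]
      simp only [lie_lie]
      abel

instance : LieAlgebra ℚ (SD L V) where
  lie_smul c a b := by
    apply SD.ext' <;> simp only [SD.lie_fst, SD.lie_snd, SD.smul_fst, SD.smul_snd, smul_lie,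
      lie_smul, smul_sub]

/-- second projection -/
def SD.sndL : SD L V →ₗ[ℚ] V where
  toFun a := a.2
  map_add' _ _ := rfl
  map_smul' _ _ := rfl

/-- first projection -/
def SD.fstL : SD L V →ₗ⁅ℚ⁆ L where
  toFun a := a.1
  map_add' _ _ := rfl
  map_smul' _ _ := rfl
  map_lie' := rfl

end SD

variable {ι : Type} [Fintype ι] [DecidableEq ι] {M : Matrix ι ι ℤ}

section wedge
variable {L : Type} [LieRing L] [LieAlgebra ℚ L] {h e f : ι → L}

/-- wedge -/
def wd (a b : L) : L ⊗[ℚ] L := a ⊗ₜ b - b ⊗ₜ a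

theorem wd_swap (a b : L) : wd a b = - wd b a := by simp [wd]
theorem wd_self (a : L) : wd a a = 0 := by simp [wd]
theorem wd_smul_left (c : ℚ) (a b : L) : wd (c • a) b = c • wd a b := by
  simp [wd, ← TensorProduct.smul_tmul', smul_sub]
theorem wd_smul_right (c : ℚ) (a b : L) : wd a (c • b) = c • wd a b := by
  simp [wd, ← TensorProduct.smul_tmul', smul_sub]
theorem wd_neg_left (a b : L) : wd (-a) b = - wd a b := by
  simp [wd, TensorProduct.neg_tmul, TensorProduct.tmul_neg]; abel
theorem wd_neg_right (a b : L) : wd a (-b) = - wd a b := by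
  simp [wd, TensorProduct.neg_tmul, TensorProduct.tmul_neg]; abel
theorem wd_zero_left (a : L) : wd 0 a = 0 := by simp [wd]
theorem wd_zero_right (a : L) : wd a 0 = 0 := by simp [wd]
theorem lie_wd (x a b : L) : ⁅x, wd a b⁆ = wd ⁅x, a⁆ b + wd a ⁅x, b⁆ := by
  simp [wd]; abel

theorem KMRel.eh (K : KMRel M h e f) (i j : ι) : ⁅e i, h j⁆ = -((M j i : ℚ) • e i) := by
  rw [← lie_skew, K.he]
theorem KMRel.fh (K : KMRel M h e f) (i j : ι) : ⁅f i, h j⁆ = (M j i : ℚ) • f i := by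
  rw [← lie_skew, K.hf, neg_neg]

theorem coc_ee0 (K : KMRel M h e f) (S : SLM M) (i j : ι) (h0 : M i j = 0) :
    ⁅e i, wd (e j) (h j)⁆ - ⁅e j, wd (e i) (h i)⁆ = 0 := by
  have h0' : M j i = 0 := by rw [S.sym, h0]
  rw [lie_wd, lie_wd, K.ee0 i j h0, K.ee0 j i h0', K.eh, K.eh, h0, h0']
  simp [wd_zero_left, wd_zero_right]

theorem coc_ee1 (K : KMRel M h e f) (S : SLM M) (i j : ι) (h0 : M i j = -1) :
    ⁅e i, ⁅e i, wd (e j) (h j)⁆ - ⁅e j, wd (e i) (h i)⁆⁆ - ⁅⁅e i, e j⁆, wd (e i) (h i)⁆ = 0 := by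
  have h0' : M j i = -1 := by rw [S.sym, h0]
  have h1 : ⁅e j, e i⁆ = -⁅e i, e j⁆ := (lie_skew _ _).symm
  have h2 : ⁅⁅e i, e j⁆, e i⁆ = 0 := by rw [← lie_skew, K.ee1 i j h0, neg_zero]
  have h3 : ⁅⁅e i, e j⁆, h i⁆ = - ⁅e i, e j⁆ := by
    rw [← lie_skew, leibniz_lie, K.he, K.he, S.diag, h0, smul_lie, lie_smul]
    push_cast; module
  simp only [lie_wd, lie_sub, lie_add, K.eh, h0, h0', h1, h2, h3, wd_smul_right, wd_smul_left,
    wd_neg_right, wd_neg_left, lie_neg, lie_smul, lie_self, K.ee1 i j h0, wd_zero_left,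
    wd_zero_right, S.diag]
  rw [wd_swap (⁅e i, e j⁆) (e i)]
  push_cast
  simp
  module

/-- the extended generators satisfy the relations -/
theorem coc_rel (K : KMRel M h e f) (S : SLM M) :
    KMRel M (L := SD L (L ⊗[ℚ] L)) (fun i => SD.mk (h i) 0) (fun i => SD.mk (e i) (wd (e i) (h i)))
      (fun i => SD.mk (f i) (wd (f i) (h i))) where
  hh i j := by
    apply SD.ext' <;> simp [SD.lie_fst, SD.lie_snd, SD.mk_fst, SD.mk_snd, K.hh, SD.zero_fst, SD.zero_snd]
  ef i := by
    apply SD.ext' <;> simp only [SD.lie_fst, SD.lie_snd, SD.mk_fst, SD.mk_snd, K.ef]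
    rw [lie_wd, lie_wd, K.ef, K.eh, K.fh, ← lie_skew, K.ef, S.diag, wd_self, wd_neg_left, wd_self,
      wd_neg_right, wd_smul_right, wd_smul_right, wd_swap (f i) (e i)]
    simp
  ef' i j hij := by
    apply SD.ext' <;> simp only [SD.lie_fst, SD.lie_snd, SD.mk_fst, SD.mk_snd, K.ef' i j hij, SD.zero_fst,
      SD.zero_snd]
    rw [lie_wd, lie_wd, K.ef' i j hij, K.eh, K.fh, ← lie_skew, K.ef' i j hij, neg_zero,
      wd_neg_right, wd_smul_right, wd_smul_right, wd_swap (f j) (e i), S.sym j i]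
    simp [wd_zero_left]
  he i j := by
    apply SD.ext' <;> simp only [SD.lie_fst, SD.lie_snd, SD.mk_fst, SD.mk_snd, K.he, SD.smul_fst,
      SD.smul_snd]
    rw [lie_wd, K.he, K.hh, wd_zero_right, wd_smul_left]; simp
  hf i j := by
    apply SD.ext' <;> simp only [SD.lie_fst, SD.lie_snd, SD.mk_fst, SD.mk_snd, K.hf, SD.smul_fst,
      SD.smul_snd, SD.neg_fst, SD.neg_snd]
    rw [lie_wd, K.hf, K.hh, wd_zero_right, wd_neg_left, wd_smul_left]; simp
  ee0 i j h0 := by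
    apply SD.ext' <;> simp only [SD.lie_fst, SD.lie_snd, SD.mk_fst, SD.mk_snd, SD.zero_fst, SD.zero_snd]
    · exact K.ee0 i j h0
    · exact coc_ee0 K S i j h0
  ee1 i j h0 := by
    apply SD.ext' <;> simp only [SD.lie_fst, SD.lie_snd, SD.mk_fst, SD.mk_snd, SD.zero_fst, SD.zero_snd]
    · exact K.ee1 i j h0
    · exact coc_ee1 K S i j h0
  ff0 i j h0 := by
    apply SD.ext' <;> simp only [SD.lie_fst, SD.lie_snd, SD.mk_fst, SD.mk_snd, SD.zero_fst, SD.zero_snd]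
    · exact K.ff0 i j h0
    · have := coc_ee0 K.swap S i j h0
      simp only [wd_neg_right, lie_neg] at this
      rw [← neg_eq_zero, ← this]; abel
  ff1 i j h0 := by
    apply SD.ext' <;> simp only [SD.lie_fst, SD.lie_snd, SD.mk_fst, SD.mk_snd, SD.zero_fst, SD.zero_snd]
    · exact K.ff1 i j h0
    · have := coc_ee1 K.swap S i j h0
      simp only [wd_neg_right, lie_neg, lie_sub] at this
      rw [← neg_eq_zero, ← this, lie_sub]; abel

end wedge

section univ

theorem mk_bracket' (x y : FreeLieAlgebra ℚ (Generators ι)) :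
    (LieSubmodule.Quotient.mk ⁅x, y⁆ : Matrix.ToLieAlgebra ℚ M) =
      ⁅(LieSubmodule.Quotient.mk x : Matrix.ToLieAlgebra ℚ M),
        (LieSubmodule.Quotient.mk y : Matrix.ToLieAlgebra ℚ M)⁆ := rfl

/-- quotient map -/
def qm (M : Matrix ι ι ℤ) : FreeLieAlgebra ℚ (Generators ι) →ₗ⁅ℚ⁆ Matrix.ToLieAlgebra ℚ M where
  toFun x := LieSubmodule.Quotient.mk x
  map_add' _ _ := rfl
  map_smul' _ _ := rfl
  map_lie' := rfl

theorem qm_surj : Function.Surjective (qm M) := Quot.mk_surjective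

theorem qm_zero {x} (hx : x ∈ Relations.toSet ℚ M) : qm M x = 0 :=
  LieSubmodule.Quotient.mk_eq_zero'.2 (LieSubmodule.subset_lieSpan hx)

variable (M) in
/-- relations in a Lie algebra as images of the free ones -/
theorem rel_iff {L : Type} [LieRing L] [LieAlgebra ℚ L] (S : SLM M)
    (φ : FreeLieAlgebra ℚ (Generators ι) →ₗ⁅ℚ⁆ L) :
    KMRel M (fun i => φ (FreeLieAlgebra.of ℚ (Generators.H i)))
      (fun i => φ (FreeLieAlgebra.of ℚ (Generators.E i)))
      (fun i => φ (FreeLieAlgebra.of ℚ (Generators.F i))) ↔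
    ∀ x ∈ Relations.toSet ℚ M, φ x = 0 := by
  constructor
  · intro K x hx
    rcases hx with ((((⟨⟨i, j⟩, rfl⟩ | ⟨⟨i, j⟩, rfl⟩) | ⟨⟨i, j⟩, rfl⟩) | ⟨⟨i, j⟩, rfl⟩) |
      ⟨⟨i, j⟩, rfl⟩) | ⟨⟨i, j⟩, rfl⟩
    · simpa [Relations.HH] using K.hh i j
    · by_cases hij : i = j
      · subst hij
        simpa [Relations.EF, sub_eq_zero] using K.ef i
      · simpa [Relations.EF, hij] using K.ef' i j hij
    · have := K.he i j
      simp [Relations.HE, sub_eq_zero, this, Int.cast_smul_eq_zsmul]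
    · have := K.hf i j
      simp [Relations.HF, sub_eq_zero, this, Int.cast_smul_eq_zsmul]
    · by_cases hij : i = j
      · subst hij; simp [Relations.adE, S.diag]
      · rcases S.off i j hij with h0 | h0
        · simpa [Relations.adE, h0] using K.ee0 i j h0
        · simpa [Relations.adE, h0] using K.ee1 i j h0
    · by_cases hij : i = j
      · subst hij; simp [Relations.adF, S.diag]
      · rcases S.off i j hij with h0 | h0
        · simpa [Relations.adF, h0] using K.ff0 i j h0
        · simpa [Relations.adF, h0] using K.ff1 i j h0
  · intro H
    refine ⟨?_, ?_, ?_, ?_, ?_, ?_, ?_, ?_, ?_⟩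
    · intro i j
      have := H (Relations.HH ℚ (i, j)) (by simp [Relations.toSet])
      simpa [Relations.HH] using this
    · intro i
      have := H (Relations.EF ℚ (i, i)) (by simp [Relations.toSet])
      simpa [Relations.EF, sub_eq_zero] using this
    · intro i j hij
      have := H (Relations.EF ℚ (i, j)) (by simp [Relations.toSet])
      simpa [Relations.EF, hij] using this
    · intro i j
      have := H (Relations.HE ℚ M (i, j)) (by simp [Relations.toSet])
      simpa [Relations.HE, sub_eq_zero, Int.cast_smul_eq_zsmul] using this
    · intro i j
      have := H (Relations.HF ℚ M (i, j)) (by simp [Relations.toSet])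
      simpa [Relations.HF, add_eq_zero_iff_eq_neg, Int.cast_smul_eq_zsmul] using this
    · intro i j h0
      have := H (Relations.adE ℚ M (i, j)) (by simp [Relations.toSet])
      simpa [Relations.adE, h0] using this
    · intro i j h0
      have := H (Relations.adE ℚ M (i, j)) (by simp [Relations.toSet])
      simpa [Relations.adE, h0] using this
    · intro i j h0
      have := H (Relations.adF ℚ M (i, j)) (by simp [Relations.toSet])
      simpa [Relations.adF, h0] using this
    · intro i j h0
      have := H (Relations.adF ℚ M (i, j)) (by simp [Relations.toSet])
      simpa [Relations.adF, h0] using this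

theorem KM_rel (S : SLM M) : KMRel M (gH M) (gE M) (gF M) :=
  (rel_iff M S (qm M)).2 fun _ hx => qm_zero hx

theorem free_ind {X : Type} (N : LieSubalgebra ℚ (FreeLieAlgebra ℚ X))
    (hN : ∀ x, FreeLieAlgebra.of ℚ x ∈ N) (y) : y ∈ N := by
  let φ : FreeLieAlgebra ℚ X →ₗ⁅ℚ⁆ N := FreeLieAlgebra.lift ℚ fun x => ⟨_, hN x⟩
  have : N.incl.comp φ = LieHom.id := by
    apply FreeLieAlgebra.hom_ext
    intro x
    simp [φ]
  have h2 := congrArg (fun g => g y) this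
  simp only [LieHom.comp_apply, LieHom.id_apply] at h2
  rw [← h2]
  exact (φ y).2

theorem KM_std (S : SLM M) : Std M (gH M) (gE M) (gF M) where
  toKMRel := KM_rel S
  toSLM := S
  gen := by
    set N := LieSubalgebra.lieSpan ℚ (Matrix.ToLieAlgebra ℚ M) (Set.range (gE M) ∪ Set.range (gF M))
      with hN
    rw [eq_top_iff]
    intro x _
    obtain ⟨y, rfl⟩ := qm_surj x
    have hE : ∀ i, gE M i ∈ N := fun i => LieSubalgebra.subset_lieSpan (Or.inl ⟨i, rfl⟩)
    have hF : ∀ i, gF M i ∈ N := fun i => LieSubalgebra.subset_lieSpan (Or.inr ⟨i, rfl⟩)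
    refine free_ind (N.comap (qm M)) ?_ y
    rintro (i | i | i)
    · show gH M i ∈ N
      rw [← (KM_rel S).ef]
      exact N.lie_mem (hE i) (hF i)
    · exact hE i
    · exact hF i

theorem KM_univ (S : SLM M) {L : Type} [LieRing L] [LieAlgebra ℚ L] {h e f : ι → L}
    (K : KMRel M h e f) : ∃ φ : Matrix.ToLieAlgebra ℚ M →ₗ⁅ℚ⁆ L,
      (∀ i, φ (gH M i) = h i) ∧ (∀ i, φ (gE M i) = e i) ∧ (∀ i, φ (gF M i) = f i) := by
  let g : Generators ι → L := fun x => match x with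
    | Generators.H i => h i
    | Generators.E i => e i
    | Generators.F i => f i
  let ψ := FreeLieAlgebra.lift ℚ g
  have hψ : ∀ x ∈ Relations.toSet ℚ M, ψ x = 0 := by
    refine (rel_iff M S ψ).1 ?_
    simpa [ψ, g] using K
  have hker : Relations.toIdeal ℚ M ≤ ψ.ker := by
    refine LieSubmodule.lieSpan_le.2 ?_
    intro x hx
    exact LieHom.mem_ker.2 (hψ x hx)
  let φ : Matrix.ToLieAlgebra ℚ M →ₗ⁅ℚ⁆ L :=
    { Submodule.liftQ (Relations.toIdeal ℚ M).toSubmodule ψ.toLinearMap (fun x hx =>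
        LieHom.mem_ker.1 (hker hx)) with
      map_lie' := by
        intro x y
        obtain ⟨x, rfl⟩ := qm_surj x
        obtain ⟨y, rfl⟩ := qm_surj y
        exact LieHom.map_lie ψ x y }
  have hφ : ∀ x, φ (qm M x) = ψ x := fun x => rfl
  refine ⟨φ, fun i => ?_, fun i => ?_, fun i => ?_⟩
  · exact (hφ _).trans (by simp [ψ, g])
  · exact (hφ _).trans (by simp [ψ, g])
  · exact (hφ _).trans (by simp [ψ, g])

theorem KM_hom_ext {φ : Matrix.ToLieAlgebra ℚ M →ₗ⁅ℚ⁆ Matrix.ToLieAlgebra ℚ M}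
    (h1 : ∀ i, φ (gH M i) = gH M i) (h2 : ∀ i, φ (gE M i) = gE M i)
    (h3 : ∀ i, φ (gF M i) = gF M i) (x) : φ x = x := by
  have : φ.comp (qm M) = qm M := by
    apply FreeLieAlgebra.hom_ext
    rintro (i | i | i)
    · exact h1 i
    · exact h2 i
    · exact h3 i
  obtain ⟨x, rfl⟩ := qm_surj x
  exact congrArg (fun g => g x) this

theorem KM_coc (S : SLM M) : ∃ δ, Coc (gH M) (gE M) δ := by
  obtain ⟨φ, h1, h2, h3⟩ := KM_univ S (coc_rel (KM_rel S) S)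
  have hid : ∀ x, (φ x).1 = x := by
    refine KM_hom_ext (φ := SD.fstL.comp φ) ?_ ?_ ?_
    · intro i; rw [LieHom.comp_apply, h1]; rfl
    · intro i; rw [LieHom.comp_apply, h2]; rfl
    · intro i; rw [LieHom.comp_apply, h3]; rfl
  refine ⟨SD.sndL ∘ₗ φ.toLinearMap, ?_, ?_⟩
  · intro x y
    show (φ ⁅x, y⁆).2 = ⁅x, (φ y).2⁆ - ⁅y, (φ x).2⁆
    rw [LieHom.map_lie, SD.lie_snd, hid, hid]
  · intro i
    show (φ (gE M i)).2 = _
    rw [h2]; rfl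

end univ

theorem E11_mulVec (n : Fin 11 → ℤ) :
    E11M.mulVec n 0 = 2 * n 0 - n 1 ∧ E11M.mulVec n 1 = 2 * n 1 - n 0 - n 2 ∧
    E11M.mulVec n 2 = 2 * n 2 - n 1 - n 3 ∧ E11M.mulVec n 3 = 2 * n 3 - n 2 - n 4 ∧
    E11M.mulVec n 4 = 2 * n 4 - n 3 - n 5 ∧ E11M.mulVec n 5 = 2 * n 5 - n 4 - n 6 ∧
    E11M.mulVec n 6 = 2 * n 6 - n 5 - n 7 ∧ E11M.mulVec n 7 = 2 * n 7 - n 6 - n 8 - n 10 ∧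
    E11M.mulVec n 8 = 2 * n 8 - n 7 - n 9 ∧ E11M.mulVec n 9 = 2 * n 9 - n 8 ∧
    E11M.mulVec n 10 = 2 * n 10 - n 7 := by
  have hs : ∀ g : Fin 11 → ℤ, ∑ i, g i = g 0 + g 1 + g 2 + g 3 + g 4 + g 5 + g 6 + g 7 + g 8 + g 9 + g 10 := by
    intro g
    simp only [Fin.sum_univ_castSucc, Fin.sum_univ_zero, zero_add]
    rfl
  refine ⟨?_, ?_, ?_, ?_, ?_, ?_, ?_, ?_, ?_, ?_, ?_⟩ <;>
  · simp only [Matrix.mulVec, dotProduct, hs]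
    norm_num [E11M, Fin.ext_iff]
    try ring

theorem E11_sym (i j : Fin 11) : E11M i j = E11M j i := by
  simp only [E11M, Fin.ext_iff]
  split_ifs <;> first | rfl | omega

theorem E11_inj (n : Fin 11 → ℤ) (hn : E11M.mulVec n = 0) : n = 0 := by
  obtain ⟨e0, e1, e2, e3, e4, e5, e6, e7, e8, e9, e10⟩ := E11_mulVec n
  rw [hn, Pi.zero_apply] at e0 e1 e2 e3 e4 e5 e6 e7 e8 e9 e10
  have f10 : n 10 = 0 := by linarith
  have f9 : n 9 = 0 := by linarith
  have f8 : n 8 = 0 := by linarith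
  have f7 : n 7 = 0 := by linarith
  have f6 : n 6 = 0 := by linarith
  have f5 : n 5 = 0 := by linarith
  have f4 : n 4 = 0 := by linarith
  have f3 : n 3 = 0 := by linarith
  have f2 : n 2 = 0 := by linarith
  have f1 : n 1 = 0 := by linarith
  have f0 : n 0 = 0 := by linarith
  clear e0 e1 e2 e3 e4 e5 e6 e7 e8 e9 e10
  funext i
  fin_cases i <;> assumption

theorem E11_SLM : SLM E11M where
  diag i := by simp [E11M]
  off i j hij := by
    simp only [E11M, hij, if_false]
    split_ifs <;> simp
  sym := E11_sym
  inj n hn := E11_inj n hn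

end E11B

namespace E11B
section treesum
open scoped Classical TensorProduct

variable {ι : Type} [Fintype ι] [DecidableEq ι]

/-- pairs of positive vectors with `p μ + q ν = β` -/
def PS (β : ι → ℤ) (p q : ℕ) : Finset ((ι → ℤ) × (ι → ℤ)) :=
  ((Finset.Icc 0 β) ×ˢ (Finset.Icc 0 β)).filter
    (fun x => 0 < x.1 ∧ 0 < x.2 ∧ (p : ℤ) • x.1 + (q : ℤ) • x.2 = β)

theorem le_of_smul_add {p : ℕ} (hp : 1 ≤ p) {μ ρ β : ι → ℤ} (h0 : 0 ≤ μ) (hρ : 0 ≤ ρ)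
    (h : (p : ℤ) • μ + ρ = β) : μ ≤ β := by
  rw [← h]
  intro i
  have h1 := h0 i
  have h2 := hρ i
  have hp' : (1 : ℤ) ≤ p := by exact_mod_cast hp
  simp only [Pi.add_apply, Pi.smul_apply, smul_eq_mul, Pi.zero_apply] at *
  nlinarith

theorem mem_PS {β : ι → ℤ} {p q : ℕ} (hp : 1 ≤ p) (hq : 1 ≤ q) {x : (ι → ℤ) × (ι → ℤ)} :
    x ∈ PS β p q ↔ 0 < x.1 ∧ 0 < x.2 ∧ (p : ℤ) • x.1 + (q : ℤ) • x.2 = β := by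
  simp only [PS, Finset.mem_filter, Finset.mem_product, Finset.mem_Icc]
  constructor
  · exact fun h => h.2
  · intro h
    have e1 : (0 : ι → ℤ) ≤ (p : ℤ) • x.1 := smul_nonneg (by positivity) h.1.le
    have e2 : (0 : ι → ℤ) ≤ (q : ℤ) • x.2 := smul_nonneg (by positivity) h.2.1.le
    exact ⟨⟨⟨h.1.le, le_of_smul_add hp h.1.le e2 h.2.2⟩, ⟨h.2.1.le,
      le_of_smul_add hq h.2.1.le e1 (by rw [add_comm]; exact h.2.2)⟩⟩, h⟩

/-- sum over pairs -/
def Sg (T : (ι → ℤ) → (ι → ℤ) → ℚ) (β : ι → ℤ) (p q : ℕ) : ℚ := ∑ x ∈ PS β p q, T x.1 x.2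

theorem Sg_step (T : (ι → ℤ) → (ι → ℤ) → ℚ) (β : ι → ℤ) {p q : ℕ} (hp : 1 ≤ p) (hq : 1 ≤ q)
    (R : (ι → ℤ) → (ι → ℤ) → ℚ)
    (hT : ∀ μ ν, 0 < μ → 0 < ν → T μ ν = R μ ν + (if 0 < ν - μ then T μ (ν - μ) else 0)
      + (if 0 < μ - ν then T (μ - ν) ν else 0)) :
    Sg T β p q = Sg R β p q + Sg T β (p + q) q + Sg T β p (p + q) := by
  have h1 : ∑ x ∈ PS β p q, (if 0 < x.2 - x.1 then T x.1 (x.2 - x.1) else 0)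
      = Sg T β (p + q) q := by
    rw [← Finset.sum_filter, Sg]
    refine Finset.sum_bij' (fun x _ => (x.1, x.2 - x.1)) (fun x _ => (x.1, x.2 + x.1)) ?_ ?_ ?_ ?_ ?_
    · rintro ⟨μ, ν⟩ hx
      rw [Finset.mem_filter, mem_PS hp hq] at hx
      rw [mem_PS (by omega) hq]
      refine ⟨hx.1.1, hx.2, ?_⟩
      rw [← hx.1.2.2]; push_cast; module
    · rintro ⟨μ, ν⟩ hx
      rw [mem_PS (by omega) hq] at hx
      rw [Finset.mem_filter, mem_PS hp hq]
      refine ⟨⟨hx.1, add_pos hx.2.1 hx.1, ?_⟩, ?_⟩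
      · rw [← hx.2.2]; push_cast; module
      · simpa using hx.2.1
    · rintro ⟨μ, ν⟩ hx; simp
    · rintro ⟨μ, ν⟩ hx; simp
    · rintro ⟨μ, ν⟩ hx; rfl
  have h2 : ∑ x ∈ PS β p q, (if 0 < x.1 - x.2 then T (x.1 - x.2) x.2 else 0)
      = Sg T β p (p + q) := by
    rw [← Finset.sum_filter, Sg]
    refine Finset.sum_bij' (fun x _ => (x.1 - x.2, x.2)) (fun x _ => (x.1 + x.2, x.2)) ?_ ?_ ?_ ?_ ?_
    · rintro ⟨μ, ν⟩ hx
      rw [Finset.mem_filter, mem_PS hp hq] at hx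
      rw [mem_PS hp (by omega)]
      refine ⟨hx.2, hx.1.2.1, ?_⟩
      rw [← hx.1.2.2]; push_cast; module
    · rintro ⟨μ, ν⟩ hx
      rw [mem_PS hp (by omega)] at hx
      rw [Finset.mem_filter, mem_PS hp hq]
      refine ⟨⟨add_pos hx.1 hx.2.1, hx.2.1, ?_⟩, ?_⟩
      · rw [← hx.2.2]; push_cast; module
      · simpa using hx.1
    · rintro ⟨μ, ν⟩ hx; simp
    · rintro ⟨μ, ν⟩ hx; simp
    · rintro ⟨μ, ν⟩ hx; rfl
  rw [← h1, ← h2, Sg, Sg, ← Finset.sum_add_distrib, ← Finset.sum_add_distrib]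
  refine Finset.sum_congr rfl fun x hx => ?_
  rw [mem_PS hp hq] at hx
  exact hT _ _ hx.1 hx.2.1

theorem Sg_swap (R : (ι → ℤ) → (ι → ℤ) → ℚ) (hR : ∀ μ ν, R μ ν = R ν μ) (β : ι → ℤ) {p q : ℕ}
    (hp : 1 ≤ p) (hq : 1 ≤ q) : Sg R β p q = Sg R β q p := by
  refine Finset.sum_bij' (fun x _ => x.swap) (fun x _ => x.swap) ?_ ?_ ?_ ?_ ?_
  · rintro ⟨μ, ν⟩ hx
    rw [mem_PS hp hq] at hx
    rw [mem_PS hq hp]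
    exact ⟨hx.2.1, hx.1, by rw [add_comm]; exact hx.2.2⟩
  · rintro ⟨μ, ν⟩ hx
    rw [mem_PS hq hp] at hx
    rw [mem_PS hp hq]
    exact ⟨hx.2.1, hx.1, by rw [add_comm]; exact hx.2.2⟩
  · rintro ⟨μ, ν⟩ hx; rfl
  · rintro ⟨μ, ν⟩ hx; rfl
  · rintro ⟨μ, ν⟩ hx; exact hR _ _

theorem Sg_one (T : (ι → ℤ) → (ι → ℤ) → ℚ) (β : ι → ℤ) :
    ∑ μ ∈ Finset.Ioo 0 β, T μ (β - μ) = Sg T β 1 1 := by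
  refine Finset.sum_bij' (fun μ _ => (μ, β - μ)) (fun x _ => x.1) ?_ ?_ ?_ ?_ ?_
  · intro μ hμ
    rw [Finset.mem_Ioo] at hμ
    rw [mem_PS le_rfl le_rfl]
    exact ⟨hμ.1, sub_pos.2 hμ.2, by simp⟩
  · rintro ⟨μ, ν⟩ hx
    rw [mem_PS le_rfl le_rfl] at hx
    rw [Finset.mem_Ioo]
    refine ⟨hx.1, ?_⟩
    have := hx.2.2
    simp only [Nat.cast_one, one_smul] at this
    rw [← this]; exact lt_add_of_pos_right _ hx.2.1
  · intro μ hμ; rfl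
  · rintro ⟨μ, ν⟩ hx
    rw [mem_PS le_rfl le_rfl] at hx
    have := hx.2.2
    simp only [Nat.cast_one, one_smul] at this
    simp [← this]
  · intro μ hμ; rfl

/-- abstract tree -/
def treeQ (f : ℕ → ℕ → ℕ) (m : ℕ) : ℕ → ℕ → ℕ → ℕ
  | 0, _, _ => 0
  | n + 1, p, q => if p ≤ m ∧ q ≤ m then
      f p q + (treeQ f m n (p + q) q + treeQ f m n p (p + q)) else 0

theorem Sg_tree (T R : (ι → ℤ) → (ι → ℤ) → ℚ) (β : ι → ℤ)
    (hT : ∀ μ ν, 0 < μ → 0 < ν → T μ ν = R μ ν + (if 0 < ν - μ then T μ (ν - μ) else 0)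
      + (if 0 < μ - ν then T (μ - ν) ν else 0))
    (hR : ∀ μ ν, R μ ν = R ν μ) (f : ℕ → ℕ → ℕ) (m : ℕ)
    (hf : ∀ p q, 1 ≤ p → 1 ≤ q → p ≠ q → Sg R β p q ≤ f p q)
    (hm : ∀ p q, 1 ≤ p → 1 ≤ q → (m < p ∨ m < q) → Sg T β p q = 0) (n : ℕ) :
    ∀ p q, 1 ≤ p → 1 ≤ q → p ≠ q → m < n + max p q →
      Sg T β p q ≤ treeQ f m n p q ∧ Sg T β q p ≤ treeQ f m n p q := by
  induction n with
  | zero =>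
    intro p q hp hq hpq h
    have h' : m < p ∨ m < q := by
      rw [zero_add] at h; exact lt_max_iff.1 h
    rw [hm p q hp hq h', hm q p hq hp h'.symm]
    simp [treeQ]
  | succ n ih =>
    intro p q hp hq hpq h
    by_cases hc : p ≤ m ∧ q ≤ m
    · have e1 := ih (p + q) q (by omega) hq (by omega) (by omega)
      have e2 := ih p (p + q) hp (by omega) (by omega) (by omega)
      have hRR := Sg_swap R hR β hp hq
      have hff := hf p q hp hq hpq
      rw [treeQ, if_pos hc, Sg_step T β hp hq R hT, Sg_step T β hq hp R hT, ← hRR, add_comm q p]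
      push_cast
      constructor
      · linarith [e1.1, e2.1]
      · linarith [e1.2, e2.2]
    · have h' : m < p ∨ m < q := by omega
      rw [hm p q hp hq h', hm q p hq hp h'.symm]
      simp [treeQ, hc]

variable {M : Matrix ι ι ℤ} {L : Type} [LieRing L] [LieAlgebra ℚ L] {h e f : ι → L}

/-- the bound for R -/
def RU (M : Matrix ι ι ℤ) (U : (ι → ℤ) → ℕ) (μ ν : ι → ℤ) : ℕ := (-bil M μ ν).toNat * (U μ * U ν)

theorem key_bound (S : Std M h e f) {δ : L →ₗ[ℚ] L ⊗[ℚ] L} (C : Coc h e δ) {β : ι → ℤ}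
    (hβ : 0 < β) (U : (ι → ℤ) → ℕ) (hU : ∀ μ, 0 < μ → μ < β → mul' M h μ ≤ U μ)
    (f : ℕ → ℕ → ℕ) (z m : ℕ)
    (hf : ∀ p q, 1 ≤ p → 1 ≤ q → p ≠ q → ∑ x ∈ PS β p q, RU M U x.1 x.2 ≤ f p q)
    (hz : ∑ x ∈ PS β 1 1, RU M U x.1 x.2 ≤ z)
    (hm : ∀ p q, 1 ≤ p → 1 ≤ q → (m < p ∨ m < q) → ∀ x ∈ PS β p q, U x.1 = 0 ∨ U x.2 = 0) :
    (2 * ht β - bil M β β) * mul' M h β ≤ z + 2 * treeQ f m m 1 2 := by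
  set T := TT S δ with hTdef
  set R : (ι → ℤ) → (ι → ℤ) → ℚ := fun μ ν =>
    -bil M μ ν * (mul' M h μ * mul' M h ν - if μ = ν then (mul' M h μ : ℚ) else 0) with hRdef
  have hT : ∀ μ ν, 0 < μ → 0 < ν → T μ ν = R μ ν + (if 0 < ν - μ then T μ (ν - μ) else 0)
      + (if 0 < μ - ν then T (μ - ν) ν else 0) := fun μ ν hμ hν => TT_rec S C hμ hν
  have hR : ∀ μ ν, R μ ν = R ν μ := by
    intro μ ν
    simp only [hRdef]
    rw [bil_comm S.toSLM μ ν]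
    by_cases hc : μ = ν
    · subst hc; rfl
    · rw [if_neg hc, if_neg (Ne.symm hc)]; ring
  have hlt : ∀ p q, 1 ≤ p → 1 ≤ q → ∀ x ∈ PS β p q, x.1 < β ∧ x.2 < β := by
    intro p q hp hq x hx
    rw [mem_PS hp hq] at hx
    have hp' : (1 : ℤ) ≤ p := by exact_mod_cast hp
    have hq' : (1 : ℤ) ≤ q := by exact_mod_cast hq
    have e1 : x.1 ≤ (p : ℤ) • x.1 := by
      intro i
      have := hx.1.le i
      simp only [Pi.smul_apply, smul_eq_mul, Pi.zero_apply] at *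
      nlinarith
    have e2 : x.2 ≤ (q : ℤ) • x.2 := by
      intro i
      have := hx.2.1.le i
      simp only [Pi.smul_apply, smul_eq_mul, Pi.zero_apply] at *
      nlinarith
    rw [← hx.2.2]
    exact ⟨e1.trans_lt (lt_add_of_pos_right _ (hx.2.1.trans_le e2)),
      e2.trans_lt (lt_add_of_pos_left _ (hx.1.trans_le e1))⟩
  have hRb : ∀ p q, 1 ≤ p → 1 ≤ q → Sg R β p q ≤ (∑ x ∈ PS β p q, RU M U x.1 x.2 : ℕ) := by
    intro p q hp hq
    rw [Sg]; push_cast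
    refine Finset.sum_le_sum fun x hx => ?_
    have hx' := hx
    rw [mem_PS hp hq] at hx'
    have h1 := hU x.1 hx'.1 (hlt p q hp hq x hx).1
    have h2 := hU x.2 hx'.2.1 (hlt p q hp hq x hx).2
    have h12 : mul' M h x.1 * mul' M h x.2 ≤ U x.1 * U x.2 := Nat.mul_le_mul h1 h2
    have hB : (mul' M h x.1 * mul' M h x.2 - if x.1 = x.2 then (mul' M h x.1 : ℚ) else 0) ≤
        (U x.1 * U x.2 : ℕ) := by
      have : ((mul' M h x.1 * mul' M h x.2 : ℕ) : ℚ) ≤ (U x.1 * U x.2 : ℕ) := by exact_mod_cast h12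
      push_cast at *
      split_ifs
      · have : (0 : ℚ) ≤ mul' M h x.1 := by positivity
        linarith
      · linarith
    have hB0 : (0 : ℚ) ≤ (mul' M h x.1 * mul' M h x.2 - if x.1 = x.2 then (mul' M h x.1 : ℚ) else 0) := by
      split_ifs with hc
      · rw [← hc]
        have : mul' M h x.1 ≤ mul' M h x.1 * mul' M h x.1 := Nat.le_mul_self _
        have : ((mul' M h x.1 : ℕ) : ℚ) ≤ (mul' M h x.1 * mul' M h x.1 : ℕ) := by exact_mod_cast this
        push_cast at this; linarith
      · simp only [sub_zero]; positivity
    have hc : ((-bil M x.1 x.2 : ℤ) : ℚ) ≤ ((-bil M x.1 x.2).toNat : ℚ) := by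
      have := Int.self_le_toNat (-bil M x.1 x.2)
      exact_mod_cast this
    simp only [hRdef, RU]
    push_cast at *
    calc _ ≤ ((-bil M x.1 x.2).toNat : ℚ) * (mul' M h x.1 * mul' M h x.2 - if x.1 = x.2 then (mul' M h x.1 : ℚ) else 0) :=
          mul_le_mul_of_nonneg_right hc hB0
      _ ≤ _ := mul_le_mul_of_nonneg_left hB (by positivity)
  have hm' : ∀ p q, 1 ≤ p → 1 ≤ q → (m < p ∨ m < q) → Sg T β p q = 0 := by
    intro p q hp hq hpq
    refine Finset.sum_eq_zero fun x hx => ?_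
    have hx' := hx
    rw [mem_PS hp hq] at hx'
    refine TT_zero S δ hx'.1 hx'.2.1 ?_
    have h1 := hU x.1 hx'.1 (hlt p q hp hq x hx).1
    have h2 := hU x.2 hx'.2.1 (hlt p q hp hq x hx).2
    rcases hm p q hp hq hpq x hx with h0 | h0 <;> omega
  have hf' : ∀ p q, 1 ≤ p → 1 ≤ q → p ≠ q → Sg R β p q ≤ f p q := by
    intro p q hp hq hpq
    exact (hRb p q hp hq).trans (by exact_mod_cast hf p q hp hq hpq)
  have tr := Sg_tree T R β hT hR f m hf' hm' m 1 2 le_rfl (by norm_num) (by norm_num) (by omega)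
  have h11 : Sg R β 1 1 ≤ z := (hRb 1 1 le_rfl le_rfl).trans (by exact_mod_cast hz)
  have hs := TT_sum S C hβ
  rw [Sg_one, Sg_step T β le_rfl le_rfl R hT] at hs
  have : ((2 * ht β - bil M β β : ℚ) * mul' M h β) ≤ z + 2 * treeQ f m m 1 2 := by
    rw [← hs]
    have a1 := tr.1
    have a2 := tr.2
    norm_num at *
    linarith
  exact_mod_cast this

end treesum
end E11B

namespace E11B
section coords

theorem s11 {α : Type*} [AddCommMonoid α] (g : Fin 11 → α) :
    ∑ i, g i = g 0 + g 1 + g 2 + g 3 + g 4 + g 5 + g 6 + g 7 + g 8 + g 9 + g 10 := by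
  simp only [Fin.sum_univ_castSucc, Fin.sum_univ_zero, zero_add]
  rfl

theorem all11 {P : Fin 11 → Prop} (h0 : P 0) (h1 : P 1) (h2 : P 2) (h3 : P 3) (h4 : P 4) (h5 : P 5)
    (h6 : P 6) (h7 : P 7) (h8 : P 8) (h9 : P 9) (h10 : P 10) (i : Fin 11) : P i := by
  fin_cases i <;> assumption

/-- coordinates -/
def aa (n : Fin 11 → ℤ) : Fin 11 → ℤ := ![n 0, n 1 - n 0, n 2 - n 1, n 3 - n 2, n 4 - n 3, n 5 - n 4,
  n 6 - n 5, n 7 - n 6, n 8 - n 7 + n 10, n 9 - n 8 + n 10, n 10 - n 9]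

theorem aa_vals (n : Fin 11 → ℤ) : aa n 0 = n 0 ∧ aa n 1 = n 1 - n 0 ∧ aa n 2 = n 2 - n 1 ∧
    aa n 3 = n 3 - n 2 ∧ aa n 4 = n 4 - n 3 ∧ aa n 5 = n 5 - n 4 ∧ aa n 6 = n 6 - n 5 ∧
    aa n 7 = n 7 - n 6 ∧ aa n 8 = n 8 - n 7 + n 10 ∧ aa n 9 = n 9 - n 8 + n 10 ∧
    aa n 10 = n 10 - n 9 := ⟨rfl, rfl, rfl, rfl, rfl, rfl, rfl, rfl, rfl, rfl, rfl⟩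

theorem aa_lin (p q : ℤ) (μ ν : Fin 11 → ℤ) (i : Fin 11) :
    aa (p • μ + q • ν) i = p * aa μ i + q * aa ν i := by
  obtain ⟨e0, e1, e2, e3, e4, e5, e6, e7, e8, e9, e10⟩ := aa_vals μ
  obtain ⟨f0, f1, f2, f3, f4, f5, f6, f7, f8, f9, f10⟩ := aa_vals ν
  obtain ⟨g0, g1, g2, g3, g4, g5, g6, g7, g8, g9, g10⟩ := aa_vals (p • μ + q • ν)
  simp only [Pi.add_apply, Pi.smul_apply, smul_eq_mul] at *
  revert i
  apply all11
  · rw [e0, f0, g0]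
  · rw [e1, f1, g1]; ring
  · rw [e2, f2, g2]; ring
  · rw [e3, f3, g3]; ring
  · rw [e4, f4, g4]; ring
  · rw [e5, f5, g5]; ring
  · rw [e6, f6, g6]; ring
  · rw [e7, f7, g7]; ring
  · rw [e8, f8, g8]; ring
  · rw [e9, f9, g9]; ring
  · rw [e10, f10, g10]; ring

theorem aa_sum (n : Fin 11 → ℤ) : ∑ i, aa n i = 3 * n 10 := by
  obtain ⟨e0, e1, e2, e3, e4, e5, e6, e7, e8, e9, e10⟩ := aa_vals n
  rw [s11]; linarith

theorem aa_inj {n n' : Fin 11 → ℤ} (hh : aa n = aa n') : n = n' := by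
  have h10 : n 10 = n' 10 := by
    have := aa_sum n; have := aa_sum n'; rw [hh] at *; linarith
  obtain ⟨e0, e1, e2, e3, e4, e5, e6, e7, e8, e9, e10⟩ := aa_vals n
  obtain ⟨f0, f1, f2, f3, f4, f5, f6, f7, f8, f9, f10⟩ := aa_vals n'
  rw [hh] at *
  have g0 : n 0 = n' 0 := by linarith
  have g1 : n 1 = n' 1 := by linarith
  have g2 : n 2 = n' 2 := by linarith
  have g3 : n 3 = n' 3 := by linarith
  have g4 : n 4 = n' 4 := by linarith
  have g5 : n 5 = n' 5 := by linarith
  have g6 : n 6 = n' 6 := by linarith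
  have g7 : n 7 = n' 7 := by linarith
  have g8 : n 8 = n' 8 := by linarith
  have g9 : n 9 = n' 9 := by linarith
  funext i
  revert i
  apply all11 <;> assumption

theorem bil_aa (μ ν : Fin 11 → ℤ) :
    bil E11M μ ν = ∑ i, aa μ i * aa ν i - μ 10 * ν 10 := by
  obtain ⟨e0, e1, e2, e3, e4, e5, e6, e7, e8, e9, e10⟩ := aa_vals μ
  obtain ⟨f0, f1, f2, f3, f4, f5, f6, f7, f8, f9, f10⟩ := aa_vals ν
  obtain ⟨g0, g1, g2, g3, g4, g5, g6, g7, g8, g9, g10⟩ := E11_mulVec ν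
  rw [bil, s11, s11, e0, e1, e2, e3, e4, e5, e6, e7, e8, e9, e10, f0, f1, f2, f3, f4, f5, f6, f7, f8,
    f9, f10, g0, g1, g2, g3, g4, g5, g6, g7, g8, g9, g10]
  ring

theorem ht_aa (n : Fin 11 → ℤ) : ht n = 10 * aa n 0 + 9 * aa n 1 + 8 * aa n 2 + 7 * aa n 3 +
    6 * aa n 4 + 5 * aa n 5 + 4 * aa n 6 + 3 * aa n 7 + 2 * aa n 8 + aa n 9 - 2 * n 10 := by
  obtain ⟨e0, e1, e2, e3, e4, e5, e6, e7, e8, e9, e10⟩ := aa_vals n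
  rw [ht, s11, e0, e1, e2, e3, e4, e5, e6, e7, e8, e9]
  ring

theorem mulVec_aa (n : Fin 11 → ℤ) (i : Fin 10) :
    E11M.mulVec n i.castSucc = aa n i.castSucc - aa n i.succ := by
  obtain ⟨f0, f1, f2, f3, f4, f5, f6, f7, f8, f9, f10⟩ := aa_vals n
  obtain ⟨g0, g1, g2, g3, g4, g5, g6, g7, g8, g9, g10⟩ := E11_mulVec n
  fin_cases i
  · show E11M.mulVec n 0 = aa n 0 - aa n 1
    rw [g0, f0, f1]; ring
  · show E11M.mulVec n 1 = aa n 1 - aa n 2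
    rw [g1, f1, f2]; ring
  · show E11M.mulVec n 2 = aa n 2 - aa n 3
    rw [g2, f2, f3]; ring
  · show E11M.mulVec n 3 = aa n 3 - aa n 4
    rw [g3, f3, f4]; ring
  · show E11M.mulVec n 4 = aa n 4 - aa n 5
    rw [g4, f4, f5]; ring
  · show E11M.mulVec n 5 = aa n 5 - aa n 6
    rw [g5, f5, f6]; ring
  · show E11M.mulVec n 6 = aa n 6 - aa n 7
    rw [g6, f6, f7]; ring
  · show E11M.mulVec n 7 = aa n 7 - aa n 8
    rw [g7, f7, f8]; ring
  · show E11M.mulVec n 8 = aa n 8 - aa n 9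
    rw [g8, f8, f9]; ring
  · show E11M.mulVec n 9 = aa n 9 - aa n 10
    rw [g9, f9, f10]; ring

theorem aa_single (i : Fin 10) (j : Fin 11) :
    aa (Pi.single i.castSucc 1) j = if j = i.castSucc then 1 else if j = i.succ then -1 else 0 := by
  fin_cases i <;> fin_cases j <;> rfl

end coords

section roots
variable {ι : Type} [Fintype ι] [DecidableEq ι] {M : Matrix ι ι ℤ}
  {L : Type} [LieRing L] [LieAlgebra ℚ L] {h e f : ι → L}

theorem root_step (S : Std M h e f) {n : ι → ℤ} (hn : 0 < n) (h0 : mul' M h n ≠ 0) (i : ι)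
    (hk : 0 < M.mulVec n i) : n = Pi.single i 1 ∨ (0 < n - Pi.single i (M.mulVec n i) ∧
      mul' M h n ≤ mul' M h (n - Pi.single i (M.mulVec n i))) := by
  obtain ⟨k, hk'⟩ := Int.eq_ofNat_of_zero_le hk.le
  have hcol : ∀ c : ℤ, M.mulVec (Pi.single i c) i = 2 * c := by
    intro c; simp [Matrix.mulVec_single, S.diag, mul_comm]
  by_cases hex : ∃ j, j ≠ i ∧ 0 < n j
  · obtain ⟨j, hj, hnj⟩ := hex
    right
    have hj' : 0 < (n - Pi.single i (M.mulVec n i) : ι → ℤ) j := by simp [hj, hnj]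
    have hpos : 0 < n - Pi.single i (M.mulVec n i) := by
      by_contra hc
      have : ∃ l, (n - Pi.single i (M.mulVec n i) : ι → ℤ) l < 0 := by
        by_contra hc2
        push Not at hc2
        exact hc (lt_of_le_of_ne (fun l => hc2 l) (fun hh => by rw [← hh] at hj'; simp at hj'))
      obtain ⟨l, hl⟩ := this
      refine h0 (mul'_bot (refl_bot S i hk' ?_))
      rw [← hk']
      exact W_mixed S hj' hl
    refine ⟨hpos, ?_⟩
    rw [hk'] at hpos ⊢
    exact refl_le S i hk' hpos
  · push Not at hex
    left
    have hs : n = Pi.single i (n i) := by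
      funext j
      by_cases hj : j = i
      · subst hj; simp
      · have := hn.le j
        rw [Pi.single_eq_of_ne hj]
        exact le_antisymm (hex j hj) this
    have h2 : M.mulVec n i = 2 * n i := by rw [hs, hcol]; simp
    have h1 : n i = 1 := by
      by_contra hc
      refine h0 ?_
      rw [hs]
      exact mul'_bot (W_multiple S i (by omega))
    rw [h1] at hs
    exact hs

theorem bil_sub_single (S : SLM M) (n : ι → ℤ) (i : ι) :
    bil M (n - Pi.single i (M.mulVec n i)) (n - Pi.single i (M.mulVec n i)) = bil M n n := by
  set k := M.mulVec n i with hk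
  have e1 : ∀ c, bil M (Pi.single i k) c = k * M.mulVec c i := by
    intro c
    simp only [bil, Pi.single_apply, ite_mul, zero_mul, Finset.sum_ite_eq', Finset.mem_univ, if_true]
  have e2 : M.mulVec (Pi.single i k) i = 2 * k := by simp [Matrix.mulVec_single, S.diag, mul_comm]
  have hn : n = (n - Pi.single i k) + Pi.single i k := by simp
  conv_rhs => rw [hn]
  have e3 : M.mulVec (n - Pi.single i k) i = - k := by
    rw [Matrix.mulVec_sub, Pi.sub_apply, e2, ← hk]; ring
  rw [bil_add_left, bil_add_right, bil_add_right, bil_comm S _ (Pi.single i k), e1, e1, e2, e3]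
  ring

theorem ht_sub_single (n : ι → ℤ) (i : ι) (k : ℤ) : ht (n - Pi.single i k) = ht n - k := by
  simp [ht, Finset.sum_sub_distrib]

theorem ht_pos {n : ι → ℤ} (hn : 0 < n) : 0 < ht n := by
  obtain ⟨hle, i, hi⟩ := Pi.lt_def.1 hn
  exact Finset.sum_pos' (fun j _ => hle j) ⟨i, Finset.mem_univ _, hi⟩

theorem root_ind (S : Std M h e f) (P : (ι → ℤ) → Prop)
    (hs : ∀ i, P (Pi.single i 1))
    (hd : ∀ n, 0 < n → mul' M h n ≠ 0 → (∀ i, M.mulVec n i ≤ 0) → (∀ n', 0 < n' → mul' M h n' ≠ 0 → ht n' < ht n → P n') → P n)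
    (hr : ∀ n i, 0 < n → mul' M h n ≠ 0 → 0 < M.mulVec n i → 0 < n - Pi.single i (M.mulVec n i) →
      mul' M h n ≤ mul' M h (n - Pi.single i (M.mulVec n i)) → ht (n - Pi.single i (M.mulVec n i)) < ht n →
      P (n - Pi.single i (M.mulVec n i)) → P n) (n : ι → ℤ)
    (hn : 0 < n) (h0 : mul' M h n ≠ 0) : P n := by
  obtain ⟨N, hN⟩ : ∃ N : ℕ, ht n < N := ⟨(ht n).toNat + 1, by push_cast; have := Int.self_le_toNat (ht n); omega⟩
  induction N generalizing n with
  | zero => have := ht_pos hn; simp at hN; omega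
  | succ N ih =>
    by_cases hc : ∀ i, M.mulVec n i ≤ 0
    · exact hd n hn h0 hc fun n' hn' h0' hlt => ih n' hn' h0' (by push_cast at hN; omega)
    · push Not at hc
      obtain ⟨i, hi⟩ := hc
      rcases root_step S hn h0 i hi with h1 | ⟨h1, h2⟩
      · rw [h1]; exact hs i
      · have hlt : ht (n - Pi.single i (M.mulVec n i)) < ht n := by rw [ht_sub_single]; omega
        exact hr n i hn h0 hi h1 h2 hlt (ih _ h1 (by omega) (by push_cast at hN; omega))

theorem root_norm (S : Std M h e f) (n : ι → ℤ) (hn : 0 < n) (h0 : mul' M h n ≠ 0) : bil M n n ≤ 2 := by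
  refine root_ind S (fun n => bil M n n ≤ 2) ?_ ?_ ?_ n hn h0
  · intro i
    rw [bil_single_left]
    simp [Matrix.mulVec_single, S.diag]
  · intro n hn h0 hd _
    have : bil M n n ≤ 0 := by
      refine Finset.sum_nonpos fun i _ => mul_nonpos_of_nonneg_of_nonpos (hn.le i) (hd i)
    linarith
  · intro n i hn h0 hi h1 h2 hlt hP
    rwa [bil_sub_single S.toSLM] at hP

end roots

section adm
variable {L : Type} [LieRing L] [LieAlgebra ℚ L] {h e f : Fin 11 → L}

theorem asc_nonneg (n : Fin 11 → ℤ) (hn : 0 ≤ n) (hd : ∀ i : Fin 10, E11M.mulVec n i.castSucc ≤ 0) :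
    ∀ i, 0 ≤ aa n i := by
  intro i
  induction i using Fin.induction with
  | zero => exact hn 0
  | succ i ih =>
    have := hd i
    rw [mulVec_aa] at this
    linarith

theorem root_nonneg (S : Std E11M h e f) (n : Fin 11 → ℤ) (hn : 0 < n) (h0 : mul' E11M h n ≠ 0)
    (hl : 1 ≤ n 10) (j : Fin 11) : 0 ≤ aa n j := by
  obtain ⟨N, hN⟩ : ∃ N : ℕ, ht n < N := ⟨(ht n).toNat + 1, by push_cast; have := Int.self_le_toNat (ht n); omega⟩
  induction N generalizing n j with
  | zero => have := ht_pos hn; simp at hN; omega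
  | succ N ih =>
    by_cases hc : ∀ i : Fin 10, E11M.mulVec n i.castSucc ≤ 0
    · exact asc_nonneg n hn.le hc j
    · push Not at hc
      obtain ⟨i, hi⟩ := hc
      have hi10 : (10 : Fin 11) ≠ i.castSucc := by
        intro hh; have := congrArg Fin.val hh; have := i.2; simp at *; omega
      rcases root_step S hn h0 _ hi with h1 | ⟨h1, h2⟩
      · rw [h1, Pi.single_eq_of_ne hi10] at hl; omega
      · have hlt : ht (n - Pi.single i.castSucc (E11M.mulVec n i.castSucc)) < ht n := by
          rw [ht_sub_single]; omega
        have key := fun j => ih _ h1 (by omega) (by rw [Pi.sub_apply, Pi.single_eq_of_ne hi10]; omega) j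
          (by push_cast at hN; omega)
        set k := E11M.mulVec n i.castSucc with hk
        have hkk := mulVec_aa n i
        rw [← hk] at hkk
        have hv : ∀ j, aa (n - Pi.single i.castSucc k) j = aa n j - k * aa (Pi.single i.castSucc 1) j := by
          intro j
          have : n - Pi.single i.castSucc k = (1 : ℤ) • n + (-k) • (Pi.single i.castSucc 1 : Fin 11 → ℤ) := by
            rw [← Pi.single_smul]
            simp [sub_eq_add_neg, ← Pi.single_neg]
          rw [this, aa_lin]; ring
        have hne : i.succ ≠ i.castSucc := by
          intro hh; have := congrArg Fin.val hh; simp at this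
        have k1 := key i.castSucc
        have k2 := key i.succ
        have k3 := key j
        rw [hv, aa_single] at k1 k2 k3
        rw [if_pos rfl] at k1
        rw [if_neg hne, if_pos rfl] at k2
        by_cases j1 : j = i.castSucc
        · rw [j1]; linarith
        · by_cases j2 : j = i.succ
          · rw [j2]; linarith
          · rw [if_neg j1, if_neg j2] at k3; linarith

end adm
end E11B

namespace E11B
section kern
def force {α : Type} (n : Nat) (k : Nat → α) : α := Nat.rec (k 0) (fun m _ => k (Nat.succ m)) n
def lrec {α β : Type} (l : List α) (b : β) (f : α → β → β) : β := List.rec b (fun x _ ih => f x ih) l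
def nrec {β : Type} (n : Nat) (b : β) (f : Nat → β → β) : β := Nat.rec b (fun x ih => f x ih) n
def uTab : Nat := 2611982870223138147211041892299893657572647331037288284252465183053721074715130937926271306088370049826249615848421731956202289626311163457908811152147040788028027053817451498877980590736838153420347063438966887744231386184686424651043677136948929457116200131905921033877545801954652373747551357975660348335221594526073671462037907496477048944080037294859732748295452299782850654007566512463105519551028427548296128031392784799475440462795967871719704068736617383378853778362139929547214774976568802020149883605155315713
def uu (k : Nat) : Nat := Nat.land (Nat.shiftRight uTab (Nat.mul 48 k)) 281474976710655
def tri (c x : Nat) : Nat := Nat.add (Nat.div (Nat.mul (Nat.sub x c) (Nat.sub (Nat.sub x c) 1)) 2) (Nat.div (Nat.mul (Nat.sub c x) (Nat.succ (Nat.sub c x))) 2)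
def cc (l : Nat) : Nat := Nat.div (Nat.mul 3 l) 11
def KK (l : Nat) : Nat := (2 + l*l + 11*(cc l)*(cc l+1) - 3*l*(2*cc l+1))/2
structure Opt where
  (x t u : Nat)
def opts (c1 K1 c2 K2 p q a : Nat) : List Opt :=
  nrec (Nat.succ (Nat.div a p)) [] fun n ih =>
    cond (Nat.beq (Nat.mod (Nat.sub a (Nat.mul p n)) q) 0)
      (force (tri c1 n) fun t => force (tri c2 (Nat.div (Nat.sub a (Nat.mul p n)) q)) fun u =>
       cond (cond (Nat.ble t K1) (Nat.ble u K2) false) (Opt.mk n t u :: ih) ih) ih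
def lenP (os : List (List Opt)) : Nat := lrec os 1 fun o m => Nat.mul m (lrec o 0 fun _ n => Nat.succ n)
def shAdd (P w Bz Bzx : Nat) (o : List Opt) : Nat :=
  lrec o 0 fun o acc => Nat.add acc (Nat.shiftLeft P (Nat.mul w (Nat.add o.x (Nat.add (Nat.mul Bz o.t) (Nat.mul Bzx o.u)))))
def prodN (w Bz Bzx C : Nat) (os : List (List Opt)) : Nat :=
  lrec os 1 fun o P => force P fun P => Nat.land (shAdd P w Bz Bzx o) C
def wt (k p q k1 k2 : Nat) : Nat := Nat.div (Nat.sub (Nat.add k (Nat.add (Nat.mul p p) (Nat.mul q q))) (Nat.succ (Nat.add (Nat.mul (Nat.mul p p) k1) (Nat.mul (Nat.mul q q) k2)))) (Nat.mul p q)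
def nsum (n : Nat) (f : Nat → Nat) : Nat := nrec n 0 fun i ih => Nat.add (f i) ih
def Rpl (k : Nat) (as : List Nat) (p q l1 l2 : Nat) : Nat :=
  force (cc l1) fun c1 => force (KK l1) fun K1 => force (cc l2) fun c2 => force (KK l2) fun K2 =>
  (fun os : List (List Opt) => force (lenP os) fun ln => cond (Nat.beq ln 0) 0 (
  force (Nat.succ (Nat.log2 ln)) fun w =>
  force (Nat.mul 17 (Nat.add K1 26)) fun Bzx => force (Nat.mul w Bzx) fun wzx => force (Nat.mul w 17) fun wz => force (Nat.sub (Nat.pow 2 w) 1) fun D =>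
  force (Nat.sub (Nat.pow 2 (w*(Bzx*(K2+1)+3*l1))) 1) fun C =>
  force (Nat.shiftRight (prodN w 17 Bzx C os) (w*(3*l1))) fun N =>
  force (Nat.sub (Nat.pow 2 wzx) 1) fun C' => 
  nsum (Nat.succ K2) fun u => force (Nat.land (Nat.shiftRight N (Nat.mul wzx u)) C') fun N' =>
    cond (Nat.beq N' 0) 0 (
    Nat.mul (uu (Nat.sub K2 u)) (nsum (Nat.succ K1) fun t => force (wt k p q (Nat.sub K1 t) (Nat.sub K2 u)) fun x => cond (Nat.beq x 0) 0
      (Nat.mul x (Nat.mul (uu (Nat.sub K1 t)) (Nat.land (Nat.shiftRight N' (Nat.mul wz t)) D)))))))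
  (lrec as [] fun a r => opts c1 K1 c2 K2 p q a :: r)
/-- sum over l1 ≥ 1, l2 ≥ 1 -/
def Rp (k : Nat) (as : List Nat) (l p q : Nat) : Nat := nsum l fun n =>
  force (Nat.sub l (Nat.mul q n)) fun r => cond (Nat.beq n 0) 0 (cond (Nat.beq r 0) 0 (cond (Nat.beq (Nat.mod r p) 0)
    (Rpl k as p q (Nat.div r p) n) 0))
/-- levels (l2 < l1), l2 ≥ 1 -/
def R11 (k : Nat) (as : List Nat) (l : Nat) : Nat :=
  force (nsum l fun n => cond (Nat.beq n 0) 0 (cond (Nat.ble l (Nat.mul 2 n)) 0 (Rpl k as 1 1 (Nat.sub l n) n))) fun x =>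
  Nat.add (2*x) (cond (Nat.beq (Nat.mod l 2) 0) (Rpl k as 1 1 (Nat.div l 2) (Nat.div l 2)) 0)
def tree (f : Nat → Nat → Nat) (m n : Nat) : Nat → Nat → Nat := nrec n (fun _ _ => 0) fun _ ih p q =>
  cond (cond (Nat.ble p m) (Nat.ble q m) false) (Nat.add (f p q) (Nat.add (ih (Nat.add p q) q) (ih p (Nat.add p q)))) 0
def lsum (l : List Nat) : Nat := lrec l 0 Nat.add
def lsq (l : List Nat) : Nat := lrec l 0 fun a s => Nat.add (Nat.mul a a) s
def lmax (l : List Nat) : Nat := lrec l 0 Nat.max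
/-- contribution of mu = e_i - e_j -/
def zt (k p q ai aj : Nat) : Nat := cond (Nat.ble p ai) (force (Nat.div (Nat.sub (Nat.add aj (Nat.mul 2 p)) ai) q) fun w =>
  force (Nat.add k (Nat.add (Nat.mul p p) (Nat.mul q q))) fun s => force (Nat.succ (Nat.mul (Nat.mul p q) w)) fun r =>
  cond (Nat.ble r s) (Nat.mul w (uu (Nat.div (Nat.sub s r) (Nat.mul q q)))) 0) 0
def zs (k p q ai : Nat) (as : List Nat) : Nat := lrec as 0 fun aj s => Nat.add (zt k p q ai aj) s
def zall (k p q : Nat) (as : List Nat) : Nat := List.rec 0 (fun a l ih => Nat.add (zs k p q a l) ih) as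
def ndv (q : Nat) (as : List Nat) : Nat := lrec as 0 fun a s => cond (Nat.beq (Nat.mod a q) 0) s (Nat.succ s)
def zz (k : Nat) (as : List Nat) (p q : Nat) : Nat := cond (Nat.ble (ndv q as) 2) (zall k p q as) 0
def wsum (as : List Nat) : Nat := (List.rec (fun _ => 0) (fun a _ ih n => Nat.add (Nat.mul a n) (ih (Nat.pred n))) as : Nat → Nat) 10
def chk (as : List Nat) : Bool :=
  force (Nat.div (lsum as) 3) fun l => force (lmax as) fun m => force (Nat.div (Nat.sub (2 + l*l) (lsq as)) 2) fun k => 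
  force (R11 k as l) fun x => force (tree (fun p q => Nat.add (Rp k as l p q) (Nat.add (zz k as p q) (zz k as q p))) m m 1 2) fun y =>
  force (zz k as 1 1) fun z =>
  Nat.blt (x + 2*y + 2*z) ((2*(wsum as - 2*l) + 2*k - 2) * (uu k + 1))
def dec (n : Nat) : List Nat := (Nat.rec (fun _ => []) (fun _ ih n => force (Nat.mod n 16) fun a => a :: ih (Nat.div n 16)) 11 : Nat → List Nat) n
def allB (l : List Nat) : Bool := lrec l true fun n s => cond (chk (dec n)) s false
end kern

section ksound

theorem force_eq {α : Type} (n : ℕ) (k : ℕ → α) : force n k = k n := by cases n <;> rfl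
theorem lrec_nil {α β : Type} (b : β) (f : α → β → β) : lrec [] b f = b := rfl
theorem lrec_cons {α β : Type} (x : α) (l : List α) (b : β) (f : α → β → β) :
    lrec (x :: l) b f = f x (lrec l b f) := rfl
theorem nrec_zero {β : Type} (b : β) (f : ℕ → β → β) : nrec 0 b f = b := rfl
theorem nrec_succ {β : Type} (n : ℕ) (b : β) (f : ℕ → β → β) :
    nrec (n + 1) b f = f n (nrec n b f) := rfl
theorem nsum_eq (n : ℕ) (f : ℕ → ℕ) : nsum n f = ∑ i ∈ Finset.range n, f i := by
  induction n with
  | zero => rfl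
  | succ n ih => rw [Finset.sum_range_succ, ← ih, add_comm (nsum n f)]; rfl

/-- triples attached to selections -/
def sel : List (List Opt) → List (ℕ × ℕ × ℕ)
  | [] => [(0, 0, 0)]
  | o :: os => o.flatMap fun p => (sel os).map fun t => (p.x + t.1, p.t + t.2.1, p.u + t.2.2)

/-- position -/
def ps (Bz Bzx : ℕ) (t : ℕ × ℕ × ℕ) : ℕ := t.1 + (Bz * t.2.1 + Bzx * t.2.2)

/-- packed sum -/
def Qs (w Bz Bzx : ℕ) (L : List (ℕ × ℕ × ℕ)) : ℕ := (L.map fun t => 2 ^ (w * ps Bz Bzx t)).sum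

theorem lenP_eq (os : List (List Opt)) : lenP os = (sel os).length := by
  have h1 : ∀ o : List Opt, (lrec o 0 fun _ n => Nat.succ n) = o.length := by
    intro o
    induction o with
    | nil => rfl
    | cons a o ih => rw [lrec_cons, ih]; rfl
  induction os with
  | nil => rfl
  | cons o os ih =>
    have : lenP (o :: os) = Nat.mul (lenP os) (lrec o 0 fun _ n => Nat.succ n) := rfl
    rw [this, h1, ih, sel]
    simp only [List.length_flatMap, List.length_map, List.map_const', List.sum_replicate]
    rw [smul_eq_mul, mul_comm]; rfl

theorem Qs_shift (w Bz Bzx : ℕ) (p : Opt) (L : List (ℕ × ℕ × ℕ)) :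
    Qs w Bz Bzx (L.map fun t => (p.x + t.1, p.t + t.2.1, p.u + t.2.2)) =
      Qs w Bz Bzx L * 2 ^ (w * (p.x + (Bz * p.t + Bzx * p.u))) := by
  induction L with
  | nil => simp [Qs]
  | cons t L ih =>
    simp only [Qs, List.map_cons, List.sum_cons] at ih ⊢
    rw [ih, add_mul, ← pow_add]
    congr 2
    simp only [ps]; ring

theorem Qs_append (w Bz Bzx : ℕ) (L L' : List (ℕ × ℕ × ℕ)) :
    Qs w Bz Bzx (L ++ L') = Qs w Bz Bzx L + Qs w Bz Bzx L' := by simp [Qs]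

theorem shAdd_cons (P w Bz Bzx : ℕ) (p : Opt) (o : List Opt) :
    shAdd P w Bz Bzx (p :: o) = shAdd P w Bz Bzx o + P * 2 ^ (w * (p.x + (Bz * p.t + Bzx * p.u))) := by
  have : shAdd P w Bz Bzx (p :: o) = shAdd P w Bz Bzx o +
    P <<< (w * (p.x + (Bz * p.t + Bzx * p.u))) := rfl
  rw [this, Nat.shiftLeft_eq]

theorem shAdd_mod (P Q w Bz Bzx c : ℕ) (hP : P ≡ Q [MOD c]) (L : List (ℕ × ℕ × ℕ))
    (hQ : Q = Qs w Bz Bzx L) (o : List Opt) :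
    shAdd P w Bz Bzx o ≡ Qs w Bz Bzx (o.flatMap fun p => L.map fun t =>
      (p.x + t.1, p.t + t.2.1, p.u + t.2.2)) [MOD c] := by
  induction o with
  | nil => rfl
  | cons p o ih =>
    rw [shAdd_cons, List.flatMap_cons, Qs_append, Qs_shift, add_comm, ← hQ]
    exact (hP.mul_right _).add ih

theorem prodN_eq (w Bz Bzx c : ℕ) (hc : 1 ≤ c) (os : List (List Opt)) :
    prodN w Bz Bzx (Nat.sub (Nat.pow 2 c) 1) os = Qs w Bz Bzx (sel os) % 2 ^ c := by
  induction os with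
  | nil =>
    have : (1 : ℕ) < 2 ^ c := Nat.one_lt_two_pow (by omega)
    have h2 : Qs w Bz Bzx (sel []) = 1 := by simp [Qs, sel, ps]
    rw [h2, Nat.mod_eq_of_lt this]; rfl
  | cons o os ih =>
    have : prodN w Bz Bzx (Nat.sub (Nat.pow 2 c) 1) (o :: os) =
        force (prodN w Bz Bzx (Nat.sub (Nat.pow 2 c) 1) os) fun P =>
          (shAdd P w Bz Bzx o) &&& (2 ^ c - 1) := rfl
    rw [this, force_eq, Nat.and_two_pow_sub_one_eq_mod, ih]
    exact shAdd_mod _ _ w Bz Bzx (2 ^ c) (Nat.mod_modEq _ _) (sel os) rfl o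

theorem Qs_digit (w Bz Bzx P : ℕ) (L : List (ℕ × ℕ × ℕ)) :
    ∃ lo hi c n, Qs w Bz Bzx L = lo + c * 2 ^ (w * P) + hi * 2 ^ (w * (P + 1)) ∧ c ≤ L.length ∧
      lo * 2 ^ w ≤ n * 2 ^ (w * P) ∧ n ≤ L.length ∧ ∀ t, ps Bz Bzx t = P → L.count t ≤ c := by
  induction L with
  | nil => exact ⟨0, 0, 0, 0, by simp [Qs]⟩
  | cons s L ih =>
    obtain ⟨lo, hi, c, n, h1, h2, h3, h4, h5⟩ := ih
    have hQ : Qs w Bz Bzx (s :: L) = 2 ^ (w * ps Bz Bzx s) + Qs w Bz Bzx L := by simp [Qs]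
    rcases lt_trichotomy (ps Bz Bzx s) P with hlt | heq | hgt
    · refine ⟨lo + 2 ^ (w * ps Bz Bzx s), hi, c, n + 1, ?_, ?_, ?_, ?_, ?_⟩
      · rw [hQ, h1]; ring
      · simp; omega
      · have : 2 ^ (w * ps Bz Bzx s) * 2 ^ w ≤ 2 ^ (w * P) := by
          rw [← pow_add]
          apply Nat.pow_le_pow_right (by norm_num)
          nlinarith
        nlinarith
      · simp; omega
      · intro t ht
        rw [List.count_cons_of_ne]
        · exact h5 t ht
        · rintro rfl; omega
    · refine ⟨lo, hi, c + 1, n, ?_, ?_, h3, ?_, ?_⟩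
      · rw [hQ, h1, heq]; ring
      · simp; omega
      · simp; omega
      · intro t ht
        rw [List.count_cons]
        have := h5 t ht
        split_ifs <;> omega
    · refine ⟨lo, hi + 2 ^ (w * (ps Bz Bzx s - (P + 1))), c, n, ?_, ?_, h3, ?_, ?_⟩
      · rw [hQ, h1, add_mul hi, ← pow_add]
        have : w * (ps Bz Bzx s - (P + 1)) + w * (P + 1) = w * ps Bz Bzx s := by
          rw [← mul_add]; congr 1; omega
        rw [this]; ring
      · simp; omega
      · simp; omega
      · intro t ht
        rw [List.count_cons_of_ne]
        · exact h5 t ht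
        · rintro rfl; omega

theorem digit_ge (w Bz Bzx P : ℕ) (L : List (ℕ × ℕ × ℕ)) (hL : L.length < 2 ^ w) (t : ℕ × ℕ × ℕ)
    (ht : ps Bz Bzx t = P) : L.count t ≤ Qs w Bz Bzx L / 2 ^ (w * P) % 2 ^ w := by
  obtain ⟨lo, hi, c, n, h1, h2, h3, h4, h5⟩ := Qs_digit w Bz Bzx P L
  have hw : 0 < 2 ^ w := by positivity
  have hP : 0 < 2 ^ (w * P) := by positivity
  have hlo : lo < 2 ^ (w * P) := by
    have : lo * 2 ^ w < 2 ^ (w * P) * 2 ^ w := by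
      calc _ ≤ n * 2 ^ (w * P) := h3
        _ < 2 ^ w * 2 ^ (w * P) := Nat.mul_lt_mul_of_pos_right (by omega) hP
        _ = _ := mul_comm _ _
    exact Nat.lt_of_mul_lt_mul_right this
  have : Qs w Bz Bzx L = lo + 2 ^ (w * P) * (c + 2 ^ w * hi) := by
    rw [h1, mul_add w P 1, pow_add, mul_one]; ring
  rw [this, Nat.add_mul_div_left _ _ hP, Nat.div_eq_of_lt hlo, zero_add, Nat.add_mul_mod_self_left,
    Nat.mod_eq_of_lt (by omega)]
  exact h5 t ht

/-- extraction from nested masks -/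
theorem extract_eq (Q w c s z y : ℕ) (a b : ℕ) (h1 : s + z + a ≤ c) (h2 : y + w ≤ a) :
    ((Q % 2 ^ c) / 2 ^ s / 2 ^ z % 2 ^ a) / 2 ^ y % 2 ^ w = Q / 2 ^ (s + z + y) % 2 ^ w := by
  apply Nat.eq_of_testBit_eq
  intro i
  simp only [Nat.testBit_mod_two_pow, Nat.testBit_div_two_pow]
  by_cases hi : i < w
  · have e1 : y + i < a := by omega
    have e2 : s + (z + (y + i)) < c := by omega
    simp only [hi, decide_true, Bool.true_and, add_comm, add_left_comm] at *
    simp [e1, e2, add_comm, add_left_comm] <;> grind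
  · simp [hi]

end ksound
end E11B

namespace E11B
section rpl

theorem mem_opts {c1 K1 c2 K2 p q a n : ℕ} (hp : 1 ≤ p) (h1 : p * n ≤ a) (h2 : (a - p * n) % q = 0)
    (h3 : tri c1 n ≤ K1) (h4 : tri c2 ((a - p * n) / q) ≤ K2) :
    Opt.mk n (tri c1 n) (tri c2 ((a - p * n) / q)) ∈ opts c1 K1 c2 K2 p q a := by
  have hn : n < a / p + 1 := by
    have : n ≤ a / p := (Nat.le_div_iff_mul_le (by omega)).2 (by rw [mul_comm]; exact h1)
    omega
  have hn' : n < Nat.succ (Nat.div a p) := hn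
  rw [opts]
  simp only [force_eq]
  generalize Nat.succ (Nat.div a p) = N at hn'
  clear hn
  induction N with
  | zero => omega
  | succ N ih =>
    rw [nrec_succ]
    by_cases hc : n = N
    · subst hc
      have e1 : Nat.beq (Nat.mod (Nat.sub a (Nat.mul p n)) q) 0 = true := by
        rw [Nat.beq_eq]; exact h2
      have e2 : Nat.ble (tri c1 n) K1 = true := by rw [Nat.ble_eq]; exact h3
      have e3 : Nat.ble (tri c2 (Nat.div (Nat.sub a (Nat.mul p n)) q)) K2 = true := by
        rw [Nat.ble_eq]; exact h4
      simp only [e1, e2, e3, cond_true]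
      exact List.mem_cons_self
    · have := ih (by omega)
      cases (Nat.beq (Nat.mod (Nat.sub a (Nat.mul p N)) q) 0)
      · exact this
      · rw [cond_true]
        cases (cond (Nat.ble (tri c1 N) K1) (Nat.ble (tri c2 (Nat.div (Nat.sub a (Nat.mul p N)) q)) K2) false)
        · exact this
        · exact List.mem_cons_of_mem _ this

/-- the triple of a vector -/
def trip (c1 c2 p q : ℕ) : List ℕ → List ℕ → ℕ × ℕ × ℕ
  | a :: as, x :: v => (x + (trip c1 c2 p q as v).1, tri c1 x + (trip c1 c2 p q as v).2.1,
      tri c2 ((a - p * x) / q) + (trip c1 c2 p q as v).2.2)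
  | _, _ => (0, 0, 0)

/-- list of all vectors -/
def vs (c1 K1 c2 K2 p q : ℕ) : List ℕ → List (List ℕ)
  | [] => [[]]
  | a :: as => (opts c1 K1 c2 K2 p q a).flatMap fun o => (vs c1 K1 c2 K2 p q as).map fun v => o.x :: v

theorem opts_form {c1 K1 c2 K2 p q a : ℕ} {o : Opt} (ho : o ∈ opts c1 K1 c2 K2 p q a) :
    o.t = tri c1 o.x ∧ o.u = tri c2 ((a - p * o.x) / q) := by
  rw [opts] at ho
  generalize Nat.succ (Nat.div a p) = N at *
  induction N with
  | zero => rw [nrec_zero] at ho; cases ho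
  | succ N ih =>
    rw [nrec_succ] at ho
    simp only [force_eq] at ho ih
    cases h1 : (Nat.beq (Nat.mod (Nat.sub a (Nat.mul p N)) q) 0) <;> rw [h1] at ho
    · exact ih ho
    · simp only [cond_true] at ho
      cases h2 : (cond (Nat.ble (tri c1 N) K1) (Nat.ble (tri c2 (Nat.div (Nat.sub a (Nat.mul p N)) q)) K2) false) <;>
        rw [h2] at ho
      · exact ih ho
      · simp only [cond_true] at ho
        rcases List.mem_cons.1 ho with h | h
        · rw [h]; exact ⟨rfl, rfl⟩
        · exact ih h

theorem sel_vs (c1 K1 c2 K2 p q : ℕ) (as : List ℕ) :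
    sel (lrec as [] fun a r => opts c1 K1 c2 K2 p q a :: r) =
      (vs c1 K1 c2 K2 p q as).map (trip c1 c2 p q as) := by
  induction as with
  | nil => rfl
  | cons a as ih =>
    rw [lrec_cons, sel, ih, vs, List.map_flatMap]
    apply List.flatMap_congr
    intro o ho
    obtain ⟨e1, e2⟩ := opts_form ho
    rw [List.map_map, List.map_map]
    apply List.map_congr_left
    intro v _
    simp only [Function.comp_apply, trip, e1, e2]

theorem sum_G (L : List (ℕ × ℕ × ℕ)) (X K1 K2 : ℕ) (g : ℕ → ℕ → ℕ) :
    (L.map fun t => if t.1 = X ∧ t.2.1 ≤ K1 ∧ t.2.2 ≤ K2 then g t.2.1 t.2.2 else 0).sum ≤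
      ∑ u ∈ Finset.range (K2 + 1), ∑ t ∈ Finset.range (K1 + 1), g t u * L.count (X, t, u) := by
  induction L with
  | nil => simp
  | cons s L ih =>
    rw [List.map_cons, List.sum_cons]
    have : ∀ u t, g t u * (s :: L).count (X, t, u) = g t u * L.count (X, t, u) +
        (if s = (X, t, u) then g t u else 0) := by
      intro u t
      rw [List.count_cons]
      by_cases hs : s = (X, t, u) <;> simp [hs, mul_add]
    simp only [this, Finset.sum_add_distrib]
    rw [add_comm]
    refine Nat.add_le_add ih ?_
    split_ifs with hc
    · obtain ⟨rfl, h1, h2⟩ := hc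
      refine le_trans ?_ (Finset.single_le_sum (f := fun u => ∑ t ∈ Finset.range (K1 + 1), if s = (s.1, t, u) then g t u else 0)
        (fun _ _ => Nat.zero_le _) (Finset.mem_range.2 (Nat.lt_succ_of_le h2)))
      refine le_trans ?_ (Finset.single_le_sum (f := fun t => if s = (s.1, t, s.2.2) then g t s.2.2 else 0)
        (fun _ _ => Nat.zero_le _) (Finset.mem_range.2 (Nat.lt_succ_of_le h1)))
      simp
    · exact Nat.zero_le _

theorem Rpl_ge (k : ℕ) (as : List ℕ) (p q l1 l2 : ℕ) :
    ∑ u ∈ Finset.range (KK l2 + 1), ∑ t ∈ Finset.range (KK l1 + 1),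
      (wt k p q (KK l1 - t) (KK l2 - u) * (uu (KK l1 - t) * uu (KK l2 - u))) *
        ((vs (cc l1) (KK l1) (cc l2) (KK l2) p q as).map (trip (cc l1) (cc l2) p q as)).count (3 * l1, t, u)
      ≤ Rpl k as p q l1 l2 := by
  rw [← sel_vs]
  set os := (lrec as [] fun a r => opts (cc l1) (KK l1) (cc l2) (KK l2) p q a :: r) with hos
  rw [Rpl]
  simp only [force_eq]
  rw [← hos]
  generalize KK l1 = K1
  generalize KK l2 = K2
  by_cases hz : lenP os = 0
  · have : sel os = [] := by rw [lenP_eq] at hz; exact List.eq_nil_of_length_eq_zero hz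
    rw [this]; simp
  have hb : Nat.beq (lenP os) 0 = false := by
    cases hh : Nat.beq (lenP os) 0
    · rfl
    · exact absurd (Nat.eq_of_beq_eq_true hh) hz
  rw [hb, cond_false]
  set w := Nat.succ (Nat.log2 (lenP os)) with hw
  have hlen : (sel os).length < 2 ^ w := by rw [← lenP_eq]; exact Nat.lt_log2_self
  set Bzx := Nat.mul 17 (Nat.add K1 26) with hB
  have hB' : Bzx = 17 * (K1 + 26) := rfl
  have hw1 : 1 ≤ w := by omega
  have hc1 : 1 ≤ w * (Bzx * (K2 + 1) + 3 * l1) := by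
    apply Nat.mul_pos hw1
    have : 0 < Bzx * (K2 + 1) := Nat.mul_pos (by omega) (by omega)
    omega
  rw [prodN_eq w 17 Bzx _ hc1 os, nsum_eq]
  refine Finset.sum_le_sum fun u hu => ?_
  rw [Finset.mem_range] at hu
  set N' := Nat.land (Nat.shiftRight (Nat.shiftRight (Qs w 17 Bzx (sel os) % 2 ^ (w * (Bzx * (K2 + 1) + 3 * l1))) (w * (3 * l1)))
    (Nat.mul (Nat.mul w Bzx) u)) (Nat.sub (Nat.pow 2 (Nat.mul w Bzx)) 1) with hN'
  have hN2 : N' = (Qs w 17 Bzx (sel os) % 2 ^ (w * (Bzx * (K2 + 1) + 3 * l1))) / 2 ^ (w * (3 * l1)) /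
      2 ^ (w * Bzx * u) % 2 ^ (w * Bzx) := by
    rw [hN']
    show ((_ >>> _) >>> _) &&& (2 ^ (w * Bzx) - 1) = _
    rw [Nat.and_two_pow_sub_one_eq_mod, Nat.shiftRight_eq_div_pow, Nat.shiftRight_eq_div_pow]
    rfl
  have hcnt : ∀ t ∈ Finset.range (K1 + 1), (sel os).count (3 * l1, t, u) ≤
      N' / 2 ^ (w * 17 * t) % 2 ^ w := by
    intro t ht
    rw [Finset.mem_range] at ht
    have e1 : w * 17 * t + w ≤ w * Bzx := by
      rw [hB']
      calc w * 17 * t + w = w * (17 * t + 1) := by ring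
        _ ≤ _ := Nat.mul_le_mul_left _ (by omega)
    have e2 : w * (3 * l1) + w * Bzx * u + w * Bzx ≤ w * (Bzx * (K2 + 1) + 3 * l1) := by
      calc w * (3 * l1) + w * Bzx * u + w * Bzx = w * (Bzx * (u + 1) + 3 * l1) := by ring
        _ ≤ _ := Nat.mul_le_mul_left _ (Nat.add_le_add_right (Nat.mul_le_mul_left _ (by omega)) _)
    rw [hN2, extract_eq _ _ _ _ _ _ _ 0 e2 e1]
    have e3 : w * (3 * l1) + w * Bzx * u + w * 17 * t = w * (3 * l1 + (17 * t + Bzx * u)) := by ring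
    rw [e3]
    exact digit_ge w 17 Bzx _ (sel os) hlen (3 * l1, t, u) rfl
  by_cases h0 : N' = 0
  · have : ∑ t ∈ Finset.range (K1 + 1),
      (wt k p q (K1 - t) (K2 - u) * (uu (K1 - t) * uu (K2 - u))) * (sel os).count (3 * l1, t, u) = 0 := by
      refine Finset.sum_eq_zero fun t ht => ?_
      have := hcnt t ht
      rw [h0] at this
      simp only [Nat.zero_div, Nat.zero_mod, Nat.le_zero] at this
      rw [this, mul_zero]
    rw [this]; exact Nat.zero_le _
  have hb2 : Nat.beq N' 0 = false := by
    cases hh : Nat.beq N' 0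
    · rfl
    · exact absurd (Nat.eq_of_beq_eq_true hh) h0
  rw [hb2, cond_false, nsum_eq]
  show _ ≤ uu (K2 - u) * _
  rw [Finset.mul_sum]
  refine Finset.sum_le_sum fun t ht => ?_
  have hd : Nat.land (Nat.shiftRight N' (Nat.mul (Nat.mul w 17) t)) (Nat.sub (Nat.pow 2 w) 1) =
      N' / 2 ^ (w * 17 * t) % 2 ^ w := by
    show (_ >>> _) &&& (2 ^ w - 1) = _
    rw [Nat.and_two_pow_sub_one_eq_mod, Nat.shiftRight_eq_div_pow]
    rfl
  rw [hd]
  show _ ≤ uu (K2 - u) * cond (Nat.beq (wt k p q (K1 - t) (K2 - u)) 0) 0 _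
  cases hwt : Nat.beq (wt k p q (K1 - t) (K2 - u)) 0
  · rw [cond_false]
    show _ ≤ uu (K2 - u) * (wt k p q (K1 - t) (K2 - u) * (uu (K1 - t) * _))
    calc _ ≤ (wt k p q (K1 - t) (K2 - u) * (uu (K1 - t) * uu (K2 - u))) * (N' / 2 ^ (w * 17 * t) % 2 ^ w) :=
          Nat.mul_le_mul_left _ (hcnt t ht)
      _ = _ := by ring
  · rw [Nat.eq_of_beq_eq_true hwt]; simp

theorem mem_vs {c1 K1 c2 K2 p q : ℕ} (hp : 1 ≤ p) (as v : List ℕ)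
    (hv : List.Forall₂ (fun a x => p * x ≤ a ∧ (a - p * x) % q = 0 ∧ tri c1 x ≤ K1 ∧
      tri c2 ((a - p * x) / q) ≤ K2) as v) : v ∈ vs c1 K1 c2 K2 p q as := by
  induction hv with
  | nil => simp [vs]
  | cons h1 h2 ih =>
    rw [vs, List.mem_flatMap]
    exact ⟨_, mem_opts hp h1.1 h1.2.1 h1.2.2.1 h1.2.2.2, List.mem_map.2 ⟨_, ih, rfl⟩⟩

theorem sum_toFinset_le {α : Type*} [DecidableEq α] (l : List α) (f : α → ℕ) :
    ∑ x ∈ l.toFinset, f x ≤ (l.map f).sum := by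
  induction l with
  | nil => simp
  | cons a l ih =>
    rw [List.toFinset_cons, List.map_cons, List.sum_cons]
    by_cases ha : a ∈ l.toFinset
    · rw [Finset.insert_eq_of_mem ha]; omega
    · rw [Finset.sum_insert ha]; omega

theorem Rpl_sound (k : ℕ) (as : List ℕ) {p : ℕ} (q l1 l2 : ℕ) (hp : 1 ≤ p) (V : Finset (List ℕ))
    (hV : ∀ v ∈ V, List.Forall₂ (fun a x => p * x ≤ a ∧ (a - p * x) % q = 0) as v ∧
      (trip (cc l1) (cc l2) p q as v).1 = 3 * l1 ∧ (trip (cc l1) (cc l2) p q as v).2.1 ≤ KK l1 ∧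
      (trip (cc l1) (cc l2) p q as v).2.2 ≤ KK l2) :
    ∑ v ∈ V, wt k p q (KK l1 - (trip (cc l1) (cc l2) p q as v).2.1) (KK l2 - (trip (cc l1) (cc l2) p q as v).2.2) *
      (uu (KK l1 - (trip (cc l1) (cc l2) p q as v).2.1) * uu (KK l2 - (trip (cc l1) (cc l2) p q as v).2.2))
      ≤ Rpl k as p q l1 l2 := by
  refine le_trans ?_ (Rpl_ge k as p q l1 l2)
  refine le_trans ?_ (sum_G _ (3 * l1) (KK l1) (KK l2) (fun t u =>
    wt k p q (KK l1 - t) (KK l2 - u) * (uu (KK l1 - t) * uu (KK l2 - u))))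
  rw [List.map_map]
  refine le_trans ?_ (sum_toFinset_le _ _)
  have hsub : V ⊆ (vs (cc l1) (KK l1) (cc l2) (KK l2) p q as).toFinset := by
    intro v hv
    rw [List.mem_toFinset]
    obtain ⟨h1, h2, h3, h4⟩ := hV v hv
    apply mem_vs hp
    clear h2 hV hv
    revert h3 h4
    generalize KK l1 = K1
    generalize KK l2 = K2
    intro h3 h4
    induction h1 with
    | nil => exact List.Forall₂.nil
    | cons a1 a2 ih =>
      simp only [trip] at h3 h4
      exact List.Forall₂.cons ⟨a1.1, a1.2, by omega, by omega⟩ (ih (by omega) (by omega))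
  refine le_trans ?_ (Finset.sum_le_sum_of_subset hsub)
  refine Finset.sum_le_sum fun v hv => ?_
  obtain ⟨h1, h2, h3, h4⟩ := hV v hv
  simp only [Function.comp_apply, h2, h3, h4, and_self, if_true]
  exact le_rfl

end rpl
end E11B

namespace E11B
section lev
open scoped Classical

theorem bil_even (n : Fin 11 → ℤ) : ∃ c, bil E11M n n = 2 * c := by
  obtain ⟨g0, g1, g2, g3, g4, g5, g6, g7, g8, g9, g10⟩ := E11_mulVec n
  refine ⟨n 0 * (n 0 - n 1) + n 1 * (n 1 - n 2) + n 2 * (n 2 - n 3) + n 3 * (n 3 - n 4) + n 4 * (n 4 - n 5)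
    + n 5 * (n 5 - n 6) + n 6 * (n 6 - n 7) + n 7 * (n 7 - n 8 - n 10) + n 8 * (n 8 - n 9) + n 9 * n 9 + n 10 * n 10, ?_⟩
  rw [bil, s11, g0, g1, g2, g3, g4, g5, g6, g7, g8, g9, g10]
  ring

/-- `1 - norm / 2` -/
def kN (n : Fin 11 → ℤ) : ℕ := ((2 - bil E11M n n) / 2).toNat

theorem kN_eq {n : Fin 11 → ℤ} (hn : bil E11M n n ≤ 2) : 2 * (kN n : ℤ) = 2 - bil E11M n n := by
  obtain ⟨c, hc⟩ := bil_even n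
  rw [kN, hc]
  rw [hc] at hn
  omega

/-- admissible vectors -/
def Adm (n : Fin 11 → ℤ) : Prop := bil E11M n n ≤ 2 ∧ (1 ≤ n 10 → ∀ i, 0 ≤ aa n i)

/-- the bound -/
def UU (n : Fin 11 → ℤ) : ℕ := if Adm n then uu (kN n) else 0

theorem UU_adm {n : Fin 11 → ℤ} (h : UU n ≠ 0) : Adm n := by
  by_contra hc; exact h (if_neg hc)

/-- coordinates as naturals -/
def ab (n : Fin 11 → ℤ) (i : Fin 11) : ℕ := (aa n i).toNat

theorem tri_eq (c x : ℕ) : 2 * (tri c x : ℤ) = ((x : ℤ) - c) * ((x : ℤ) - c - 1) := by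
  have hdiv : ∀ m : ℕ, 2 * (m * (m - 1) / 2) = m * (m - 1) := by
    intro m
    exact Nat.mul_div_cancel' (Nat.even_mul_pred_self m).two_dvd
  have hdiv2 : ∀ m : ℕ, 2 * (m * (m + 1) / 2) = m * (m + 1) := by
    intro m
    exact Nat.mul_div_cancel' (Nat.even_mul_succ_self m).two_dvd
  have h0 : tri c x = (x - c) * (x - c - 1) / 2 + (c - x) * (c - x + 1) / 2 := rfl
  have h1 : 2 * tri c x = (x - c) * (x - c - 1) + (c - x) * (c - x + 1) := by
    rw [h0, mul_add, hdiv, hdiv2]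
  rcases le_or_gt c x with h | h
  · obtain ⟨d, rfl⟩ := Nat.exists_eq_add_of_le h
    have e1 : c + d - c = d := by omega
    have e2 : c - (c + d) = 0 := by omega
    rw [e1, e2] at h1
    have : (2 * tri c (c + d) : ℤ) = (d * (d - 1 : ℕ) : ℕ) := by exact_mod_cast (by omega)
    rw [this]
    rcases d with _ | d
    · simp
    · push_cast; simp; 
  · obtain ⟨d, rfl⟩ := Nat.exists_eq_add_of_le h.le
    have e1 : x - (x + d) = 0 := by omega
    have e2 : x + d - x = d := by omega
    rw [e1, e2] at h1
    have : (2 * tri (x + d) x : ℤ) = (d * (d + 1) : ℕ) := by exact_mod_cast (by omega)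
    rw [this]
    push_cast; ring

theorem K_lemma (n : Fin 11 → ℤ) (l : ℕ) (hl : n 10 = l) (hb : bil E11M n n ≤ 2)
    (h0 : ∀ i, 0 ≤ aa n i) : ∑ i, tri (cc l) (ab n i) + kN n = KK l := by
  have hk := kN_eq hb
  have hs := aa_sum n
  have hbb := bil_aa n n
  have hab : ∀ i, ((ab n i : ℕ) : ℤ) = aa n i := fun i => Int.toNat_of_nonneg (h0 i)
  rw [hl] at hs hbb
  set c := cc l with hc
  have ht : 2 * (∑ i, (tri c (ab n i) : ℤ)) = ∑ i, aa n i * aa n i - (2 * c + 1) * (3 * l) + 11 * (c * (c + 1)) := by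
    rw [← hs, Finset.mul_sum, Finset.mul_sum, ← Finset.sum_sub_distrib]
    have : (11 : ℤ) * (c * (c + 1)) = ∑ i : Fin 11, ((c : ℤ) * (c + 1)) := by simp
    rw [this, ← Finset.sum_add_distrib]
    refine Finset.sum_congr rfl fun i _ => ?_
    rw [tri_eq, hab]; ring
  have key : (2 + l * l + 11 * c * (c + 1) : ℕ) = 2 * (∑ i, tri c (ab n i) + kN n) + 3 * l * (2 * c + 1) := by
    zify
    linarith
  rw [KK, ← hc, key, Nat.add_sub_cancel, Nat.mul_div_cancel_left _ (by norm_num)]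

/-- explicit list -/
def lst (g : Fin 11 → ℕ) : List ℕ := [g 0, g 1, g 2, g 3, g 4, g 5, g 6, g 7, g 8, g 9, g 10]

theorem lst_ofFn (g : Fin 11 → ℕ) : lst g = List.ofFn g := rfl

theorem lst_inj {g g' : Fin 11 → ℕ} (h : lst g = lst g') : g = g' := List.ofFn_injective h

theorem trip_lst (c1 c2 p q : ℕ) (a x : Fin 11 → ℕ) : trip c1 c2 p q (lst a) (lst x) =
    (∑ i, x i, ∑ i, tri c1 (x i), ∑ i, tri c2 ((a i - p * x i) / q)) := by
  simp only [trip, lst, s11, add_zero, add_assoc]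

theorem forall2_lst {R : ℕ → ℕ → Prop} (a x : Fin 11 → ℕ) (h : ∀ i, R (a i) (x i)) :
    List.Forall₂ R (lst a) (lst x) := by
  simp only [lst]
  exact .cons (h 0) (.cons (h 1) (.cons (h 2) (.cons (h 3) (.cons (h 4) (.cons (h 5) (.cons (h 6)
    (.cons (h 7) (.cons (h 8) (.cons (h 9) (.cons (h 10) .nil))))))))))

theorem bil_lin (p q : ℤ) (μ ν : Fin 11 → ℤ) : bil E11M (p • μ + q • ν) (p • μ + q • ν) =
    p * p * bil E11M μ μ + q * q * bil E11M ν ν + 2 * (p * q) * bil E11M μ ν := by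
  rw [bil_aa, bil_aa, bil_aa, bil_aa]
  simp only [aa_lin, Pi.add_apply, Pi.smul_apply, smul_eq_mul, s11]
  ring

theorem wt_eq {β μ ν : Fin 11 → ℤ} {p q : ℕ} (hp : 1 ≤ p) (hq : 1 ≤ q)
    (hβ : (p : ℤ) • μ + (q : ℤ) • ν = β) (h1 : bil E11M β β ≤ 2) (h2 : bil E11M μ μ ≤ 2)
    (h3 : bil E11M ν ν ≤ 2) : wt (kN β) p q (kN μ) (kN ν) = (-bil E11M μ ν).toNat := by
  have hb := bil_lin p q μ ν
  rw [hβ] at hb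
  have k1 := kN_eq h1
  have k2 := kN_eq h2
  have k3 := kN_eq h3
  have hpq : 0 < p * q := Nat.mul_pos hp hq
  have h0 : wt (kN β) p q (kN μ) (kN ν) =
    (kN β + (p * p + q * q) - (p * p * kN μ + q * q * kN ν + 1)) / (p * q) := rfl
  rw [h0]
  have e : (kN β : ℤ) + (p * p + q * q) = (p * p * kN μ + q * q * kN ν + 1) + p * q * (-bil E11M μ ν) := by
    have a2 : (p : ℤ) * p * (2 * (kN μ : ℤ)) = p * p * (2 - bil E11M μ μ) := by rw [k2]
    have a3 : (q : ℤ) * q * (2 * (kN ν : ℤ)) = q * q * (2 - bil E11M ν ν) := by rw [k3]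
    linarith
  rcases le_or_gt 0 (-bil E11M μ ν) with hs | hs
  · obtain ⟨w, hw⟩ := Int.eq_ofNat_of_zero_le hs
    rw [hw] at e ⊢
    have e' : kN β + (p * p + q * q) = (p * p * kN μ + q * q * kN ν + 1) + p * q * w := by
      exact_mod_cast e
    rw [e', Nat.add_sub_cancel_left, Nat.mul_div_cancel_left _ hpq]
    rfl
  · have : (kN β : ℤ) + (p * p + q * q) ≤ (p * p * kN μ + q * q * kN ν + 1) := by
      have : (p : ℤ) * q * (-bil E11M μ ν) ≤ 0 :=
        mul_nonpos_of_nonneg_of_nonpos (by positivity) hs.le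
      linarith
    have e' : kN β + (p * p + q * q) ≤ (p * p * kN μ + q * q * kN ν + 1) := by exact_mod_cast this
    rw [Nat.sub_eq_zero_of_le e', Nat.zero_div, Int.toNat_of_nonpos hs.le]

theorem lev_bound {β : Fin 11 → ℤ} (hβ : bil E11M β β ≤ 2) {p q l1 l2 : ℕ} (hp : 1 ≤ p) (hq : 1 ≤ q)
    (hl1 : 1 ≤ l1) (hl2 : 1 ≤ l2) (F : Finset ((Fin 11 → ℤ) × (Fin 11 → ℤ)))
    (hF : F ⊆ PS β p q) (h1 : ∀ x ∈ F, x.1 10 = l1) (h2 : ∀ x ∈ F, x.2 10 = l2) :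
    ∑ x ∈ F, RU E11M UU x.1 x.2 ≤ Rpl (kN β) (lst (ab β)) p q l1 l2 := by
  rw [← Finset.sum_filter_ne_zero]
  set F' := F.filter (fun x => RU E11M UU x.1 x.2 ≠ 0) with hF'
  have hmem : ∀ x ∈ F', x ∈ PS β p q ∧ x.1 10 = l1 ∧ x.2 10 = l2 ∧ Adm x.1 ∧ Adm x.2 := by
    intro x hx
    rw [hF', Finset.mem_filter] at hx
    have hne := hx.2
    rw [RU] at hne
    refine ⟨hF hx.1, h1 x hx.1, h2 x hx.1, UU_adm ?_, UU_adm ?_⟩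
    · intro hh; rw [hh] at hne; simp at hne
    · intro hh; rw [hh] at hne; simp at hne
  have hpos : ∀ x ∈ F', (∀ i, 0 ≤ aa x.1 i) ∧ (∀ i, 0 ≤ aa x.2 i) ∧
      ∀ i, ab β i = p * ab x.1 i + q * ab x.2 i := by
    intro x hx
    obtain ⟨g1, g2, g3, g4, g5⟩ := hmem x hx
    have a1 := g4.2 (by rw [g2]; exact_mod_cast hl1)
    have a2 := g5.2 (by rw [g3]; exact_mod_cast hl2)
    refine ⟨a1, a2, fun i => ?_⟩
    rw [mem_PS hp hq] at g1
    have := aa_lin p q x.1 x.2 i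
    rw [g1.2.2] at this
    have b1 : ((ab x.1 i : ℕ) : ℤ) = aa x.1 i := Int.toNat_of_nonneg (a1 i)
    have b2 : ((ab x.2 i : ℕ) : ℤ) = aa x.2 i := Int.toNat_of_nonneg (a2 i)
    have b3 : aa β i = ((p * ab x.1 i + q * ab x.2 i : ℕ) : ℤ) := by push_cast; rw [b1, b2, this]
    rw [ab, b3]; rfl
  have hdiv : ∀ x ∈ F', ∀ i, (ab β i - p * ab x.1 i) / q = ab x.2 i := by
    intro x hx i
    rw [(hpos x hx).2.2 i, Nat.add_sub_cancel_left, Nat.mul_div_cancel_left _ (by omega)]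
  have htrip : ∀ x ∈ F', trip (cc l1) (cc l2) p q (lst (ab β)) (lst (ab x.1)) =
      (3 * l1, KK l1 - kN x.1, KK l2 - kN x.2) ∧ kN x.1 ≤ KK l1 ∧ kN x.2 ≤ KK l2 := by
    intro x hx
    obtain ⟨g1, g2, g3, g4, g5⟩ := hmem x hx
    obtain ⟨a1, a2, a3⟩ := hpos x hx
    have b1 := K_lemma x.1 l1 g2 g4.1 a1
    have b2 := K_lemma x.2 l2 g3 g5.1 a2
    have b3 : ∑ i, ab x.1 i = 3 * l1 := by
      have := aa_sum x.1
      rw [g2] at this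
      have e : ∀ i, ((ab x.1 i : ℕ) : ℤ) = aa x.1 i := fun i => Int.toNat_of_nonneg (a1 i)
      zify
      rw [← this]
      exact Finset.sum_congr rfl fun i _ => e i
    refine ⟨?_, by omega, by omega⟩
    rw [trip_lst, b3]
    simp only [hdiv x hx]
    rw [← b1, ← b2]
    simp
  have hinj : Set.InjOn (fun x : (Fin 11 → ℤ) × (Fin 11 → ℤ) => lst (ab x.1)) F' := by
    intro x hx y hy hxy
    have e1 := lst_inj hxy
    have : aa x.1 = aa y.1 := by
      funext i
      have := congrFun e1 i
      have c1 := (hpos x hx).1 i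
      have c2 := (hpos y hy).1 i
      simp only [ab] at this
      omega
    have e2 := aa_inj this
    have g1 := (mem_PS hp hq).1 (hmem x hx).1
    have g2 := (mem_PS hp hq).1 (hmem y hy).1
    have e3 : (q : ℤ) • x.2 = (q : ℤ) • y.2 := by
      have := g1.2.2.trans g2.2.2.symm
      rw [e2] at this
      exact add_left_cancel this
    have hq0 : (q : ℤ) ≠ 0 := by omega
    exact Prod.ext e2 (smul_right_injective _ hq0 e3)
  refine le_trans ?_ (Rpl_sound (kN β) (lst (ab β)) q l1 l2 hp (F'.image fun x => lst (ab x.1)) ?_)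
  · rw [Finset.sum_image hinj]
    refine Finset.sum_le_sum fun x hx => ?_
    obtain ⟨g1, g2, g3, g4, g5⟩ := hmem x hx
    obtain ⟨e1, e2, e3⟩ := htrip x hx
    rw [e1]
    simp only
    rw [Nat.sub_sub_self e2, Nat.sub_sub_self e3, wt_eq hp hq ((mem_PS hp hq).1 g1).2.2 hβ g4.1 g5.1,
      RU, UU, UU, if_pos g4, if_pos g5]
  · intro v hv
    rw [Finset.mem_image] at hv
    obtain ⟨x, hx, rfl⟩ := hv
    obtain ⟨e1, e2, e3⟩ := htrip x hx
    rw [e1]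
    refine ⟨forall2_lst _ _ fun i => ?_, rfl, Nat.sub_le _ _, Nat.sub_le _ _⟩
    rw [(hpos x hx).2.2 i]
    exact ⟨by omega, by simp⟩

end lev
end E11B

namespace E11B
section zlev
open scoped Classical

theorem psum (n : Fin 11 → ℤ) (h : n 10 = 0) (j : Fin 11) :
    ∑ l, (if l ≤ j then aa n l else 0) = n j := by
  obtain ⟨e0, e1, e2, e3, e4, e5, e6, e7, e8, e9, e10⟩ := aa_vals n
  revert j
  apply all11 <;> simp only [s11, e0, e1, e2, e3, e4, e5, e6, e7, e8, e9, e10, h] <;> simp <;> omega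

theorem level_zero {n : Fin 11 → ℤ} (hn : 0 < n) (h : n 10 = 0) (hb : bil E11M n n ≤ 2) :
    ∃ i j, i < j ∧ aa n i = 1 ∧ aa n j = -1 ∧ ∀ l, l ≠ i → l ≠ j → aa n l = 0 := by
  have hs := aa_sum n
  have hq := bil_aa n n
  rw [h] at hs hq
  have hne : ∃ l, aa n l ≠ 0 := by
    by_contra hc
    push Not at hc
    have : n = 0 := aa_inj (by
      funext i; rw [hc]; 
      obtain ⟨e0, e1, e2, e3, e4, e5, e6, e7, e8, e9, e10⟩ := aa_vals 0
      revert i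
      apply all11 <;> simp [*])
    exact hn.ne' this
  have hp : ∃ i, 0 < aa n i := by
    by_contra hc
    push Not at hc
    obtain ⟨l, hl⟩ := hne
    have := (Finset.sum_eq_zero_iff_of_nonpos (fun i _ => hc i)).1 (by linarith) l (Finset.mem_univ _)
    exact hl this
  have hm : ∃ i, aa n i < 0 := by
    by_contra hc
    push Not at hc
    obtain ⟨l, hl⟩ := hne
    have := (Finset.sum_eq_zero_iff_of_nonneg (fun i _ => hc i)).1 (by linarith) l (Finset.mem_univ _)
    exact hl this
  obtain ⟨i, hi⟩ := hp
  obtain ⟨j, hj⟩ := hm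
  have hij : i ≠ j := by rintro rfl; omega
  have hsplit : ∑ l, aa n l * aa n l = aa n i * aa n i + (aa n j * aa n j +
      ∑ l ∈ (Finset.univ.erase i).erase j, aa n l * aa n l) := by
    rw [Finset.add_sum_erase (Finset.univ.erase i) (fun l => aa n l * aa n l)
      (Finset.mem_erase.2 ⟨hij.symm, Finset.mem_univ _⟩),
      Finset.add_sum_erase _ (fun l => aa n l * aa n l) (Finset.mem_univ _)]
  have hr : ∀ l ∈ (Finset.univ.erase i).erase j, 0 ≤ aa n l * aa n l := fun l _ => mul_self_nonneg _
  have hr0 := Finset.sum_nonneg hr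
  have hi1 : aa n i = 1 := by nlinarith
  have hj1 : aa n j = -1 := by nlinarith
  have hz : ∀ l, l ≠ i → l ≠ j → aa n l = 0 := by
    intro l h1 h2
    have h3 : ∑ l ∈ (Finset.univ.erase i).erase j, aa n l * aa n l = 0 := by
      rw [hi1, hj1] at hsplit; linarith
    have := (Finset.sum_eq_zero_iff_of_nonneg hr).1 h3 l
      (Finset.mem_erase.2 ⟨h2, Finset.mem_erase.2 ⟨h1, Finset.mem_univ _⟩⟩)
    exact mul_self_eq_zero.1 this
  refine ⟨i, j, ?_, hi1, hj1, hz⟩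
  by_contra hc
  have hji : j < i := lt_of_le_of_ne (not_lt.1 hc) hij.symm
  have h4 := psum n h j
  rw [Finset.sum_eq_single j] at h4
  · have := hn.le j
    simp only [Pi.zero_apply] at this
    rw [if_pos le_rfl] at h4
    omega
  · intro l _ hl
    split_ifs with hlj
    · exact hz l (fun hh => absurd (hh ▸ hlj) (not_le.2 hji)) hl
    · rfl
  · intro hh; exact absurd (Finset.mem_univ _) hh

theorem zs_ofFn (k p q a : ℕ) {m : ℕ} (g : Fin m → ℕ) :
    zs k p q a (List.ofFn g) = ∑ j, zt k p q a (g j) := by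
  induction m with
  | zero => rfl
  | succ m ih =>
    rw [List.ofFn_succ, Fin.sum_univ_succ, ← ih]; rfl

theorem zall_ofFn (k p q : ℕ) {m : ℕ} (g : Fin m → ℕ) :
    zall k p q (List.ofFn g) = ∑ i, ∑ j, if i < j then zt k p q (g i) (g j) else 0 := by
  induction m with
  | zero => rfl
  | succ m ih =>
    rw [List.ofFn_succ, Fin.sum_univ_succ]
    have : zall k p q (g 0 :: List.ofFn fun i : Fin m => g i.succ) =
      zs k p q (g 0) (List.ofFn fun i : Fin m => g i.succ) + zall k p q (List.ofFn fun i : Fin m => g i.succ) := rfl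
    rw [this, ih, zs_ofFn]
    congr 1
    · rw [Fin.sum_univ_succ]; simp
    · refine Finset.sum_congr rfl fun i _ => ?_
      rw [Fin.sum_univ_succ]
      simp

theorem ndv_ofFn (q : ℕ) {m : ℕ} (g : Fin m → ℕ) :
    ndv q (List.ofFn g) = ∑ i, if g i % q = 0 then 0 else 1 := by
  induction m with
  | zero => rfl
  | succ m ih =>
    rw [List.ofFn_succ, Fin.sum_univ_succ]
    have : ndv q (g 0 :: List.ofFn fun i : Fin m => g i.succ) =
      cond (Nat.beq (g 0 % q) 0) (ndv q (List.ofFn fun i : Fin m => g i.succ))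
        (Nat.succ (ndv q (List.ofFn fun i : Fin m => g i.succ))) := rfl
    rw [this, ih]
    by_cases h : g 0 % q = 0
    · rw [h]; simp
    · have : Nat.beq (g 0 % q) 0 = false := by
        rw [← Bool.not_eq_true, Nat.beq_eq]; exact h
      rw [this, if_neg h, cond_false, Nat.succ_eq_add_one, add_comm]

theorem uu_zero : uu 0 = 1 := by decide +kernel

theorem zt_eq {β μ ν : Fin 11 → ℤ} {p q : ℕ} (hp : 1 ≤ p) (hq : 1 ≤ q) (hβ : bil E11M β β ≤ 2)
    (hβ0 : ∀ l, 0 ≤ aa β l)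
    (hx : (p : ℤ) • μ + (q : ℤ) • ν = β) (hμ : Adm μ) (hν : Adm ν) (hμ0 : μ 10 = 0) (hν0 : 1 ≤ ν 10)
    {i j : Fin 11} (hij : i < j) (hi : aa μ i = 1) (hj : aa μ j = -1)
    (hz : ∀ l, l ≠ i → l ≠ j → aa μ l = 0) :
    RU E11M UU μ ν ≤ zt (kN β) p q (ab β i) (ab β j) ∧ ∀ l, l ≠ i → l ≠ j → ab β l % q = 0 := by
  have hν1 := hν.2 hν0
  have hlin : ∀ l, aa β l = p * aa μ l + q * aa ν l := fun l => by rw [← hx, aa_lin]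
  have hνn : ∀ l, ((ab ν l : ℕ) : ℤ) = aa ν l := fun l => Int.toNat_of_nonneg (hν1 l)
  have hβn : ∀ l, ((ab β l : ℕ) : ℤ) = aa β l := fun l => Int.toNat_of_nonneg (hβ0 l)
  have hbi : ab β i = p + q * ab ν i := by
    zify; rw [hνn, hβn, hlin, hi]; ring
  have hbj : ab β j + p = q * ab ν j := by
    zify; rw [hνn, hβn, hlin, hj]; ring
  have hsum : ∀ g : Fin 11 → ℤ, ∑ l, aa μ l * g l = g i - g j := by
    intro g
    rw [← Finset.add_sum_erase _ _ (Finset.mem_univ i),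
      ← Finset.add_sum_erase _ _ (Finset.mem_erase.2 ⟨hij.ne', Finset.mem_univ j⟩),
      Finset.sum_eq_zero, hi, hj]
    · ring
    · intro l hl
      rw [Finset.mem_erase, Finset.mem_erase] at hl
      rw [hz l hl.2.1 hl.1, zero_mul]
  have hμμ : bil E11M μ μ = 2 := by rw [bil_aa, hsum, hi, hj, hμ0]; norm_num
  have hμν : -bil E11M μ ν = ab ν j - ab ν i := by rw [bil_aa, hsum, hμ0, hνn, hνn]; ring
  have hkμ : kN μ = 0 := by have := kN_eq hμ.1; rw [hμμ] at this; omega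
  refine ⟨?_, fun l h1 h2 => ?_⟩
  · have h0 : zt (kN β) p q (ab β i) (ab β j) = cond (Nat.ble p (ab β i))
      (force ((ab β j + 2 * p - ab β i) / q) fun w => force (kN β + (p * p + q * q)) fun s =>
        force (p * q * w + 1) fun r => cond (Nat.ble r s) (w * (uu ((s - r) / (q * q)))) 0) 0 := rfl
    have h1 : Nat.ble p (ab β i) = true := by rw [Nat.ble_eq]; omega
    have h2 : (ab β j + 2 * p - ab β i) / q = ab ν j - ab ν i := by
      have : ab β j + 2 * p - ab β i = q * (ab ν j - ab ν i) := by rw [Nat.mul_sub]; omega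
      rw [this, Nat.mul_div_cancel_left _ (by omega)]
    rw [h0, h1, cond_true, force_eq, force_eq, force_eq, h2]
    rw [RU, hμν, UU, if_pos hμ, hkμ, uu_zero, one_mul, UU, if_pos hν]
    rcases le_or_gt (ab ν j) (ab ν i) with hle | hlt
    · have : ((ab ν j : ℤ) - ab ν i).toNat = 0 := by omega
      rw [this, zero_mul]; exact Nat.zero_le _
    · obtain ⟨w, hw⟩ := Nat.exists_eq_add_of_lt hlt
      have e1 : ab ν j - ab ν i = w + 1 := by omega
      have e2 : ((ab ν j : ℤ) - ab ν i).toNat = w + 1 := by omega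
      rw [e1, e2]
      have e3 : (ab ν j : ℤ) - ab ν i = (w + 1 : ℕ) := by omega
      have hb := bil_lin p q μ ν
      rw [hx] at hb
      have k1 := kN_eq hβ
      have k3 := kN_eq hν.1
      have e : kN β + (p * p + q * q) = (p * q * (w + 1) + 1) + q * q * kN ν := by
        zify
        have a3 : (q : ℤ) * q * (2 * (kN ν : ℤ)) = q * q * (2 - bil E11M ν ν) := by rw [k3]
        have a4 : bil E11M μ ν = -((w : ℤ) + 1) := by rw [e3] at hμν; push_cast at hμν; linarith
        rw [a4, hμμ] at hb
        linarith
      have h3 : Nat.ble (p * q * (w + 1) + 1) (kN β + (p * p + q * q)) = true := by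
        rw [Nat.ble_eq, e]; exact Nat.le_add_right _ _
      rw [h3, cond_true, e, Nat.add_sub_cancel_left, Nat.mul_div_cancel_left _ (Nat.mul_pos hq hq)]
  · have : ab β l = q * ab ν l := by
      zify; rw [hνn, hβn, hlin, hz l h1 h2]; ring
    rw [this, Nat.mul_mod_right]

theorem RU_ne {μ ν : Fin 11 → ℤ} (h : RU E11M UU μ ν ≠ 0) : Adm μ ∧ Adm ν := by
  rw [RU] at h
  refine ⟨UU_adm ?_, UU_adm ?_⟩
  · intro hh; rw [hh] at h; simp at h
  · intro hh; rw [hh] at h; simp at h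

theorem z_bound {β : Fin 11 → ℤ} (hβ : bil E11M β β ≤ 2) (hβ0 : ∀ l, 0 ≤ aa β l) (hβ1 : 1 ≤ β 10)
    {p q : ℕ} (hp : 1 ≤ p) (hq : 1 ≤ q) :
    ∑ x ∈ (PS β p q).filter (fun x => x.1 10 = 0), RU E11M UU x.1 x.2 ≤ zz (kN β) (lst (ab β)) p q := by
  rw [← Finset.sum_filter_ne_zero]
  set F := ((PS β p q).filter (fun x => x.1 10 = 0)).filter (fun x => RU E11M UU x.1 x.2 ≠ 0) with hF
  have hmem : ∀ x ∈ F, ∃ ij : Fin 11 × Fin 11, ij.1 < ij.2 ∧ aa x.1 ij.1 = 1 ∧ aa x.1 ij.2 = -1 ∧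
      (∀ l, l ≠ ij.1 → l ≠ ij.2 → aa x.1 l = 0) ∧ (p : ℤ) • x.1 + (q : ℤ) • x.2 = β ∧
      RU E11M UU x.1 x.2 ≤ zt (kN β) p q (ab β ij.1) (ab β ij.2) ∧
      ∀ l, l ≠ ij.1 → l ≠ ij.2 → ab β l % q = 0 := by
    intro x hx
    rw [hF, Finset.mem_filter, Finset.mem_filter, mem_PS hp hq] at hx
    obtain ⟨⟨⟨h1, h2, h3⟩, h4⟩, h5⟩ := hx
    obtain ⟨a1, a2⟩ := RU_ne h5
    obtain ⟨i, j, hij, hi, hj, hz⟩ := level_zero h1 h4 a1.1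
    have h6 : 1 ≤ x.2 10 := by
      have : β 10 = p * x.1 10 + q * x.2 10 := by rw [← h3]; simp
      rw [h4] at this
      have h7 := h2.le 10
      simp only [Pi.zero_apply] at h7
      rcases h7.lt_or_eq with h8 | h8
      · omega
      · rw [← h8] at this; omega
    exact ⟨(i, j), hij, hi, hj, hz, h3, zt_eq hp hq hβ hβ0 h3 a1 a2 h4 h6 hij hi hj hz⟩
  rcases F.eq_empty_or_nonempty with he | ⟨x0, hx0⟩
  · rw [he]; simp
  choose! g hg using hmem
  have hn : Nat.ble (ndv q (lst (ab β))) 2 = true := by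
    rw [Nat.ble_eq, lst_ofFn, ndv_ofFn]
    obtain ⟨h1, -, -, -, -, -, h7⟩ := hg x0 hx0
    rw [← Finset.add_sum_erase _ _ (Finset.mem_univ (g x0).1),
      ← Finset.add_sum_erase _ _ (Finset.mem_erase.2 ⟨h1.ne', Finset.mem_univ (g x0).2⟩),
      Finset.sum_eq_zero]
    · split_ifs <;> omega
    · intro l hl
      rw [Finset.mem_erase, Finset.mem_erase] at hl
      rw [if_pos (h7 l hl.2.1 hl.1)]
  rw [zz, hn, cond_true, lst_ofFn, zall_ofFn, ← Finset.sum_product']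
  have hinj : Set.InjOn g F := by
    intro x hx y hy hxy
    obtain ⟨a1, a2, a3, a4, a5, -⟩ := hg x hx
    obtain ⟨b1, b2, b3, b4, b5, -⟩ := hg y hy
    rw [← hxy] at b1 b2 b3 b4
    have e2 : x.1 = y.1 := by
      apply aa_inj
      funext l
      by_cases h1 : l = (g x).1
      · rw [h1, a2, b2]
      by_cases h2 : l = (g x).2
      · rw [h2, a3, b3]
      rw [a4 l h1 h2, b4 l h1 h2]
    have e3 : (q : ℤ) • x.2 = (q : ℤ) • y.2 := by
      have := a5.trans b5.symm
      rw [e2] at this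
      exact add_left_cancel this
    have hq0 : (q : ℤ) ≠ 0 := by omega
    exact Prod.ext e2 (smul_right_injective _ hq0 e3)
  calc ∑ x ∈ F, RU E11M UU x.1 x.2 
      ≤ ∑ x ∈ F, (if (g x).1 < (g x).2 then zt (kN β) p q (ab β (g x).1) (ab β (g x).2) else 0) := by
        refine Finset.sum_le_sum fun x hx => ?_
        rw [if_pos (hg x hx).1]; exact (hg x hx).2.2.2.2.2.1
    _ = ∑ y ∈ F.image g, (if y.1 < y.2 then zt (kN β) p q (ab β y.1) (ab β y.2) else 0) := by
        rw [Finset.sum_image hinj]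
    _ ≤ _ := Finset.sum_le_sum_of_subset (fun y _ => by simp)

theorem RU_comm (U : (Fin 11 → ℤ) → ℕ) (μ ν : Fin 11 → ℤ) : RU E11M U μ ν = RU E11M U ν μ := by
  rw [RU, RU, mul_comm (U μ)]
  congr 3
  rw [bil_aa, bil_aa, mul_comm (μ 10)]
  congr 1
  exact Finset.sum_congr rfl fun i _ => mul_comm _ _

/-- swapping the two components of a sum over pairs -/
theorem PS_swap (β : Fin 11 → ℤ) {p q : ℕ} (hp : 1 ≤ p) (hq : 1 ≤ q) (P : (Fin 11 → ℤ) → (Fin 11 → ℤ) → Prop) :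
    ∑ x ∈ (PS β p q).filter (fun x => P x.1 x.2), RU E11M UU x.1 x.2 =
    ∑ x ∈ (PS β q p).filter (fun x => P x.2 x.1), RU E11M UU x.1 x.2 := by
  refine Finset.sum_bij' (fun x _ => (x.2, x.1)) (fun x _ => (x.2, x.1)) ?_ ?_ ?_ ?_ ?_
  · intro x hx
    rw [Finset.mem_filter, mem_PS hp hq] at hx
    rw [Finset.mem_filter, mem_PS hq hp]
    exact ⟨⟨hx.1.2.1, hx.1.1, by rw [← hx.1.2.2, add_comm]⟩, hx.2⟩
  · intro x hx
    rw [Finset.mem_filter, mem_PS hq hp] at hx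
    rw [Finset.mem_filter, mem_PS hp hq]
    exact ⟨⟨hx.1.2.1, hx.1.1, by rw [← hx.1.2.2, add_comm]⟩, hx.2⟩
  · intro x _; rfl
  · intro x _; rfl
  · intro x _; exact RU_comm _ _ _

theorem le_lmax {m : ℕ} (g : Fin m → ℕ) (i : Fin m) : g i ≤ lmax (List.ofFn g) := by
  induction m with
  | zero => exact i.elim0
  | succ m ih =>
    rw [List.ofFn_succ]
    have : lmax (g 0 :: List.ofFn fun i : Fin m => g i.succ) =
      max (g 0) (lmax (List.ofFn fun i : Fin m => g i.succ)) := rfl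
    rw [this]
    refine Fin.cases ?_ (fun i => ?_) i
    · exact le_max_left _ _
    · exact le_max_of_le_right (ih (fun i => g i.succ) i)

/-- an admissible vector of positive level has two positive coordinates -/
theorem two_pos {n : Fin 11 → ℤ} (hn : Adm n) (h : 1 ≤ n 10) (i : Fin 11) : ∃ j, j ≠ i ∧ 1 ≤ aa n j := by
  by_contra hc
  push Not at hc
  have h0 := hn.2 h
  have hz : ∀ j, j ≠ i → aa n j = 0 := fun j hj => le_antisymm (by have := hc j hj; omega) (h0 j)
  have hs := aa_sum n
  have hb := bil_aa n n
  rw [Finset.sum_eq_single i (fun j _ hj => hz j hj) (by simp)] at hs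
  rw [Finset.sum_eq_single i (fun j _ hj => by rw [hz j hj, zero_mul]) (by simp), hs] at hb
  have := hn.1
  nlinarith

theorem vanish_aux {β : Fin 11 → ℤ} (hβ0 : ∀ l, 0 ≤ aa β l) (hβ1 : 1 ≤ β 10)
    {p q : ℕ} (hp : 1 ≤ p) (hq : 1 ≤ q) {μ ν : Fin 11 → ℤ} (hμ : 0 < μ) (hν : 0 < ν)
    (hx : (p : ℤ) • μ + (q : ℤ) • ν = β) (h1 : Adm μ) (h2 : Adm ν) : p ≤ lmax (lst (ab β)) := by
  have hlin : ∀ l, aa β l = p * aa μ l + q * aa ν l := fun l => by rw [← hx, aa_lin]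
  have hβn : ∀ l, ((ab β l : ℕ) : ℤ) = aa β l := fun l => Int.toNat_of_nonneg (hβ0 l)
  suffices h : ∃ l, 1 ≤ aa μ l ∧ 0 ≤ aa ν l by
    obtain ⟨l, h3, h4⟩ := h
    refine le_trans ?_ (le_lmax (ab β) l)
    zify
    rw [hβn, hlin]
    have : (0 : ℤ) ≤ q * aa ν l := by positivity
    nlinarith
  have e10 : β 10 = p * μ 10 + q * ν 10 := by rw [← hx]; simp
  have m0 := hμ.le 10
  have n0 := hν.le 10
  simp only [Pi.zero_apply] at m0 n0
  rcases n0.lt_or_eq with hn | hn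
  · have h0 := h2.2 (by omega)
    rcases m0.lt_or_eq with hm | hm
    · obtain ⟨j, -, hj⟩ := two_pos h1 (by omega) 0
      exact ⟨j, hj, h0 j⟩
    · obtain ⟨i, j, hij, hi, hj, hz⟩ := level_zero hμ hm.symm h1.1
      exact ⟨i, by omega, h0 i⟩
  · have hm : 1 ≤ μ 10 := by
      rcases m0.lt_or_eq with hm | hm
      · omega
      · rw [← hn, ← hm] at e10; omega
    obtain ⟨i, j, hij, hi, hj, hz⟩ := level_zero hν hn.symm h2.1
    obtain ⟨l, hl, hl1⟩ := two_pos h1 hm j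
    refine ⟨l, hl1, ?_⟩
    by_cases h : l = i
    · rw [h, hi]; norm_num
    · rw [hz l h hl]

theorem vanish {β : Fin 11 → ℤ} (hβ0 : ∀ l, 0 ≤ aa β l) (hβ1 : 1 ≤ β 10)
    {p q : ℕ} (hp : 1 ≤ p) (hq : 1 ≤ q) (hm : lmax (lst (ab β)) < p ∨ lmax (lst (ab β)) < q)
    (x : (Fin 11 → ℤ) × (Fin 11 → ℤ)) (hx : x ∈ PS β p q) : UU x.1 = 0 ∨ UU x.2 = 0 := by
  by_contra hc
  push Not at hc
  rw [mem_PS hp hq] at hx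
  have a1 := UU_adm hc.1
  have a2 := UU_adm hc.2
  have b1 := vanish_aux hβ0 hβ1 hp hq hx.1 hx.2.1 hx.2.2 a1 a2
  have b2 := vanish_aux hβ0 hβ1 hq hp hx.2.1 hx.1 (by rw [← hx.2.2, add_comm]) a2 a1
  omega

end zlev
end E11B

namespace E11B
section rp
open scoped Classical

/-- pairs with both levels positive -/
def PP (β : Fin 11 → ℤ) (p q : ℕ) : Finset ((Fin 11 → ℤ) × (Fin 11 → ℤ)) :=
  (PS β p q).filter fun x => x.1 10 ≠ 0 ∧ x.2 10 ≠ 0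

theorem mem_PP {β : Fin 11 → ℤ} {p q l : ℕ} (hp : 1 ≤ p) (hq : 1 ≤ q) (hl : β 10 = l)
    {x : (Fin 11 → ℤ) × (Fin 11 → ℤ)} (hx : x ∈ PP β p q) :
    ∃ a b : ℕ, x.1 10 = a ∧ x.2 10 = b ∧ 1 ≤ a ∧ 1 ≤ b ∧ p * a + q * b = l := by
  rw [PP, Finset.mem_filter, mem_PS hp hq] at hx
  obtain ⟨⟨h1, h2, h3⟩, h4, h5⟩ := hx
  have m0 := h1.le 10
  have n0 := h2.le 10
  simp only [Pi.zero_apply] at m0 n0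
  obtain ⟨a, ha⟩ := Int.eq_ofNat_of_zero_le m0
  obtain ⟨b, hb⟩ := Int.eq_ofNat_of_zero_le n0
  have e10 : β 10 = p * x.1 10 + q * x.2 10 := by rw [← h3]; simp
  refine ⟨a, b, ha, hb, by omega, by omega, ?_⟩
  rw [hl, ha, hb] at e10
  exact_mod_cast e10.symm

theorem PS_split {β : Fin 11 → ℤ} (hβ : bil E11M β β ≤ 2) (hβ0 : ∀ l, 0 ≤ aa β l) (hβ1 : 1 ≤ β 10)
    {p q : ℕ} (hp : 1 ≤ p) (hq : 1 ≤ q) : ∑ x ∈ PS β p q, RU E11M UU x.1 x.2 ≤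
      ∑ x ∈ PP β p q, RU E11M UU x.1 x.2 + (zz (kN β) (lst (ab β)) p q + zz (kN β) (lst (ab β)) q p) := by
  have h1 := z_bound hβ hβ0 hβ1 hp hq
  have h2 := z_bound hβ hβ0 hβ1 hq hp
  have h3 : ∑ x ∈ (PS β p q).filter (fun x => x.2 10 = 0), RU E11M UU x.1 x.2 =
      ∑ x ∈ (PS β q p).filter (fun x => x.1 10 = 0), RU E11M UU x.1 x.2 := by
    convert PS_swap β hp hq (fun _ y => y 10 = 0)
  rw [← h3] at h2
  refine le_trans ?_ (Nat.add_le_add le_rfl (Nat.add_le_add h1 h2))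
  rw [PP, Finset.sum_filter, Finset.sum_filter, Finset.sum_filter, ← Finset.sum_add_distrib,
    ← Finset.sum_add_distrib]
  refine Finset.sum_le_sum fun x _ => ?_
  by_cases c1 : x.1 10 = 0 <;> by_cases c2 : x.2 10 = 0 <;> simp [c1, c2]

theorem Rp_bound {β : Fin 11 → ℤ} (hβ : bil E11M β β ≤ 2) {p q l : ℕ} (hp : 1 ≤ p) (hq : 1 ≤ q)
    (hl : β 10 = l) :
    ∑ x ∈ PP β p q, RU E11M UU x.1 x.2 ≤ Rp (kN β) (lst (ab β)) l p q := by
  rw [Rp, nsum_eq]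
  rw [← Finset.sum_fiberwise_of_maps_to (s := PP β p q) (t := Finset.range l) (g := fun x => (x.2 10).toNat)]
  · refine Finset.sum_le_sum fun n hn => ?_
    rw [force_eq]
    rcases ((PP β p q).filter fun x => (x.2 10).toNat = n).eq_empty_or_nonempty with he | ⟨x0, hx0⟩
    · rw [he]; simp
    rw [Finset.mem_filter] at hx0
    obtain ⟨a, b, h1, h2, h3, h4, h5⟩ := mem_PP hp hq hl hx0.1
    have hb : b = n := by rw [← hx0.2, h2]; rfl
    subst hb
    have e1 : Nat.sub l (Nat.mul q b) = p * a := by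
      show l - q * b = p * a
      omega
    have e2 : Nat.beq b 0 = false := by rw [← Bool.not_eq_true, Nat.beq_eq]; omega
    have e3 : Nat.beq (p * a) 0 = false := by
      rw [← Bool.not_eq_true, Nat.beq_eq]
      have := Nat.mul_pos hp h3
      omega
    have e4 : Nat.beq (Nat.mod (p * a) p) 0 = true := by
      rw [Nat.beq_eq]; exact Nat.mul_mod_right _ _
    have e5 : Nat.div (p * a) p = a := Nat.mul_div_cancel_left _ hp
    rw [e1, e2, e3, e4, e5, cond_false, cond_false, cond_true]
    refine lev_bound hβ hp hq h3 h4 _ ?_ ?_ ?_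
    · intro x hx
      rw [Finset.mem_filter, PP, Finset.mem_filter] at hx
      exact hx.1.1
    · intro x hx
      rw [Finset.mem_filter] at hx
      obtain ⟨a', b', g1, g2, g3, g4, g5⟩ := mem_PP hp hq hl hx.1
      have hb' : b' = b := by rw [← hx.2, g2]; rfl
      subst hb'
      have : p * a' = p * a := by omega
      rw [g1, Nat.eq_of_mul_eq_mul_left hp this]
    · intro x hx
      rw [Finset.mem_filter] at hx
      obtain ⟨a', b', g1, g2, g3, g4, g5⟩ := mem_PP hp hq hl hx.1
      rw [← hx.2, g2]; rfl
  · intro x hx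
    obtain ⟨a, b, h1, h2, h3, h4, h5⟩ := mem_PP hp hq hl hx
    rw [Finset.mem_range, h2]
    show b < l
    nlinarith [Nat.mul_pos hp h3]

theorem R11_bound {β : Fin 11 → ℤ} (hβ : bil E11M β β ≤ 2) {l : ℕ} (hl : β 10 = l) :
    ∑ x ∈ PP β 1 1, RU E11M UU x.1 x.2 ≤ R11 (kN β) (lst (ab β)) l := by
  have key : ∑ x ∈ (PP β 1 1).filter (fun x => x.2 10 < x.1 10), RU E11M UU x.1 x.2 ≤
      nsum l fun n => cond (Nat.beq n 0) 0 (cond (Nat.ble l (Nat.mul 2 n)) 0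
        (Rpl (kN β) (lst (ab β)) 1 1 (Nat.sub l n) n)) := by
    rw [nsum_eq]
    rw [← Finset.sum_fiberwise_of_maps_to (t := Finset.range l) (g := fun x => (x.2 10).toNat)]
    · refine Finset.sum_le_sum fun n hn => ?_
      rcases Finset.eq_empty_or_nonempty (((PP β 1 1).filter (fun x => x.2 10 < x.1 10)).filter fun x => (x.2 10).toNat = n) with he | ⟨x0, hx0⟩
      · rw [he]; simp
      rw [Finset.mem_filter, Finset.mem_filter] at hx0
      obtain ⟨⟨hx1, hx2⟩, hx3⟩ := hx0
      obtain ⟨a, b, h1, h2, h3, h4, h5⟩ := mem_PP le_rfl le_rfl hl hx1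
      have hb : b = n := by rw [← hx3, h2]; rfl
      subst hb
      rw [h1, h2] at hx2
      have e2 : Nat.beq b 0 = false := by rw [← Bool.not_eq_true, Nat.beq_eq]; omega
      have e3 : Nat.ble l (Nat.mul 2 b) = false := by
        rw [← Bool.not_eq_true, Nat.ble_eq]
        show ¬ l ≤ 2 * b
        omega
      have e4 : Nat.sub l b = a := by
        show l - b = a
        omega
      rw [e2, e3, e4, cond_false, cond_false]
      refine lev_bound hβ le_rfl le_rfl h3 h4 _ ?_ ?_ ?_
      · intro x hx
        rw [Finset.mem_filter, Finset.mem_filter, PP, Finset.mem_filter] at hx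
        exact hx.1.1.1
      · intro x hx
        rw [Finset.mem_filter, Finset.mem_filter] at hx
        obtain ⟨a', b', g1, g2, g3, g4, g5⟩ := mem_PP le_rfl le_rfl hl hx.1.1
        have hb' : b' = b := by rw [← hx.2, g2]; rfl
        rw [g1]; omega
      · intro x hx
        rw [Finset.mem_filter, Finset.mem_filter] at hx
        obtain ⟨a', b', g1, g2, g3, g4, g5⟩ := mem_PP le_rfl le_rfl hl hx.1.1
        rw [← hx.2, g2]; rfl
    · intro x hx
      rw [Finset.mem_filter] at hx
      obtain ⟨a, b, h1, h2, h3, h4, h5⟩ := mem_PP le_rfl le_rfl hl hx.1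
      rw [Finset.mem_range, h2]
      show b < l
      omega
  have key2 : ∑ x ∈ (PP β 1 1).filter (fun x => x.1 10 < x.2 10), RU E11M UU x.1 x.2 =
      ∑ x ∈ (PP β 1 1).filter (fun x => x.2 10 < x.1 10), RU E11M UU x.1 x.2 := by
    have := PS_swap β le_rfl le_rfl (fun a b : Fin 11 → ℤ => (a 10 ≠ 0 ∧ b 10 ≠ 0) ∧ a 10 < b 10)
    rw [PP, Finset.filter_filter, Finset.filter_filter]
    convert this using 4
    tauto
  have key3 : ∑ x ∈ (PP β 1 1).filter (fun x => x.1 10 = x.2 10), RU E11M UU x.1 x.2 ≤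
      cond (Nat.beq (Nat.mod l 2) 0) (Rpl (kN β) (lst (ab β)) 1 1 (Nat.div l 2) (Nat.div l 2)) 0 := by
    rcases Finset.eq_empty_or_nonempty ((PP β 1 1).filter (fun x => x.1 10 = x.2 10)) with he | ⟨x0, hx0⟩
    · rw [he]; simp
    rw [Finset.mem_filter] at hx0
    obtain ⟨hx1, hx2⟩ := hx0
    obtain ⟨a, b, h1, h2, h3, h4, h5⟩ := mem_PP le_rfl le_rfl hl hx1
    have e1 : Nat.beq (Nat.mod l 2) 0 = true := by
      rw [Nat.beq_eq]
      show l % 2 = 0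
      omega
    have e2 : Nat.div l 2 = a := by
      show l / 2 = a
      omega
    rw [e1, e2, cond_true]
    refine lev_bound hβ le_rfl le_rfl h3 h3 _ ?_ ?_ ?_
    · intro x hx
      rw [Finset.mem_filter, PP, Finset.mem_filter] at hx
      exact hx.1.1
    · intro x hx
      rw [Finset.mem_filter] at hx
      obtain ⟨a', b', g1, g2, g3, g4, g5⟩ := mem_PP le_rfl le_rfl hl hx.1
      omega
    · intro x hx
      rw [Finset.mem_filter] at hx
      obtain ⟨a', b', g1, g2, g3, g4, g5⟩ := mem_PP le_rfl le_rfl hl hx.1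
      omega
  rw [R11, force_eq]
  refine le_trans ?_ (Nat.add_le_add (Nat.mul_le_mul_left 2 key) key3)
  rw [two_mul]
  nth_rewrite 1 [← key2]
  rw [Finset.sum_filter, Finset.sum_filter, Finset.sum_filter, ← Finset.sum_add_distrib,
    ← Finset.sum_add_distrib]
  refine Finset.sum_le_sum fun x _ => ?_
  rcases lt_trichotomy (x.1 10) (x.2 10) with h | h | h
  · rw [if_pos h]; omega
  · rw [if_pos h]; omega
  · rw [if_pos h]; omega

theorem tree_eq (f : ℕ → ℕ → ℕ) (m n p q : ℕ) : tree f m n p q = treeQ f m n p q := by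
  induction n generalizing p q with
  | zero => rfl
  | succ n ih =>
    have h : tree f m (n + 1) p q = cond (cond (Nat.ble p m) (Nat.ble q m) false)
      (f p q + (tree f m n (p + q) q + tree f m n p (p + q))) 0 := rfl
    rw [h, ih, ih, treeQ]
    by_cases c1 : p ≤ m
    · by_cases c2 : q ≤ m
      · have d1 : Nat.ble p m = true := by rw [Nat.ble_eq]; exact c1
        have d2 : Nat.ble q m = true := by rw [Nat.ble_eq]; exact c2
        rw [d1, d2, if_pos ⟨c1, c2⟩]; rfl
      · have d2 : Nat.ble q m = false := by rw [← Bool.not_eq_true, Nat.ble_eq]; exact c2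
        rw [d2, if_neg (fun h => c2 h.2)]; cases Nat.ble p m <;> rfl
    · have d2 : Nat.ble p m = false := by rw [← Bool.not_eq_true, Nat.ble_eq]; exact c1
      rw [d2, if_neg (fun h => c1 h.1)]; rfl

theorem lsum_ofFn {m : ℕ} (g : Fin m → ℕ) : lsum (List.ofFn g) = ∑ i, g i := by
  induction m with
  | zero => rfl
  | succ m ih => rw [List.ofFn_succ, Fin.sum_univ_succ, ← ih]; rfl

theorem lsq_ofFn {m : ℕ} (g : Fin m → ℕ) : lsq (List.ofFn g) = ∑ i, g i * g i := by
  induction m with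
  | zero => rfl
  | succ m ih => rw [List.ofFn_succ, Fin.sum_univ_succ, ← ih]; rfl

theorem wsum_lst (g : Fin 11 → ℕ) : wsum (lst g) = 10 * g 0 + 9 * g 1 + 8 * g 2 + 7 * g 3 + 6 * g 4 +
    5 * g 5 + 4 * g 6 + 3 * g 7 + 2 * g 8 + g 9 := by
  have : wsum (lst g) = g 0 * 10 + (g 1 * 9 + (g 2 * 8 + (g 3 * 7 + (g 4 * 6 + (g 5 * 5 + (g 6 * 4 +
    (g 7 * 3 + (g 8 * 2 + (g 9 * 1 + (g 10 * 0 + 0)))))))))) := rfl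
  rw [this]; ring

theorem dom_bound {L : Type} [LieRing L] [LieAlgebra ℚ L] {h e f : Fin 11 → L} (S : Std E11M h e f)
    {δ : L →ₗ[ℚ] TensorProduct ℚ L L} (C : Coc h e δ) {β : Fin 11 → ℤ} (hβ : 0 < β)
    (hb : bil E11M β β ≤ 0) (hβ0 : ∀ l, 0 ≤ aa β l) (hβ1 : 1 ≤ β 10)
    (hU : ∀ μ, 0 < μ → μ < β → mul' E11M h μ ≤ UU μ) (hc : chk (lst (ab β)) = true) :
    mul' E11M h β ≤ uu (kN β) := by
  have hb2 : bil E11M β β ≤ 2 := by omega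
  obtain ⟨l, hl⟩ := Int.eq_ofNat_of_zero_le (show 0 ≤ β 10 by omega)
  have hβn : ∀ l, ((ab β l : ℕ) : ℤ) = aa β l := fun l => Int.toNat_of_nonneg (hβ0 l)
  have e1 : Nat.div (lsum (lst (ab β))) 3 = l := by
    rw [lst_ofFn, lsum_ofFn]
    have : ∑ i, ab β i = 3 * l := by
      zify
      have := aa_sum β
      rw [hl] at this
      simp only [hβn, this]
    rw [this]
    exact Nat.mul_div_cancel_left _ (by norm_num)
  have e2 : Nat.div (Nat.sub (2 + l * l) (lsq (lst (ab β)))) 2 = kN β := by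
    rw [lst_ofFn, lsq_ofFn]
    have : 2 + l * l = 2 * kN β + ∑ i, ab β i * ab β i := by
      zify
      simp only [hβn]
      rw [kN_eq hb2, bil_aa, hl]; ring
    rw [this]
    show (2 * kN β + ∑ i, ab β i * ab β i - ∑ i, ab β i * ab β i) / 2 = kN β
    rw [Nat.add_sub_cancel, Nat.mul_div_cancel_left _ (by norm_num)]
  rw [chk, force_eq, e1, force_eq, force_eq, e2, force_eq, force_eq, force_eq, tree_eq] at hc
  set m := lmax (lst (ab β)) with hm
  have hkey := key_bound S C hβ UU hU
    (fun p q => Nat.add (Rp (kN β) (lst (ab β)) l p q) (Nat.add (zz (kN β) (lst (ab β)) p q) (zz (kN β) (lst (ab β)) q p)))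
    (R11 (kN β) (lst (ab β)) l + (zz (kN β) (lst (ab β)) 1 1 + zz (kN β) (lst (ab β)) 1 1)) m
    (fun p q hp hq _ => (PS_split hb2 hβ0 hβ1 hp hq).trans
      (Nat.add_le_add (Rp_bound hb2 hp hq hl) le_rfl))
    ((PS_split hb2 hβ0 hβ1 le_rfl le_rfl).trans (Nat.add_le_add (R11_bound hb2 hl) le_rfl))
    (fun p q hp hq hmm x hx => vanish hβ0 hβ1 hp hq hmm x hx)
  rw [Nat.blt_eq] at hc
  have hht := ht_aa β
  have hw := wsum_lst (ab β)
  have hpos := ht_pos hβ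
  have hk := kN_eq hb2
  rw [hl] at hht
  have hw' : ht β = (wsum (lst (ab β)) : ℤ) - 2 * l := by
    rw [hw, hht]; push_cast; simp only [hβn]
  have e3 : ((2 * (wsum (lst (ab β)) - 2 * l) + 2 * kN β - 2 : ℕ) : ℤ) = 2 * ht β - bil E11M β β := by
    omega
  set A := (2 * (wsum (lst (ab β)) - 2 * l) + 2 * kN β - 2 : ℕ) with hA
  by_contra hcon
  push Not at hcon
  have hle : A * (uu (kN β) + 1) ≤ A * mul' E11M h β := Nat.mul_le_mul_left _ hcon
  rw [← e3] at hkey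
  have hkey' : A * mul' E11M h β ≤ R11 (kN β) (lst (ab β)) l + (zz (kN β) (lst (ab β)) 1 1 + zz (kN β) (lst (ab β)) 1 1) +
    2 * treeQ (fun p q => Nat.add (Rp (kN β) (lst (ab β)) l p q) (Nat.add (zz (kN β) (lst (ab β)) p q) (zz (kN β) (lst (ab β)) q p))) m m 1 2 := by
    exact_mod_cast hkey
  omega

end rp
end E11B

namespace E11B
def c00 : List ℕ := [1172812402944, 2272324030737, 2345624805888, 2345624805648, 2345624801553, 3445136433696, 3445136433681, 2345624805921, 3518437208832, 3518437208592]
theorem t00 : allB c00 = true := by decide +kernel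
def c01 : List ℕ := [3518437204512, 3518437208337, 3518437204497, 4544648061474, 3513855910434, 3518437138977, 3518436090402, 4617948836640, 4617948836625, 4617948836385]
theorem t01 : allB c01 = true := by decide +kernel
def c02 : List ℕ := [4617948832290, 3518437208880, 3518437208865, 3518437208610, 4691249611776, 4691249611536, 4691249611296, 5717460464433, 4691249607456, 4691249611281]
theorem t02 : allB c02 = true := by decide +kernel
def c03 : List ℕ := [4686668313393, 5717460464418, 4691249607441, 4686668313378, 4691249607201, 4691249541936, 4691249541921, 4691249603106, 4691249541666, 4691248493361]
theorem t03 : allB c03 = true := by decide +kernel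
def c04 : List ℕ := [4691248493346, 4617948836658, 5790761239584, 4691231716146, 5790761239344, 5790761239569, 5790761239329, 5790761235249, 5790761239074, 5790761235234]
theorem t04 : allB c04 = true := by decide +kernel
def c05 : List ℕ := [6816972092211, 5786179941171, 3518437208883, 5790761169714, 4690963280691, 4691249611824, 4691249611809, 4691249611569, 4691249611554, 5790760121139]
theorem t05 : allB c05 = true := by decide +kernel
def c06 : List ℕ := [4691249607474, 5864062014720, 5864062014480, 6890272867392, 5864062014240, 6890272867377, 5859480716352, 5864062010400, 5864062014225, 4691249541939]
theorem t06 : allB c06 = true := by decide +kernel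
def c07 : List ℕ := [5859480716337, 6890272867362, 5864062010160, 5864062010385, 5864062013985, 5859480716322, 6890272867122, 5864062010145, 5859480716082, 5864061944880]
theorem t07 : allB c07 = true := by decide +kernel
def c08 : List ℕ := [5864061944865, 5864062006065, 5864062009890, 6890272863027, 5864061944625, 5864062006050, 5859480711987, 5864061944610, 5864060896320, 5864061940530]
theorem t08 : allB c08 = true := by decide +kernel
def c09 : List ℕ := [5864060896305, 5864060896290, 5790761239617, 5864060896050, 5790761239602, 5790761239347, 5864061874995, 5864060891955, 5864044119105, 6963573642528]
theorem t09 : allB c09 = true := by decide +kernel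
def c10 : List ℕ := [5864044119090, 6963573642288, 6963573642513, 6963573642273, 5864044118835, 6963573642033, 6963573638208, 6963573638193, 6963573642018, 7989784495170]
theorem t10 : allB c10 = true := by decide +kernel
def c11 : List ℕ := [6958992344130, 6963573638178, 7989784495155, 6958992344115, 6963573637938, 4691249611842, 5863775683650, 4691249611827, 6963573572673, 5863775683635]
theorem t11 : allB c11 = true := by decide +kernel
def c12 : List ℕ := [6963573572658, 6963573633843, 5864062014768, 6963573572403, 5864062014753, 5864062014528, 5864062014513, 6963572524098, 5864062014498, 6963572524083]
theorem t12 : allB c12 = true := by decide +kernel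
def c13 : List ℕ := [5864062014258, 5864062010433, 5864062010418, 6890272867395, 7036874417664, 5859480716355, 7036874417424, 5864062010163, 8063085270336, 7036874417184]
theorem t13 : allB c13 = true := by decide +kernel
def c14 : List ℕ := [5864061944898, 8063085270321, 7032293119296, 7036874413344, 7036874416944, 7036874417169, 5864061944883, 6963555746883, 7032293119281, 8063085270081]
theorem t14 : allB c14 = true := by decide +kernel
def c15 : List ℕ := [8063085270306, 7036874413104, 7036874416929, 7036874413329, 8063085270066, 7032293119041, 7032293119266, 7036874413089, 7032293119026, 7036874412849]
theorem t15 : allB c15 = true := by decide +kernel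
def c16 : List ℕ := [7036874347824, 7036874409024, 7036874416674, 8063085265986, 8063085269811, 7036874409009, 7036874412834, 7036874347809, 7036874347584, 5864060896323]
theorem t16 : allB c16 = true := by decide +kernel
def c17 : List ℕ := [7032293114946, 7032293118771, 8063085265971, 7036874347569, 7036874408994, 9089296122948, 7032293114931, 8058503971908, 7036874347554, 7036874408754]
theorem t17 : allB c17 = true := by decide +kernel
def c18 : List ℕ := [7027711820868, 5790761239620, 7036874347314, 7036874343489, 7036873299264, 8063085200451, 6963287311428, 7036874343474, 7036873299249, 6963573642576]
theorem t18 : allB c18 = true := by decide +kernel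
def c19 : List ℕ := [7032293049411, 7036873299009, 6963573642561, 7036873299234, 7036874404659, 7036873298994, 6963573642546, 7036874343219, 5864044119108, 6963573642306]
theorem t19 : allB c19 = true := by decide +kernel
def c20 : List ℕ := [7036874277954, 6963573642291, 7036873294914, 7036873298739, 7036874277939, 7036856522064, 7036873294899, 8063084151876, 7036856522049, 8136386045472]
theorem t20 : allB c20 = true := by decide +kernel
def c21 : List ℕ := [6963573638211, 7032292000836, 7036856522034, 8136386045232, 8136386045457, 7036856521794, 8136386045217, 8136386044992, 7036856521779, 7036873229379]
theorem t21 : allB c21 = true := by decide +kernel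
def c22 : List ℕ := [8136386044977, 9162596898129, 8136386041152, 9162596898114, 8131804747089, 8136386041137, 8136386044962, 7036856517699, 6963573572676, 8131804747074]
theorem t22 : allB c22 = true := by decide +kernel
def c23 : List ℕ := [9162596898099, 8136386040897, 5864062014801, 8136386041122, 8136386044722, 8131804747059, 5864062014786, 9162596897859, 8136386040882, 7036588086609]
theorem t23 : allB c23 = true := by decide +kernel
def c24 : List ℕ := [8136385975632, 8131804746819, 7036588086594, 5864062014771, 8136385975617, 7036588086579, 5864062014531, 7036872180804, 8136385975602, 8136386036802]
theorem t24 : allB c24 = true := by decide +kernel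
def c25 : List ℕ := [8136386040627, 7036588086339, 7036856452164, 8136385975362, 8136386036787, 9162596893764, 7036874417712, 8131804742724, 8136385975347, 7036874417472]
theorem t25 : allB c25 = true := by decide +kernel
def c26 : List ℕ := [7036874417697, 5864062010436, 8136384927057, 7036874417457, 7036588082244, 8136385971267, 8136384927042, 7036874417217, 7036874417442, 7036874413392]
theorem t26 : allB c26 = true := by decide +kernel
def c27 : List ℕ := [8136384927027, 8063085270354, 7036874417202, 7036874413377, 8136384926787, 8063085270339, 7032293119314, 7036874413362, 8209686820608, 7032293119299]
theorem t27 : allB c27 = true := by decide +kernel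
def c28 : List ℕ := [7036874413122, 7036874416947, 8209686820368, 8136385905732, 8063085270084, 7036874413107, 7036874347857, 9235897673280, 8209686820128, 8136384922692]
theorem t28 : allB c28 = true := by decide +kernel
def c29 : List ℕ := [7032293119044, 7036874347842, 8136368149842, 9235897673265, 8205105522240, 9235897673040, 8209686819888, 8209686816288, 8209686820113, 8136368149827]
theorem t29 : allB c29 = true := by decide +kernel
def c30 : List ℕ := [7036874347827, 7036874409027, 9235897673025, 8205105522225, 9235897673250, 8205105522000, 8209686816048, 8209686819873, 8209686816273, 7036874347587]
theorem t30 : allB c30 = true := by decide +kernel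
def c31 : List ℕ := [9235897673010, 8205105521985, 8205105522210, 8209686816033, 8209686815808, 8209686819633, 8136368149572, 8205105521970, 9235897672770, 9235897668945]
theorem t31 : allB c31 = true := by decide +kernel
def c32 : List ℕ := [8209686815793, 8209686811968, 8209686819618, 8209686750768, 7036873299282, 8205105521730, 9235897668930, 9235897672755, 8205105517905, 10262108525907]
theorem t32 : allB c32 = true := by decide +kernel
def c33 : List ℕ := [8209686811953, 8209686815778, 8209686750528, 8209686750753, 7036873299267, 7036874343492, 8205105517890, 8205105521715, 9235897668915, 9231316374867]
theorem t33 : allB c33 = true := by decide +kernel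
def c34 : List ℕ := [10262108525892, 8209686750513, 8209686811713, 8209686811938, 8209686815538, 8205105517875, 9235897668675, 8200524223827, 6963573642579, 9231316374852]
theorem t34 : allB c34 = true := by decide +kernel
def c35 : List ℕ := [8209686811698, 8209686750273, 8209686750498, 8209686746448, 7036873299012, 8205105517635, 8136099714387, 8200524223812, 6963573642564, 9235897603410]
theorem t35 : allB c35 = true := by decide +kernel
def c36 : List ℕ := [8209686750258, 8209686746433, 8209685702208, 8136099714372, 9235897603395, 8205105452370, 8209686746418, 8209686807618, 8209686811443, 8209685702193]
theorem t36 : allB c36 = true := by decide +kernel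
def c37 : List ℕ := [8209685701968, 8136386045520, 8205105452355, 9235897664580, 8209686746178, 8209686750003, 8209686807603, 8209685701953, 8136386045505, 8209685702178]
theorem t37 : allB c37 = true := by decide +kernel
def c38 : List ℕ := [7036856522067, 8205105513540, 9235897603140, 8209686746163, 8209685701938, 8136386045490, 8136386045265, 8209686680913, 8205105452100, 7036856522052]
theorem t38 : allB c38 = true := by decide +kernel
def c39 : List ℕ := [8136386045250, 8209685701698, 8209686680898, 8209685697873, 9235896554835, 8136386045235, 8209685697858, 8209685701683, 8209686680883, 8209686742083]
theorem t39 : allB c39 = true := by decide +kernel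
def c40 : List ℕ := [8209668925008, 8205104403795, 9235896554820, 8136386044995, 8136386041170, 8209685697843, 8209686680643, 8209668924993, 9309198448416, 8205104403780]
theorem t40 : allB c40 = true := by decide +kernel
def c41 : List ℕ := [8136386041155, 8209685697603, 9162596898132, 8209668924978, 8209668924753, 9309198448176, 9309198448401, 8131804747092, 8209668924738, 8209685632338]
theorem t41 : allB c41 = true := by decide +kernel
def c42 : List ℕ := [9309198447936, 10335409301088, 9309198448161, 8136386040900, 8209685632323, 8209668924723, 8209686676548, 5864062014804, 10335409301073, 9309198447921]
theorem t42 : allB c42 = true := by decide +kernel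
def c43 : List ℕ := [9304617150048, 9309198444096, 8136385975635, 7036588086612, 8209668924483, 8209685693508, 8209668920658, 10335409301058, 9304617150033, 9309198444081]
theorem t43 : allB c43 = true := by decide +kernel
def c44 : List ℕ := [9309198447681, 9309198447906, 9309198443856, 7036874417760, 8136385975620, 8209668920643, 8209685632068, 9235879777620, 9304617150018, 10335409300818]
theorem t44 : allB c44 = true := by decide +kernel
def c45 : List ℕ := [10335409301043, 7036874417745, 9309198443841, 9309198447666, 9309198444066, 8209400489568, 8205087626580, 9304617149778, 9304617150003, 10335409300803]
theorem t45 : allB c45 = true := by decide +kernel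
def c46 : List ℕ := [7036874417730, 8209400489553, 9309198443826, 9309198378576, 8209668920388, 9304617149763, 8209684583763, 8209400489538, 7036874417490, 7036874417715]
theorem t46 : allB c46 = true := by decide +kernel
def c47 : List ℕ := [9309198443586, 9309198378561, 9309198439761, 9309198447411, 8209668855123, 8209684583748, 7036874417475, 8209400489298, 8209400489523, 10335409296723]
theorem t47 : allB c47 = true := by decide +kernel
def c48 : List ℕ := [10335409300548, 9309198439746, 9309198443571, 9309198378546, 9309198378321, 8209668855108, 8136384927060, 8209400489283, 9304617145683, 9304617149508]
theorem t48 : allB c48 = true := by decide +kernel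
def c49 : List ℕ := [10335409296708, 9309198378306, 9309198439731, 11361620153685, 8209686820656, 9304617145668, 7036874413395, 7036874417220, 9309198378291, 9309198439491]
theorem t49 : allB c49 = true := by decide +kernel
def c50 : List ℕ := [10330828002645, 9309197330016, 8209686820416, 8209686820641, 8209400485203, 8209400489028, 7036874413380, 9309198378051, 9300035851605, 8063085270357]
theorem t50 : allB c50 = true := by decide +kernel
def c51 : List ℕ := [9309198374226, 9309197330001, 8209686820401, 8209686820176, 8209400485188, 9309198374211, 10335409231188, 9235611342165, 7032293119317, 9309197329986]
theorem t51 : allB c51 = true := by decide +kernel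
def c52 : List ℕ := [9235897673313, 8209686820161, 8209686820386, 8209686816336, 8209667806548, 9304617080148, 8204819191125, 9309197329746, 9309197329971, 9309198435396]
theorem t52 : allB c52 = true := by decide +kernel
def c53 : List ℕ := [9235897673298, 8205105522273, 8209686820146, 8209686816321, 7036874347860, 9309197329731, 9309198373956, 9235897673283, 8205105522258, 8209686816306]
theorem t53 : allB c53 = true := by decide +kernel
def c54 : List ℕ := [8209686819906, 8209686816081, 9382499223552]
theorem t54 : allB c54 = true := by decide +kernel
def codes : List (List ℕ) := [c00, c01, c02, c03, c04, c05, c06, c07, c08, c09, c10, c11, c12, c13, c14, c15, c16, c17, c18, c19, c20, c21, c22, c23, c24, c25, c26, c27, c28, c29, c30, c31, c32, c33, c34, c35, c36, c37, c38, c39, c40, c41, c42, c43, c44, c45, c46, c47, c48, c49, c50, c51, c52, c53, c54]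
theorem codes_ok : ∀ c ∈ codes, allB c = true := by
  simp only [codes, List.forall_mem_cons]
  exact ⟨t00, t01, t02, t03, t04, t05, t06, t07, t08, t09, t10, t11, t12, t13, t14, t15, t16, t17, t18, t19, t20, t21, t22, t23, t24, t25, t26, t27, t28, t29, t30, t31, t32, t33, t34, t35, t36, t37, t38, t39, t40, t41, t42, t43, t44, t45, t46, t47, t48, t49, t50, t51, t52, t53, t54, by simp⟩
end E11B

namespace E11B
section enumer

theorem allB_sound (c : List ℕ) (h : allB c = true) : ∀ n ∈ c, chk (dec n) = true := by
  induction c with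
  | nil => simp
  | cons a c ih =>
    have e : allB (a :: c) = cond (chk (dec a)) (allB c) false := rfl
    rw [e] at h
    cases hc : chk (dec a) with
    | false => rw [hc] at h; exact absurd h (by simp)
    | true =>
      rw [hc] at h
      intro n hn
      rcases List.mem_cons.1 hn with rfl | hn
      · exact hc
      · exact ih h n hn

def enm (ws : List ℕ) : (List ℕ → Bool) → ℕ → Bool :=
  List.rec (fun leaf _ => leaf []) (fun w _ ih leaf b =>
    nrec (Nat.succ (Nat.div b w)) true fun d acc =>
      cond (force (Nat.sub b (Nat.mul w d)) fun b' => ih (fun ds => leaf (d :: ds)) b') acc false) ws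

def dot : List ℕ → List ℕ → ℕ
  | w :: ws, d :: ds => w * d + dot ws ds
  | _, _ => 0

theorem nrec_all (n : ℕ) (f : ℕ → Bool) (h : (nrec n true fun d acc => cond (f d) acc false) = true) :
    ∀ d, d < n → f d = true := by
  induction n with
  | zero => intro d hd; omega
  | succ n ih =>
    rw [nrec_succ] at h
    cases hc : f n with
    | false => rw [hc] at h; exact absurd h (by simp)
    | true =>
      rw [hc] at h
      intro d hd
      rcases Nat.lt_succ_iff_lt_or_eq.1 hd with hd | rfl
      · exact ih h d hd
      · exact hc

theorem enm_sound (ws : List ℕ) (hw : ∀ w ∈ ws, 0 < w) (leaf : List ℕ → Bool) (b : ℕ)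
    (h : enm ws leaf b = true) (ds : List ℕ) (hl : ds.length = ws.length) (hb : dot ws ds ≤ b) :
    leaf ds = true := by
  induction ws generalizing leaf b ds with
  | nil =>
    rw [List.length_eq_zero_iff.1 hl]; exact h
  | cons w ws ih =>
    cases ds with
    | nil => simp at hl
    | cons d ds =>
      have hw0 : 0 < w := hw w (by simp)
      have e : enm (w :: ws) leaf b = nrec (Nat.succ (Nat.div b w)) true fun d acc =>
        cond (force (Nat.sub b (Nat.mul w d)) fun b' => enm ws (fun ds => leaf (d :: ds)) b') acc false := rfl
      rw [e] at h
      rw [dot] at hb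
      have hd : d < Nat.succ (Nat.div b w) :=
        Nat.lt_succ_of_le ((Nat.le_div_iff_mul_le hw0).2 (by rw [mul_comm]; omega))
      have := nrec_all _ _ h d hd
      rw [force_eq] at this
      refine ih (fun w hw' => hw w (by simp [hw'])) _ _ this ds (by simpa using hl) ?_
      show dot ws ds ≤ b - w * d
      omega

def memN (n : ℕ) (l : List ℕ) : Bool := lrec l false fun a s => cond (Nat.beq a n) true s
def memNN (n : ℕ) (l : List (List ℕ)) : Bool := lrec l false fun a s => cond (memN n a) true s

theorem memN_sound (n : ℕ) (l : List ℕ) (h : memN n l = true) : n ∈ l := by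
  induction l with
  | nil => exact absurd h (by simp [memN, lrec_nil])
  | cons a l ih =>
    rw [memN, lrec_cons] at h
    cases hc : Nat.beq a n with
    | true => rw [Nat.beq_eq] at hc; simp [hc]
    | false => rw [hc] at h; exact List.mem_cons_of_mem _ (ih h)

theorem memNN_sound (n : ℕ) (l : List (List ℕ)) (h : memNN n l = true) : ∃ c ∈ l, n ∈ c := by
  induction l with
  | nil => exact absurd h (by simp [memNN, lrec_nil])
  | cons a l ih =>
    rw [memNN, lrec_cons] at h
    cases hc : memN n a with
    | true => exact ⟨a, by simp, memN_sound _ _ hc⟩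
    | false =>
      rw [hc] at h
      obtain ⟨c, h1, h2⟩ := ih h
      exact ⟨c, List.mem_cons_of_mem _ h1, h2⟩

def enc (as : List ℕ) : ℕ := lrec as 0 fun a s => Nat.add a (Nat.mul 16 s)

def lbeq : List ℕ → List ℕ → Bool
  | [], [] => true
  | a :: l, b :: l' => cond (Nat.beq a b) (lbeq l l') false
  | _, _ => false

theorem lbeq_sound (l l' : List ℕ) (h : lbeq l l' = true) : l = l' := by
  induction l generalizing l' with
  | nil => cases l' <;> simp [lbeq] at h ⊢
  | cons a l ih =>
    cases l' with
    | nil => simp [lbeq] at h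
    | cons b l' =>
      rw [lbeq] at h
      cases hc : Nat.beq a b with
      | true =>
        rw [hc] at h
        rw [Nat.beq_eq] at hc
        rw [hc, ih l' h]
      | false => rw [hc] at h; exact absurd h (by simp)

def fin1 (as : List ℕ) : Bool := force (enc as) fun c =>
  cond (lbeq (dec c) as) (cond (Nat.beq c 0) true (memNN c codes)) false

def leafB (d0 d1 d2 d3 d4 d5 d6 d7 d8 d9 d10 : ℕ) : Bool :=
    force (3*d0+d3+2*d4+3*d5+4*d6+5*d7+6*d8+4*d9+2*d10) fun R =>
    cond (Nat.ble d1 R) (cond (Nat.beq ((R - d1) % 2) 0)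
      (force ((R - d1) / 2) fun a0 => force (a0 + d1) fun a1 => force (a1 + d2) fun a2 =>
       force (a2 + d3) fun a3 => force (a3 + d4) fun a4 => force (a4 + d5) fun a5 => force (a5 + d6) fun a6 =>
       force (a6 + d7) fun a7 => force (a7 + d8) fun a8 => force (a8 + d9) fun a9 => force (a9 + d10) fun a10 =>
       fin1 [a0, a1, a2, a3, a4, a5, a6, a7, a8, a9, a10]) true) true

def leaf1 : List ℕ → Bool
  | [d0, d1, d2, d3, d4, d5, d6, d7, d8, d9, d10] => leafB d0 d1 d2 d3 d4 d5 d6 d7 d8 d9 d10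
  | _ => true

def wts : List ℕ := [143, 29, 60, 93, 128, 165, 204, 245, 288, 190, 94]

theorem enum_ok : enm wts leaf1 480 = true := by decide +kernel

theorem dom_ineq {β : Fin 11 → ℤ} (hβ : 0 < β) (hd : ∀ i, E11M.mulVec β i ≤ 0) :
    0 ≤ aa β 0 ∧ aa β 0 ≤ aa β 1 ∧ aa β 1 ≤ aa β 2 ∧ aa β 2 ≤ aa β 3 ∧ aa β 3 ≤ aa β 4 ∧ aa β 4 ≤ aa β 5 ∧
    aa β 5 ≤ aa β 6 ∧ aa β 6 ≤ aa β 7 ∧ aa β 7 ≤ aa β 8 ∧ aa β 8 ≤ aa β 9 ∧ aa β 9 ≤ aa β 10 ∧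
    aa β 8 + aa β 9 + aa β 10 ≤ β 10 := by
  obtain ⟨g0, g1, g2, g3, g4, g5, g6, g7, g8, g9, g10⟩ := E11_mulVec β
  obtain ⟨e0, e1, e2, e3, e4, e5, e6, e7, e8, e9, e10⟩ := aa_vals β
  rw [e0, e1, e2, e3, e4, e5, e6, e7, e8, e9, e10]
  refine ⟨hβ.le 0, ?_, ?_, ?_, ?_, ?_, ?_, ?_, ?_, ?_, ?_, ?_⟩
  · linarith [hd 0]
  · linarith [hd 1]
  · linarith [hd 2]
  · linarith [hd 3]
  · linarith [hd 4]
  · linarith [hd 5]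
  · linarith [hd 6]
  · linarith [hd 7]
  · linarith [hd 8]
  · linarith [hd 9]
  · linarith [hd 10]

theorem fin1_of (a0 a1 a2 a3 a4 a5 a6 a7 a8 a9 a10 l : ℕ) (h1 : a0 ≤ a1) (h2 : a1 ≤ a2) (h3 : a2 ≤ a3)
    (h4 : a3 ≤ a4) (h5 : a4 ≤ a5) (h6 : a5 ≤ a6) (h7 : a6 ≤ a7) (h8 : a7 ≤ a8) (h9 : a8 ≤ a9) (h10 : a9 ≤ a10)
    (h0 : a8 + a9 + a10 ≤ l) (hs : a0 + a1 + a2 + a3 + a4 + a5 + a6 + a7 + a8 + a9 + a10 = 3 * l)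
    (hh : 10 * a0 + 9 * a1 + 8 * a2 + 7 * a3 + 6 * a4 + 5 * a5 + 4 * a6 + 3 * a7 + 2 * a8 + a9 ≤ 240 + 2 * l) :
    fin1 [a0, a1, a2, a3, a4, a5, a6, a7, a8, a9, a10] = true := by
  obtain ⟨d1, rfl⟩ := Nat.exists_eq_add_of_le h1
  obtain ⟨d2, rfl⟩ := Nat.exists_eq_add_of_le h2
  obtain ⟨d3, rfl⟩ := Nat.exists_eq_add_of_le h3
  obtain ⟨d4, rfl⟩ := Nat.exists_eq_add_of_le h4
  obtain ⟨d5, rfl⟩ := Nat.exists_eq_add_of_le h5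
  obtain ⟨d6, rfl⟩ := Nat.exists_eq_add_of_le h6
  obtain ⟨d7, rfl⟩ := Nat.exists_eq_add_of_le h7
  obtain ⟨d8, rfl⟩ := Nat.exists_eq_add_of_le h8
  obtain ⟨d9, rfl⟩ := Nat.exists_eq_add_of_le h9
  obtain ⟨d10, rfl⟩ := Nat.exists_eq_add_of_le h10
  obtain ⟨d0, rfl⟩ := Nat.exists_eq_add_of_le h0
  clear h0 h1 h2 h3 h4 h5 h6 h7 h8 h9 h10
  have hR : 3*d0+d3+2*d4+3*d5+4*d6+5*d7+6*d8+4*d9+2*d10 = d1 + 2 * a0 := by linarith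
  have key := enm_sound wts (by decide) leaf1 480 enum_ok [d0, d1, d2, d3, d4, d5, d6, d7, d8, d9, d10] rfl
     (by simp only [dot, wts]; linarith)
  clear hs hh
  change leafB d0 d1 d2 d3 d4 d5 d6 d7 d8 d9 d10 = true at key
  have q1 : Nat.ble d1 (d1 + 2 * a0) = true := by rw [Nat.ble_eq]; exact Nat.le_add_right _ _
  have q2 : d1 + 2 * a0 - d1 = 2 * a0 := by clear hR; omega
  have q3 : (2 * a0) % 2 = 0 := by clear hR; omega
  have q4 : (2 * a0) / 2 = a0 := by clear hR; omega
  have q5 : Nat.beq 0 0 = true := rfl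
  rw [leafB, force_eq, hR, q1, q2, q3, q4, q5, cond_true, cond_true, force_eq, force_eq, force_eq, force_eq,
    force_eq, force_eq, force_eq, force_eq, force_eq, force_eq, force_eq] at key
  exact key

theorem dom_mem {β : Fin 11 → ℤ} (hβ : 0 < β) (hd : ∀ i, E11M.mulVec β i ≤ 0) (hh : ht β ≤ 240) :
    bil E11M β β ≤ 0 ∧ (∀ l, 0 ≤ aa β l) ∧ 1 ≤ β 10 ∧ chk (lst (ab β)) = true := by
  have h1 : bil E11M β β ≤ 0 := by
    rw [bil]
    exact Finset.sum_nonpos fun i _ => mul_nonpos_of_nonneg_of_nonpos (hβ.le i) (hd i)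
  have hb0 : ∀ i, 0 ≤ β i := fun i => hβ.le i
  have hs := aa_sum β
  rw [s11] at hs
  obtain ⟨i0, i1, i2, i3, i4, i5, i6, i7, i8, i9, i10, i11⟩ := dom_ineq hβ hd
  have h2 : ∀ l, 0 ≤ aa β l := by apply all11 <;> linarith
  have hβn : ∀ l, ((ab β l : ℕ) : ℤ) = aa β l := fun l => Int.toNat_of_nonneg (h2 l)
  have hne : ∃ l, ab β l ≠ 0 := by
    by_contra hc
    push Not at hc
    have : β = 0 := aa_inj (by
      funext i; rw [← hβn, hc]
      obtain ⟨e0, e1, e2, e3, e4, e5, e6, e7, e8, e9, e10⟩ := aa_vals 0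
      revert i
      apply all11 <;> simp [*])
    exact hβ.ne' this
  have h3 : 1 ≤ β 10 := by
    by_contra hc
    have hz : β 10 = 0 := le_antisymm (by omega) (hb0 10)
    obtain ⟨l, hl⟩ := hne
    have hs' := aa_sum β
    rw [hz] at hs'
    have := (Finset.sum_eq_zero_iff_of_nonneg (fun i _ => h2 i)).1 (by linarith) l (Finset.mem_univ _)
    have := hβn l
    omega
  refine ⟨h1, h2, h3, ?_⟩
  have hht := ht_aa β
  have n0 := hβn 0; have n1 := hβn 1; have n2 := hβn 2; have n3 := hβn 3; have n4 := hβn 4; have n5 := hβn 5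
  have n6 := hβn 6; have n7 := hβn 7; have n8 := hβn 8; have n9 := hβn 9; have n10 := hβn 10
  obtain ⟨l, hl⟩ := Int.eq_ofNat_of_zero_le (show 0 ≤ β 10 by omega)
  rw [hht, hl, ← n0, ← n1, ← n2, ← n3, ← n4, ← n5, ← n6, ← n7, ← n8, ← n9] at hh
  rw [hl, ← n0, ← n1, ← n2, ← n3, ← n4, ← n5, ← n6, ← n7, ← n8, ← n9, ← n10] at hs
  rw [← n0, ← n1] at i1
  rw [← n1, ← n2] at i2
  rw [← n2, ← n3] at i3
  rw [← n3, ← n4] at i4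
  rw [← n4, ← n5] at i5
  rw [← n5, ← n6] at i6
  rw [← n6, ← n7] at i7
  rw [← n7, ← n8] at i8
  rw [← n8, ← n9] at i9
  rw [← n9, ← n10] at i10
  rw [hl, ← n8, ← n9, ← n10] at i11
  have hh' : 10 * (ab β 0 : ℤ) + 9 * ab β 1 + 8 * ab β 2 + 7 * ab β 3 + 6 * ab β 4 + 5 * ab β 5 + 4 * ab β 6 +
    3 * ab β 7 + 2 * ab β 8 + ab β 9 ≤ 240 + 2 * l := by linarith
  have hfin : fin1 (lst (ab β)) = true :=
    fin1_of _ _ _ _ _ _ _ _ _ _ _ l (by exact_mod_cast i1) (by exact_mod_cast i2) (by exact_mod_cast i3)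
      (by exact_mod_cast i4) (by exact_mod_cast i5) (by exact_mod_cast i6) (by exact_mod_cast i7)
      (by exact_mod_cast i8) (by exact_mod_cast i9) (by exact_mod_cast i10) (by exact_mod_cast i11)
      (by exact_mod_cast hs) (by exact_mod_cast hh')
  rw [fin1, force_eq] at hfin
  cases hc : lbeq (dec (enc (lst (ab β)))) (lst (ab β)) with
  | false => rw [hc] at hfin; exact absurd hfin (by simp)
  | true =>
    rw [hc, cond_true] at hfin
    have hdec := lbeq_sound _ _ hc
    cases hz : Nat.beq (enc (lst (ab β))) 0 with
    | true =>
      rw [Nat.beq_eq] at hz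
      rw [hz] at hdec
      obtain ⟨i, hi⟩ := hne
      have h0 : dec 0 = lst (fun _ => 0) := by decide +kernel
      rw [h0] at hdec
      exact absurd (congrFun (lst_inj hdec) i).symm hi
    | false =>
      rw [hz, cond_false] at hfin
      obtain ⟨c, hc1, hc2⟩ := memNN_sound _ _ hfin
      have := allB_sound c (codes_ok c hc1) _ hc2
      rwa [hdec] at this

end enumer
end E11B

namespace E11B
section parts
open scoped Classical

/-- weight of a coloured partition -/
def pw (f : ℕ+ × Fin 9 →₀ ℕ) : ℕ := ∑ p ∈ f.support, (p.1 : ℕ) * f p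

theorem pw_eq (f : ℕ+ × Fin 9 →₀ ℕ) : pw f = f.sum fun p m => (p.1 : ℕ) * m := rfl

theorem pw_add_single (f : ℕ+ × Fin 9 →₀ ℕ) (x : ℕ+ × Fin 9) :
    pw (f + Finsupp.single x 1) = pw f + (x.1 : ℕ) := by
  rw [pw_eq, Finsupp.sum_add_index' (by simp) (by intros; ring), Finsupp.sum_single_index (by simp), mul_one]
  rfl

/-- rows -/
def goR (j : ℕ) (l : List ℕ) : List ℕ → List ℕ :=
  List.rec (fun acc => acc.reverse) (fun a _ ih acc =>
    force (Nat.add a (acc.getD (Nat.pred j) 0)) fun v => ih (v :: acc)) l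

def rowsR (js : List ℕ) : List ℕ := lrec js (1 :: List.replicate 35 0) fun j r => goR j r []

/-- there are at least `v` partitions of `k` with parts in `xs` -/
def GE (xs : List (ℕ+ × Fin 9)) (k v : ℕ) : Prop :=
  ∃ F : Finset (ℕ+ × Fin 9 →₀ ℕ), F.card = v ∧ ∀ f ∈ F, (∀ p, p ∉ xs → f p = 0) ∧ pw f = k

theorem GE_zero (xs : List (ℕ+ × Fin 9)) (k : ℕ) : GE xs k 0 := ⟨∅, rfl, by simp⟩

theorem GE_cons {xs : List (ℕ+ × Fin 9)} {x : ℕ+ × Fin 9} (hx : x ∉ xs) {k v : ℕ} (h : GE xs k v) :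
    GE (x :: xs) k v := by
  obtain ⟨F, h1, h2⟩ := h
  refine ⟨F, h1, fun f hf => ⟨fun p hp => (h2 f hf).1 p fun hh => hp (by simp [hh]), (h2 f hf).2⟩⟩

theorem GE_add {xs : List (ℕ+ × Fin 9)} {x : ℕ+ × Fin 9} (hx : x ∉ xs) {k v w : ℕ} (h : GE xs (k + x.1) v)
    (h' : GE (x :: xs) k w) : GE (x :: xs) (k + x.1) (v + w) := by
  obtain ⟨F, h1, h2⟩ := h
  obtain ⟨G, g1, g2⟩ := h'
  refine ⟨F ∪ G.image (· + Finsupp.single x 1), ?_, ?_⟩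
  · rw [Finset.card_union_of_disjoint, h1, Finset.card_image_of_injective _ (add_left_injective _), g1]
    rw [Finset.disjoint_left]
    intro f hf hg
    obtain ⟨g, hg, rfl⟩ := Finset.mem_image.1 hg
    have := (h2 _ hf).1 x hx
    simp at this
  · intro f hf
    rcases Finset.mem_union.1 hf with hf | hf
    · exact ⟨fun p hp => (h2 f hf).1 p fun hh => hp (by simp [hh]), (h2 f hf).2⟩
    · obtain ⟨g, hg, rfl⟩ := Finset.mem_image.1 hf
      refine ⟨fun p hp => ?_, ?_⟩
      · have a := (g2 g hg).1 p hp
        have : p ≠ x := fun hh => hp (by simp [hh])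
        simp [a, Finsupp.single_apply, this.symm]
      · rw [pw_add_single, (g2 g hg).2]

theorem goR_spec {xs : List (ℕ+ × Fin 9)} {x : ℕ+ × Fin 9} (hx : x ∉ xs) (l acc : List ℕ)
    (hl : ∀ i v, l[i]? = some v → GE xs (acc.length + i) v)
    (ha : ∀ i v, acc[i]? = some v → GE (x :: xs) (acc.length - 1 - i) v) :
    ∀ i v, (goR x.1 l acc)[i]? = some v → GE (x :: xs) i v := by
  induction l generalizing acc with
  | nil =>
    intro i v h
    have e : goR x.1 [] acc = acc.reverse := rfl
    rw [e] at h
    have hi : i < acc.length := by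
      have := (List.getElem?_eq_some_iff.1 h).1
      simpa using this
    rw [List.getElem?_reverse hi] at h
    have := ha _ _ h
    have e : acc.length - 1 - (acc.length - 1 - i) = i := by omega
    rwa [e] at this
  | cons a l ih =>
    have e : goR x.1 (a :: l) acc = force (a + acc.getD (Nat.pred x.1) 0) fun v => goR x.1 l (v :: acc) := rfl
    rw [e, force_eq]
    have hj : 1 ≤ (x.1 : ℕ) := x.1.one_le
    have h0 : GE xs acc.length a := by have := hl 0 a (by simp); simpa using this
    refine ih (_ :: acc) ?_ ?_
    · intro i v hv
      have := hl (i + 1) v (by simpa using hv)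
      rw [List.length_cons]
      convert this using 1
      omega
    · intro i v hv
      cases i with
      | zero =>
        simp only [List.getElem?_cons_zero, Option.some.injEq] at hv
        rw [← hv, List.length_cons]
        have hk : acc.length + 1 - 1 - 0 = acc.length := by omega
        rw [hk, List.getD_eq_getElem?_getD]
        cases hc : acc[Nat.pred x.1]? with
        | none => exact GE_cons hx h0
        | some w =>
          have h1 := ha _ _ hc
          have h2 := (List.getElem?_eq_some_iff.1 hc).1
          rw [Nat.pred_eq_sub_one] at h1 h2
          have h3 : acc.length = (acc.length - 1 - (x.1 - 1)) + x.1 := by omega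
          rw [h3] at h0 ⊢
          exact GE_add hx h0 h1
      | succ i =>
        rw [List.getElem?_cons_succ] at hv
        have := ha i v hv
        rw [List.length_cons]
        convert this using 1
        omega

theorem rowsR_spec (xs : List (ℕ+ × Fin 9)) (hx : xs.Nodup) :
    ∀ i v, (rowsR (xs.map fun p => (p.1 : ℕ)))[i]? = some v → GE xs i v := by
  induction xs with
  | nil =>
    intro i v h
    have e : rowsR (List.map (fun p : ℕ+ × Fin 9 => (p.1 : ℕ)) []) = 1 :: List.replicate 35 0 := rfl
    rw [e] at h
    cases i with
    | zero =>
      simp only [List.getElem?_cons_zero, Option.some.injEq] at h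
      rw [← h]
      exact ⟨{0}, rfl, by simp [pw]⟩
    | succ i =>
      rw [List.getElem?_cons_succ] at h
      have := List.eq_of_mem_replicate (List.mem_of_getElem? h)
      rw [this]
      exact GE_zero _ _
  | cons x xs ih =>
    rw [List.nodup_cons] at hx
    have e : rowsR (List.map (fun p : ℕ+ × Fin 9 => (p.1 : ℕ)) (x :: xs)) =
      goR x.1 (rowsR (xs.map fun p => (p.1 : ℕ))) [] := rfl
    rw [e]
    refine goR_spec hx.1 _ [] ?_ (by simp)
    intro i v h
    simpa using ih hx.2 i v h

def xs0 : List (ℕ+ × Fin 9) := (List.range 35 ×ˢ List.finRange 9).map fun x => (x.1.succPNat, x.2)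

theorem xs0_nodup : xs0.Nodup := by
  refine List.Nodup.map ?_ (List.Nodup.product (List.nodup_range) (List.nodup_finRange 9))
  intro x y h
  simp only [Prod.mk.injEq] at h
  exact Prod.ext (Nat.succPNat_injective h.1) h.2

def js0 : List ℕ := nrec 315 [] fun n ih => Nat.succ (Nat.div (Nat.sub 314 n) 9) :: ih

theorem js0_eq : xs0.map (fun p => (p.1 : ℕ)) = js0 := by decide +kernel

def cmpR (l : List ℕ) : ℕ → Bool := List.rec (fun k => Nat.ble 36 k) (fun a _ ih k => cond (Nat.ble (uu k) a) (ih (Nat.succ k)) false) l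

theorem cmpR_sound (l : List ℕ) (k : ℕ) (h : cmpR l k = true) (i : ℕ) (hi : k + i < 36) :
    ∃ v, l[i]? = some v ∧ uu (k + i) ≤ v := by
  induction l generalizing k i with
  | nil =>
    have h' : Nat.ble 36 k = true := h
    rw [Nat.ble_eq] at h'
    omega
  | cons a l ih =>
    have e : cmpR (a :: l) k = cond (Nat.ble (uu k) a) (cmpR l (k + 1)) false := rfl
    rw [e] at h
    cases hc : Nat.ble (uu k) a with
    | false => rw [hc] at h; exact absurd h (by simp)
    | true =>
      rw [hc] at h
      rw [Nat.ble_eq] at hc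
      cases i with
      | zero => exact ⟨a, by simp, hc⟩
      | succ i =>
        obtain ⟨v, h1, h2⟩ := ih (k + 1) h i (by omega)
        refine ⟨v, by simpa using h1, ?_⟩
        have : k + (i + 1) = k + 1 + i := by omega
        rwa [this]

theorem cmp_ok : cmpR (rowsR js0) 0 = true := by decide +kernel

theorem uu_big (k : ℕ) (hk : 36 ≤ k) : uu k = 0 := by
  have h1 : uu k = (uTab >>> (48 * k)) &&& 281474976710655 := rfl
  have h2 : uTab < 2 ^ (48 * 36) := by decide +kernel
  have h3 : uTab < 2 ^ (48 * k) := lt_of_lt_of_le h2 (Nat.pow_le_pow_right (by norm_num) (by omega))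
  rw [h1, Nat.shiftRight_eq_div_pow, Nat.div_eq_of_lt h3, Nat.zero_and]

theorem fin_parts (k : ℕ) : {f : ℕ+ × Fin 9 →₀ ℕ | pw f = k}.Finite := by
  set S : Finset (ℕ+ × Fin 9) := Finset.Icc 1 k.succPNat ×ˢ Finset.univ with hS
  set g : ℕ+ × Fin 9 →₀ ℕ := Finsupp.onFinset S (fun p => if p ∈ S then k else 0)
    (by intro p hp; by_contra hc; simp [hc] at hp) with hg
  refine (Set.finite_Icc (0 : ℕ+ × Fin 9 →₀ ℕ) g).subset ?_
  intro f hf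
  refine ⟨fun p => Nat.zero_le _, fun p => ?_⟩
  have hf' : pw f = k := hf
  by_cases hp : p ∈ f.support
  · have h1 : (p.1 : ℕ) * f p ≤ k := by
      rw [← hf', pw]
      exact Finset.single_le_sum (f := fun p : ℕ+ × Fin 9 => (p.1 : ℕ) * f p) (fun _ _ => Nat.zero_le _) hp
    have h2 : f p ≠ 0 := Finsupp.mem_support_iff.1 hp
    have h3 : 1 ≤ (p.1 : ℕ) := p.1.one_le
    have h4 : p ∈ S := by
      rw [hS, Finset.mem_product, Finset.mem_Icc]
      refine ⟨⟨p.1.one_le, ?_⟩, Finset.mem_univ _⟩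
      rw [← PNat.coe_le_coe, Nat.succPNat_coe]
      have : 1 ≤ f p := by omega
      nlinarith
    rw [hg, Finsupp.onFinset_apply, if_pos h4]
    nlinarith
  · rw [Finsupp.notMem_support_iff.1 hp]; exact Nat.zero_le _

theorem uu_le (k : ℕ) : uu k ≤ coloredPartitions 9 (k : ℤ) := by
  rcases le_or_gt 36 k with hk | hk
  · rw [uu_big k hk]; exact Nat.zero_le _
  obtain ⟨v, h1, h2⟩ := cmpR_sound _ 0 cmp_ok k (by omega)
  rw [zero_add] at h2
  rw [← js0_eq] at h1
  obtain ⟨F, hF, hF'⟩ := rowsR_spec xs0 xs0_nodup k v h1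
  refine h2.trans ?_
  have e : coloredPartitions 9 (k : ℤ) = Nat.card {f : ℕ+ × Fin 9 →₀ ℕ // pw f = k} := by
    rw [coloredPartitions, if_neg (by omega)]; rfl
  have hc := Set.ncard_le_ncard (s := (F : Set (ℕ+ × Fin 9 →₀ ℕ))) (t := {f | pw f = k})
    (fun f hf => (hF' f hf).2) (fin_parts k)
  rw [Set.ncard_coe_finset] at hc
  rw [e, ← hF]
  exact hc

end parts
end E11B

namespace E11B
section main

theorem kN_congr {n m : Fin 11 → ℤ} (h : bil E11M n n = bil E11M m m) : kN n = kN m := by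
  rw [kN, kN, h]

theorem main_root (n : Fin 11 → ℤ) (hn : 0 < n) (h0 : mul' E11M (gH E11M) n ≠ 0) :
    ht n ≤ 240 → mul' E11M (gH E11M) n ≤ uu (kN n) := by
  have S := KM_std E11_SLM
  obtain ⟨δ, C⟩ := KM_coc E11_SLM
  refine root_ind S (fun n => ht n ≤ 240 → mul' E11M (gH E11M) n ≤ uu (kN n)) ?_ ?_ ?_ n hn h0
  · intro i _
    have hb : bil E11M (Pi.single i 1) (Pi.single i 1) = 2 := by
      rw [bil_single_left]
      simp [Matrix.mulVec_single, S.diag]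
    have hk : kN (Pi.single i 1) = 0 := by rw [kN, hb]; rfl
    rw [hk, uu_zero]
    exact mul'_simple S i
  · intro β hβ _ hd ih hh
    obtain ⟨hb, h1, h2, h3⟩ := dom_mem hβ hd hh
    refine dom_bound S C hβ hb h1 h2 ?_ h3
    intro μ hμ hlt
    by_cases hz : mul' E11M (gH E11M) μ = 0
    · rw [hz]; exact Nat.zero_le _
    have hht : ht μ < ht β := by
      obtain ⟨hle, i, hi⟩ := Pi.lt_def.1 hlt
      exact Finset.sum_lt_sum (fun j _ => hle j) ⟨i, Finset.mem_univ _, hi⟩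
    have hA : Adm μ := ⟨root_norm S μ hμ hz, fun hl j => root_nonneg S μ hμ hz hl j⟩
    rw [UU, if_pos hA]
    exact ih μ hμ hz hht (hht.le.trans hh)
  · intro m i hm _ _ _ hle hht ih hh
    have := ih (hht.le.trans hh)
    rw [kN_congr (bil_sub_single E11_SLM m i)] at this
    exact hle.trans this

theorem qform_bil (n : Fin 11 → ℕ) :
    qform E11M n = bil E11M (fun i => (n i : ℤ)) (fun i => (n i : ℤ)) := by
  simp only [qform, bil, Matrix.mulVec, dotProduct, Finset.mul_sum, mul_assoc]

theorem main_bound (n : Fin 11 → ℕ) (hn : n ≠ 0) (hh : ∑ i, n i ≤ 240) (hq : qform E11M n ≤ 2) :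
    rootMult E11M (fun i => (n i : ℤ)) ≤ coloredPartitions 9 (1 - qform E11M n / 2) := by
  change mul' E11M (gH E11M) (fun i => (n i : ℤ)) ≤ _
  by_cases h0 : mul' E11M (gH E11M) (fun i => (n i : ℤ)) = 0
  · rw [h0]; exact Nat.zero_le _
  have hpos : (0 : Fin 11 → ℤ) < fun i => (n i : ℤ) := by
    rw [Pi.lt_def]
    refine ⟨fun i => Int.natCast_nonneg _, ?_⟩
    obtain ⟨i, hi⟩ := Function.ne_iff.1 hn
    refine ⟨i, ?_⟩
    have : n i ≠ 0 := hi
    simp only [Pi.zero_apply]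
    omega
  have hht : ht (fun i => (n i : ℤ)) ≤ 240 := by
    rw [ht]; exact_mod_cast hh
  have h1 := main_root _ hpos h0 hht
  have h2 : 1 - qform E11M n / 2 = (kN (fun i => (n i : ℤ)) : ℤ) := by
    rw [qform_bil] at hq ⊢
    have := kN_eq hq
    omega
  rw [h2]
  exact h1.trans (uu_le _)

end main
end E11B

/-- **Upper bound on `E11` root multiplicities up to height 240.** Every nonzero
`n ∈ ℕ¹¹` of height at most `240` with `nᵀ A(E11) n ≤ 2` satisfies
`mult n ≤ p₉(1 − nᵀ A(E11) n / 2)`. -/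
theorem e11_mult_upper_bound :
    ∀ n : Fin 11 → ℕ, n ≠ 0 → ∑ i, n i ≤ 240 → qform E11M n ≤ 2 →
      rootMult E11M (fun i => (n i : ℤ)) ≤ coloredPartitions 9 (1 - qform E11M n / 2) := by
  exact E11B.main_bound
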